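/- arXiv:1701.07942 — 3 statements merged into one kernel-verified Lean document; each statement's English description precedes it below -/
import Mathlib

section
/- Let U ⊆ ℂ be a connected open set and let γ : U → ℂ⁴ be a continuous map which is not identically zero on U and which is holomorphic (complex differentiable) at every point of the open set {z ∈ U : γ(z) ≠ 0}. Then the zero set γ⁻¹(0) = {z ∈ U : γ(z) = 0} is locally finite in U; that is, γ⁻¹(0) has no accumulation point in U, and its intersection with every compact subset of U is finite. -/
open Filter

lemma rado_maxp (c : ℂ) (r M K : ℝ) (f g : ℂ → ℂ)
    (hf : ContinuousOn f (Metric.closedBall c r))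
    (hfd : ∀ z ∈ Metric.ball c r, f z ≠ 0 → DifferentiableAt ℂ f z)
    (hg : ContinuousOn g {z ∈ Metric.closedBall c r | f z ≠ 0})
    (hgd : ∀ z ∈ Metric.ball c r, f z ≠ 0 → DifferentiableAt ℂ g z)
    (hK : ∀ z ∈ Metric.closedBall c r, f z ≠ 0 → ‖g z‖ ≤ K)
    (hM0 : 0 ≤ M)
    (hM : ∀ z ∈ Metric.sphere c r, f z ≠ 0 → ‖g z‖ ≤ M) :
    ∀ z ∈ Metric.ball c r, f z ≠ 0 → ‖g z‖ ≤ M := by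
  intro z hz hfz
  obtain ⟨A, hA⟩ := (isCompact_closedBall c r).exists_bound_of_continuousOn hf
  have hAz := hA z (Metric.ball_subset_closedBall hz)
  have hfpos : 0 < ‖f z‖ := norm_pos_iff.mpr hfz
  have hApos : 0 < A := lt_of_lt_of_le hfpos hAz
  set S : Set ℂ := {x ∈ Metric.ball c r | f x ≠ 0} with hS
  have hSopen : IsOpen S :=
    (hf.mono Metric.ball_subset_closedBall).isOpen_inter_preimage Metric.isOpen_ball
      (isOpen_compl_singleton (x := (0 : ℂ)))
  have hScl : closure S ⊆ Metric.closedBall c r :=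
    closure_minimal (fun x hx => Metric.ball_subset_closedBall hx.1) Metric.isClosed_closedBall
  have hSb : Bornology.IsBounded S := Metric.isBounded_ball.subset (fun x hx => hx.1)
  have hcontcl : ∀ n : ℕ, ContinuousOn (fun x => g x ^ n * f x) (Metric.closedBall c r) := by
    intro n x hx
    by_cases hfx : f x = 0
    · rw [ContinuousWithinAt, hfx, mul_zero]
      have h1 : Tendsto (fun y => |K| ^ n * ‖f y‖) (nhdsWithin x (Metric.closedBall c r)) (nhds 0) := by
        have := ((hf x hx).norm).const_mul (|K| ^ n)
        simpa [ContinuousWithinAt, hfx] using this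
      refine squeeze_zero_norm' ?_ h1
      filter_upwards [self_mem_nhdsWithin] with y hy
      rw [norm_mul, norm_pow]
      by_cases hfy : f y = 0
      · simp [hfy]
      · have := (hK y hy hfy).trans (le_abs_self K)
        gcongr
    · have h1 : ContinuousWithinAt g {z ∈ Metric.closedBall c r | f z ≠ 0} x := hg x ⟨hx, hfx⟩
      have h2 : ContinuousWithinAt g (Metric.closedBall c r) x := by
        refine h1.mono_of_mem_nhdsWithin ?_
        have := (hf x hx).eventually_ne hfx
        filter_upwards [self_mem_nhdsWithin, this] with y hy hy'
        exact ⟨hy, hy'⟩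
      exact (h2.pow n).mul (hf x hx)
  have key : ∀ n : ℕ, ‖g z‖ ^ n * ‖f z‖ ≤ M ^ n * A := by
    intro n
    have hd : DiffContOnCl ℂ (fun x => g x ^ n * f x) S := by
      refine ⟨fun x hx => ?_, (hcontcl n).mono hScl⟩
      exact (((hgd x hx.1 hx.2).pow n).mul (hfd x hx.1 hx.2)).differentiableWithinAt
    have := Complex.norm_le_of_forall_mem_frontier_norm_le hSb hd (C := M ^ n * A) ?_
      (subset_closure (show z ∈ S from ⟨hz, hfz⟩))
    · simpa [norm_mul, norm_pow] using this
    · intro x hx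
      have hxc := hScl hx.1
      rw [norm_mul, norm_pow]
      by_cases hfx : f x = 0
      · simp only [hfx, norm_zero, mul_zero]; positivity
      · have hxs : x ∈ Metric.sphere c r := by
          rw [hSopen.frontier_eq] at hx
          by_contra hns
          apply hx.2
          refine ⟨?_, hfx⟩
          simp only [Metric.mem_closedBall, Metric.mem_sphere, Metric.mem_ball] at *
          exact lt_of_le_of_ne hxc hns
        have h1 := hM x hxs hfx
        have h2 := hA x hxc
        gcongr
  by_contra hlt
  push Not at hlt
  have hgpos : 0 < ‖g z‖ := lt_of_le_of_lt hM0 hlt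
  have hq : M / ‖g z‖ < 1 := (div_lt_one hgpos).mpr hlt
  obtain ⟨n, hn⟩ := exists_pow_lt_of_lt_one (show 0 < ‖f z‖ / A by positivity) hq
  have := key n
  rw [div_pow, div_lt_div_iff₀ (by positivity) hApos] at hn
  linarith

lemma rado_dense (U : Set ℂ) (hU : IsOpen U) (hUc : IsPreconnected U) (f : ℂ → ℂ)
    (hf : ContinuousOn f U) (hnz : ∃ z ∈ U, f z ≠ 0)
    (hfd : ∀ z ∈ U, f z ≠ 0 → DifferentiableAt ℂ f z) :
    ∀ z ∈ U, ∀ V : Set ℂ, IsOpen V → z ∈ V → ∃ x ∈ V, f x ≠ 0 := by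
  intro z hz V hV hzV
  by_contra hcon
  push Not at hcon
  have hzW : z ∈ interior {x | f x = 0} := mem_interior.mpr ⟨V, hcon, hV, hzV⟩
  obtain ⟨y, hy, hfy⟩ := hnz
  refine hfy (interior_subset (s := {x | f x = 0}) ?_)
  refine hUc.subset_of_closure_inter_subset isOpen_interior ⟨z, hz, hzW⟩ ?_ hy
  rintro b ⟨hbc, hbU⟩
  by_contra hbW
  obtain ⟨r, hr, hrU⟩ := Metric.nhds_basis_closedBall.mem_iff.mp (hU.mem_nhds hbU)
  obtain ⟨a, haW, hab⟩ := Metric.mem_closure_iff.mp hbc (r / 4) (by positivity)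
  have : ∃ z0 ∈ Metric.ball b (r / 4), f z0 ≠ 0 := by
    by_contra h
    push Not at h
    exact hbW (mem_interior.mpr ⟨_, h, Metric.isOpen_ball, Metric.mem_ball_self (by positivity)⟩)
  obtain ⟨z0, hz0, hfz0⟩ := this
  obtain ⟨ρ, hρ, hρW⟩ := Metric.isOpen_iff.mp isOpen_interior a haW
  have hfar : ∀ x, f x ≠ 0 → ρ ≤ ‖x - a‖ := by
    intro x hx
    by_contra h
    push Not at h
    exact hx (interior_subset (s := {x | f x = 0}) (hρW (by rwa [Metric.mem_ball, dist_eq_norm])))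
  have hne : ∀ x, f x ≠ 0 → x - a ≠ 0 := fun x hx => norm_pos_iff.mp (hρ.trans_le (hfar x hx))
  have hz0' : dist z0 b < r / 4 := hz0
  have := rado_maxp b r (1 / (3 * r / 4)) (1 / ρ) f (fun x => (x - a)⁻¹) (hf.mono hrU)
    (fun x hx => hfd x (hrU (Metric.ball_subset_closedBall hx)))
    (ContinuousOn.inv₀ (by fun_prop) (fun x hx => hne x hx.2))
    (fun x hx hfx => DifferentiableAt.inv (by fun_prop) (hne x hfx))
    (fun x hx hfx => by
      rw [norm_inv, ← one_div]
      exact one_div_le_one_div_of_le hρ (hfar x hfx))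
    (by positivity)
    (fun x hx hfx => by
      rw [norm_inv, ← one_div]
      refine one_div_le_one_div_of_le (by positivity) ?_
      rw [Metric.mem_sphere] at hx
      rw [← dist_eq_norm]
      have := dist_triangle x a b
      rw [dist_comm] at hab
      linarith) z0 (by rw [Metric.mem_ball]; linarith) hfz0
  rw [norm_inv, ← one_div, one_div_le_one_div (norm_pos_iff.mpr (hne z0 hfz0)) (by positivity),
    ← dist_eq_norm] at this
  have h3 := dist_triangle z0 b a
  linarith

lemma rado_scalar (U : Set ℂ) (hU : IsOpen U) (hUc : IsPreconnected U) (f : ℂ → ℂ)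
    (hf : ContinuousOn f U) (hnz : ∃ z ∈ U, f z ≠ 0)
    (hfd : ∀ z ∈ U, f z ≠ 0 → DifferentiableAt ℂ f z) :
    ∀ z ∈ U, DifferentiableAt ℂ f z := by
  intro c hc
  have hdense := rado_dense U hU hUc f hf hnz hfd
  obtain ⟨r, hr, hrU⟩ := Metric.nhds_basis_closedBall.mem_iff.mp (hU.mem_nhds hc)
  have hfB := hf.mono hrU
  have hfdB : ∀ z ∈ Metric.ball c r, f z ≠ 0 → DifferentiableAt ℂ f z :=
    fun x hx => hfd x (hrU (Metric.ball_subset_closedBall hx))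
  obtain ⟨A, hA⟩ := (isCompact_closedBall c r).exists_bound_of_continuousOn hfB
  have hA0 : 0 ≤ A := (norm_nonneg _).trans (hA c (Metric.mem_closedBall_self hr.le))
  set S : Set ℂ := {x ∈ Metric.ball c r | f x ≠ 0} with hS
  have hSopen : IsOpen S :=
    (hfB.mono Metric.ball_subset_closedBall).isOpen_inter_preimage Metric.isOpen_ball
      (isOpen_compl_singleton (x := (0 : ℂ)))
  have hhalf : Metric.ball c (r / 2) ⊆ Metric.ball c r := Metric.ball_subset_ball (by linarith)
  -- properties of dslope
  have hds_cont : ∀ z ∈ S, ContinuousOn (dslope f z) (Metric.closedBall c r) := by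
    intro z hz
    refine (continuousOn_dslope ?_).mpr ⟨hfB, hfdB z hz.1 hz.2⟩
    exact mem_of_superset (Metric.isOpen_ball.mem_nhds hz.1) Metric.ball_subset_closedBall
  have hds_diff : ∀ z ∈ S, ∀ x ∈ Metric.ball c r, f x ≠ 0 → DifferentiableAt ℂ (dslope f z) x := by
    intro z hz x hx hfx
    have h1 : DifferentiableOn ℂ f S := fun y hy => (hfdB y hy.1 hy.2).differentiableWithinAt
    exact ((Complex.differentiableOn_dslope (hSopen.mem_nhds hz)).mpr h1).differentiableAt
      (hSopen.mem_nhds ⟨hx, hfx⟩)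
  have hfar : ∀ z ∈ Metric.ball c (r / 2), ∀ a ∈ Metric.sphere c r, r / 2 ≤ ‖a - z‖ := by
    intro z hz a ha
    rw [Metric.mem_ball] at hz
    rw [Metric.mem_sphere] at ha
    rw [← dist_eq_norm]
    have := dist_triangle a z c
    linarith
  have hds_sphere : ∀ z ∈ Metric.ball c (r / 2), ∀ a ∈ Metric.sphere c r,
      ‖dslope f z a‖ ≤ 4 * A / r := by
    intro z hz a ha
    have h1 := hfar z hz a ha
    have h2 : ‖a - z‖ * ‖dslope f z a‖ = ‖f a - f z‖ := by
      rw [← norm_smul, sub_smul_dslope]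
    have h3 : ‖f a - f z‖ ≤ A + A := (norm_sub_le _ _).trans
      (add_le_add (hA a (Metric.sphere_subset_closedBall ha))
        (hA z (Metric.ball_subset_closedBall (hhalf hz))))
    rw [le_div_iff₀ hr]
    have h4 : r / 2 * ‖dslope f z a‖ ≤ ‖a - z‖ * ‖dslope f z a‖ := by gcongr
    linarith
  -- Lipschitz
  have hLip : ∀ z ∈ Metric.ball c (r / 2), f z ≠ 0 → ∀ w ∈ Metric.ball c (r / 2), f w ≠ 0 →
      ‖f z - f w‖ ≤ 4 * A / r * ‖z - w‖ := by
    intro z hz hfz w hw hfw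
    have hwS : w ∈ S := ⟨hhalf hw, hfw⟩
    obtain ⟨K, hK⟩ := (isCompact_closedBall c r).exists_bound_of_continuousOn (hds_cont w hwS)
    have := rado_maxp c r (4 * A / r) K f (dslope f w) hfB hfdB
      ((hds_cont w hwS).mono (fun x hx => hx.1)) (hds_diff w hwS) (fun x hx _ => hK x hx)
      (by positivity) (fun a ha _ => hds_sphere w hw a ha) z (hhalf hz) hfz
    rw [← sub_smul_dslope, norm_smul, mul_comm]
    gcongr
  set C : ℝ := 16 * A / r ^ 2 with hC
  have hC0 : 0 ≤ C := by positivity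
  have hsecond : ∀ z ∈ Metric.ball c (r / 2), f z ≠ 0 → ∀ w ∈ Metric.ball c (r / 2), f w ≠ 0 →
      ∀ a ∈ Metric.ball c (r / 2), f a ≠ 0 →
      ‖dslope f z a - dslope f w a‖ ≤ C * ‖z - w‖ := by
    intro z hz hfz w hw hfw a ha hfa
    have hwS : w ∈ S := ⟨hhalf hw, hfw⟩
    have hzS : z ∈ S := ⟨hhalf hz, hfz⟩
    have hgc := (hds_cont z hzS).sub (hds_cont w hwS)
    obtain ⟨K, hK⟩ := (isCompact_closedBall c r).exists_bound_of_continuousOn hgc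
    refine rado_maxp c r (C * ‖z - w‖) K f (fun a => dslope f z a - dslope f w a) hfB hfdB
      (hgc.mono (fun x hx => hx.1)) (fun x hx hfx => (hds_diff z hzS x hx hfx).sub
        (hds_diff w hwS x hx hfx)) (fun x hx _ => hK x hx)
      (by positivity) (fun b hb _ => ?_) a (hhalf ha) hfa
    have h1 := sub_smul_dslope f z b
    have h2 := sub_smul_dslope f w b
    rw [smul_eq_mul] at h1 h2
    have h3 : (b - w) * (dslope f z b - dslope f w b) =
        dslope f z b * (z - w) - (f z - f w) := by linear_combination h1 - h2
    have h4 : ‖b - w‖ * ‖dslope f z b - dslope f w b‖ ≤ 4 * A / r * ‖z - w‖ + 4 * A / r * ‖z - w‖ := by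
      rw [← norm_mul, h3]
      refine (norm_sub_le _ _).trans (add_le_add ?_ (hLip z hz hfz w hw hfw))
      rw [norm_mul]
      have := hds_sphere z hz b hb
      gcongr
    have h5 : r / 2 * ‖dslope f z b - dslope f w b‖ ≤ ‖b - w‖ * ‖dslope f z b - dslope f w b‖ := by
      have := hfar w hw b hb
      gcongr
    have h6 : C * ‖z - w‖ = (4 * A / r * ‖z - w‖ + 4 * A / r * ‖z - w‖) / (r / 2) := by
      rw [hC]; field_simp; ring
    rw [h6, le_div_iff₀ (by positivity)]
    linarith
  set T : Set ℂ := {x ∈ Metric.ball c (r / 2) | f x ≠ 0} with hT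
  have hpoly : ∀ a ∈ T, ∀ z ∈ T, ∀ w ∈ T,
      ‖(f a - f z) * (a - w) - (f a - f w) * (a - z)‖ ≤ C * ‖z - w‖ * (‖a - z‖ * ‖a - w‖) := by
    intro a ha z hz w hw
    have h1 := sub_smul_dslope f z a
    have h2 := sub_smul_dslope f w a
    rw [smul_eq_mul] at h1 h2
    have h3 := hsecond z hz.1 hz.2 w hw.1 hw.2 a ha.1 ha.2
    have h4 : (f a - f z) * (a - w) - (f a - f w) * (a - z) =
        (dslope f z a - dslope f w a) * ((a - z) * (a - w)) := by
      rw [← h1, ← h2]; ring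
    rw [h4, norm_mul, norm_mul]
    gcongr
  have hcl : ∀ x ∈ Metric.ball c (r / 2), ∃ u : ℕ → ℂ, (∀ n, u n ∈ T) ∧
      Tendsto u atTop (nhds x) ∧ Tendsto (fun n => f (u n)) atTop (nhds (f x)) := by
    intro x hx
    have hxU : x ∈ U := hrU (Metric.ball_subset_closedBall (hhalf hx))
    have : x ∈ closure T := by
      rw [mem_closure_iff]
      intro V hV hxV
      obtain ⟨y, hy, hfy⟩ := hdense x hxU (V ∩ Metric.ball c (r / 2))
        (hV.inter Metric.isOpen_ball) ⟨hxV, hx⟩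
      exact ⟨y, hy.1, hy.2, hfy⟩
    obtain ⟨u, hu, hux⟩ := mem_closure_iff_seq_limit.mp this
    exact ⟨u, hu, hux, ((hf.continuousAt (hU.mem_nhds hxU)).tendsto.comp hux)⟩
  have hpoly' : ∀ a ∈ Metric.ball c (r / 2), ∀ z ∈ Metric.ball c (r / 2),
      ∀ w ∈ Metric.ball c (r / 2),
      ‖(f a - f z) * (a - w) - (f a - f w) * (a - z)‖ ≤ C * ‖z - w‖ * (‖a - z‖ * ‖a - w‖) := by
    intro a ha z hz w hw
    obtain ⟨u, hu, hu1, hu2⟩ := hcl a ha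
    obtain ⟨v, hv, hv1, hv2⟩ := hcl z hz
    obtain ⟨s, hs, hs1, hs2⟩ := hcl w hw
    refine le_of_tendsto_of_tendsto'
      ((((hu2.sub hv2).mul (hu1.sub hs1)).sub ((hu2.sub hs2).mul (hu1.sub hv1))).norm)
      (((hv1.sub hs1).norm.const_mul C).mul ((hu1.sub hv1).norm.mul (hu1.sub hs1).norm))
      (fun n => hpoly _ (hu n) _ (hv n) _ (hs n))
  have hslope : ∀ z ∈ Metric.ball c (r / 2), z ≠ c → ∀ w ∈ Metric.ball c (r / 2), w ≠ c →
      dist (slope f c z) (slope f c w) ≤ C * ‖z - w‖ := by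
    intro z hz hzc w hw hwc
    have h := hpoly' c (Metric.mem_ball_self (by positivity)) z hz w hw
    have hz' : c - z ≠ 0 := sub_ne_zero.mpr hzc.symm
    have hw' : c - w ≠ 0 := sub_ne_zero.mpr hwc.symm
    have hz'' : z - c ≠ 0 := sub_ne_zero.mpr hzc
    have hw'' : w - c ≠ 0 := sub_ne_zero.mpr hwc
    have h4 : (f c - f z) * (c - w) - (f c - f w) * (c - z) =
        (slope f c z - slope f c w) * ((c - z) * (c - w)) := by
      rw [slope_def_field, slope_def_field]
      field_simp
      ring
    rw [h4, norm_mul, norm_mul] at h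
    rw [dist_eq_norm]
    exact le_of_mul_le_mul_right h (mul_pos (norm_pos_iff.mpr hz') (norm_pos_iff.mpr hw'))
  have hcau : Cauchy (Filter.map (slope f c) (nhdsWithin c {c}ᶜ)) := by
    rw [Metric.cauchy_iff]
    refine ⟨inferInstance, fun ε hε => ?_⟩
    set δ : ℝ := min (r / 2) (ε / (2 * (C + 1))) with hδ
    have hδ0 : 0 < δ := by positivity
    refine ⟨slope f c '' (Metric.ball c δ ∩ {c}ᶜ), image_mem_map
      (inter_mem (mem_nhdsWithin_of_mem_nhds (Metric.ball_mem_nhds c hδ0)) self_mem_nhdsWithin), ?_⟩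
    rintro _ ⟨z, ⟨hz, hzc⟩, rfl⟩ _ ⟨w, ⟨hw, hwc⟩, rfl⟩
    have hsub : Metric.ball c δ ⊆ Metric.ball c (r / 2) := Metric.ball_subset_ball (min_le_left _ _)
    have h1 := hslope z (hsub hz) hzc w (hsub hw) hwc
    have h2 : ‖z - w‖ ≤ 2 * δ := by
      rw [← dist_eq_norm]
      rw [Metric.mem_ball] at hz hw
      have := dist_triangle_right z w c
      linarith
    have h3 : δ ≤ ε / (2 * (C + 1)) := min_le_right _ _
    rw [le_div_iff₀ (by positivity)] at h3
    have h4 : C * ‖z - w‖ ≤ C * (2 * δ) := by gcongr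
    nlinarith
  obtain ⟨l, hl⟩ := cauchy_map_iff_exists_tendsto.mp hcau
  exact (hasDerivAt_iff_tendsto_slope.mpr hl).differentiableAt


/-- Let `U ⊆ ℂ` be a connected open set and `γ : U → ℂ⁴` a
continuous map, not identically zero on `U`, which is complex differentiable at
every point of the open set `{z ∈ U : γ z ≠ 0}`. Then the zero set
`{z ∈ U : γ z = 0}` is locally finite in `U`: it has no accumulation point in
`U`, and its intersection with every compact subset of `U` is finite. -/
theorem statement3 (U : Set ℂ) (hUopen : IsOpen U) (hUconn : IsConnected U)
    (γ : ℂ → (Fin 4 → ℂ))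
    (hcont : ContinuousOn γ U)
    (hnz : ¬ ∀ z ∈ U, γ z = 0)
    (hholo : ∀ z ∈ U, γ z ≠ 0 → DifferentiableAt ℂ γ z) :
    (∀ z ∈ U, ¬ AccPt z (Filter.principal {x ∈ U | γ x = 0})) ∧
    (∀ K ⊆ U, IsCompact K → ({x ∈ U | γ x = 0} ∩ K).Finite) := by
  have hdiff : DifferentiableOn ℂ γ U := by
    intro z hz
    refine DifferentiableAt.differentiableWithinAt (differentiableAt_pi.mpr fun i => ?_)
    by_cases h : ∃ x ∈ U, γ x i ≠ 0
    · refine rado_scalar U hUopen hUconn.isPreconnected (fun x => γ x i)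
        (continuousOn_pi.mp hcont i) h (fun x hx hne => ?_) z hz
      exact differentiableAt_pi.mp (hholo x hx (fun h0 => hne (by simp [h0]))) i
    · push Not at h
      refine (differentiableAt_const (0 : ℂ)).congr_of_eventuallyEq ?_
      filter_upwards [hUopen.mem_nhds hz] with x hx using h x hx
  have hacc : ∀ z ∈ U, ¬ AccPt z (Filter.principal {x ∈ U | γ x = 0}) := by
    intro z hz hA
    apply hnz
    refine (hdiff.analyticOnNhd hUopen).eqOn_zero_of_preconnected_of_frequently_eq_zero
      hUconn.isPreconnected hz ?_
    exact (accPt_iff_frequently_nhdsNE.mp hA).mono fun x hx => hx.2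
  refine ⟨hacc, fun K hKU hK => ?_⟩
  by_contra hinf
  obtain ⟨x, hx, hxa⟩ := Set.Infinite.exists_accPt_of_subset_isCompact hinf hK
    Set.inter_subset_right
  exact hacc x (hKU hx) (hxa.mono (Filter.principal_mono.mpr Set.inter_subset_left))
end

section
/- Let P, Q, w : ℝ² → ℝ be smooth functions that are ℤ²-periodic (i.e., periodic with period 1 in each of the two variables). Assume P ≥ 0 and Q ≥ 0 everywhere, that neither P nor Q is identically zero, and that ∫_{[0,1]²} w = 0. Then there exists a unique smooth ℤ²-periodic function u : ℝ² → ℝ satisfying Δu + P·e^u − Q·e^{−u} = w on ℝ², where Δu = −(∂²u/∂x² + ∂²u/∂y²) is the positive (geometers') Laplacian on the flat torus. -/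
/-- A function `ℝ² → ℝ` is `ℤ²`-periodic if it has period `1` in each variable. -/
def ZSqPeriodic (f : ℝ × ℝ → ℝ) : Prop :=
  ∀ x y : ℝ, f (x + 1, y) = f (x, y) ∧ f (x, y + 1) = f (x, y)

/-- The positive (geometers') Laplacian `Δu = −(∂²u/∂x² + ∂²u/∂y²)` on `ℝ²`. -/
noncomputable def posLaplacian (u : ℝ × ℝ → ℝ) (p : ℝ × ℝ) : ℝ :=
  -(deriv (deriv (fun s => u (s, p.2))) p.1 + deriv (deriv (fun t => u (p.1, t))) p.2)

section
open Set Filter Topology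

/-- smooth and periodic -/
def Sm (z : ℝ × ℝ → ℝ) : Prop := ContDiff ℝ (⊤ : ℕ∞) z ∧ ZSqPeriodic z

lemma per_int {f : ℝ × ℝ → ℝ} (h : ZSqPeriodic f) (m n : ℤ) (x y : ℝ) :
    f (x + m, y + n) = f (x, y) := by
  have h1 : Function.Periodic (fun t => f (t, y + n)) 1 := fun t => (h t _).1
  have h2 : Function.Periodic (fun t => f (x, t)) 1 := fun t => (h x t).2
  have h1' := h1.int_mul m x
  have h2' := h2.int_mul n y
  simp only [mul_one] at h1' h2'
  rw [h1', h2']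

abbrev Sq : Set (ℝ × ℝ) := Icc (0:ℝ) 1 ×ˢ Icc (0:ℝ) 1

lemma isCompact_Sq : IsCompact Sq := isCompact_Icc.prod isCompact_Icc

lemma per_rep (p : ℝ × ℝ) : ∃ m n : ℤ, (p.1 + m, p.2 + n) ∈ Sq := by
  refine ⟨-⌊p.1⌋, -⌊p.2⌋, ⟨⟨?_, ?_⟩, ⟨?_, ?_⟩⟩⟩ <;> push_cast <;>
  linarith [Int.floor_le p.1, Int.lt_floor_add_one p.1, Int.floor_le p.2, Int.lt_floor_add_one p.2]

lemma per_forall {f : ℝ × ℝ → ℝ} (h : ZSqPeriodic f) {T : ℝ → Prop} (hT : ∀ p ∈ Sq, T (f p)) :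
    ∀ p, T (f p) := by
  intro p
  obtain ⟨m, n, hmn⟩ := per_rep p
  have := hT _ hmn
  rwa [per_int h] at this

lemma exists_max {f : ℝ × ℝ → ℝ} (hc : Continuous f) (h : ZSqPeriodic f) :
    ∃ p, ∀ q, f q ≤ f p := by
  obtain ⟨p, -, hp⟩ := isCompact_Sq.exists_isMaxOn
    ⟨(0, 0), by simp [Sq]⟩ hc.continuousOn
  exact ⟨p, per_forall h (T := fun t => t ≤ f p) fun q hq => hp hq⟩

lemma per_lin {f g : ℝ × ℝ → ℝ} (hf : ZSqPeriodic f) (hg : ZSqPeriodic g) (F : ℝ → ℝ → ℝ) :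
    ZSqPeriodic (fun p => F (f p) (g p)) := fun x y => by
  simp only [(hf x y).1, (hf x y).2, (hg x y).1, (hg x y).2, and_self]

lemma per_trans {f : ℝ × ℝ → ℝ} (hf : ZSqPeriodic f) (e : ℝ × ℝ) :
    ZSqPeriodic (fun p => f (p + e)) := fun x y => by
  have := hf (x + e.1) (y + e.2)
  simp only [Prod.add_def]
  rw [add_right_comm x, add_right_comm y]
  exact this

lemma bdd_per {f : ℝ × ℝ → ℝ} (hc : Continuous f) (h : ZSqPeriodic f) :
    ∃ M, 0 < M ∧ ∀ q, |f q| ≤ M := by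
  obtain ⟨p, hp⟩ := exists_max hc.abs (per_lin h h (fun a _ => |a|))
  exact ⟨|f p| + 1, by positivity, fun q => by linarith [hp q]⟩

/-! ### slices and the Laplacian -/

lemma smooth_slice1 {z : ℝ × ℝ → ℝ} (hz : ContDiff ℝ (⊤ : ℕ∞) z) (y : ℝ) :
    ContDiff ℝ (⊤ : ℕ∞) (fun s => z (s, y)) := hz.comp (by fun_prop)

lemma smooth_slice2 {z : ℝ × ℝ → ℝ} (hz : ContDiff ℝ (⊤ : ℕ∞) z) (x : ℝ) :
    ContDiff ℝ (⊤ : ℕ∞) (fun s => z (x, s)) := hz.comp (by fun_prop)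

lemma smooth_deriv {f : ℝ → ℝ} (hf : ContDiff ℝ (⊤ : ℕ∞) f) :
    ContDiff ℝ (⊤ : ℕ∞) (deriv f) := by
  exact (contDiff_infty_iff_deriv.1 hf).2

lemma dd_lin {f g : ℝ → ℝ} (hf : ContDiff ℝ (⊤ : ℕ∞) f) (hg : ContDiff ℝ (⊤ : ℕ∞) g)
    (a b s : ℝ) : deriv (deriv (fun s => a * f s + b * g s)) s
      = a * deriv (deriv f) s + b * deriv (deriv g) s := by
  have key : ∀ {f g : ℝ → ℝ}, ContDiff ℝ (⊤ : ℕ∞) f → ContDiff ℝ (⊤ : ℕ∞) g →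
      deriv (fun s => a * f s + b * g s) = fun s => a * deriv f s + b * deriv g s := by
    intro f g hf hg
    funext s
    have h1 := (hf.differentiable (by simp) s).hasDerivAt
    have h2 := (hg.differentiable (by simp) s).hasDerivAt
    exact ((h1.const_mul a).add (h2.const_mul b)).deriv
  rw [key hf hg, key (smooth_deriv hf) (smooth_deriv hg)]

lemma lap_lin {z₁ z₂ : ℝ × ℝ → ℝ} (h₁ : ContDiff ℝ (⊤ : ℕ∞) z₁) (h₂ : ContDiff ℝ (⊤ : ℕ∞) z₂)
    (a b : ℝ) (p : ℝ × ℝ) : posLaplacian (fun q => a * z₁ q + b * z₂ q) p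
      = a * posLaplacian z₁ p + b * posLaplacian z₂ p := by
  unfold posLaplacian
  rw [dd_lin (smooth_slice1 h₁ _) (smooth_slice1 h₂ _),
    dd_lin (smooth_slice2 h₁ _) (smooth_slice2 h₂ _)]
  ring

lemma lap_trans (z : ℝ × ℝ → ℝ) (e p : ℝ × ℝ) :
    posLaplacian (fun q => z (q + e)) p = posLaplacian z (p + e) := by
  unfold posLaplacian
  have k : ∀ (f : ℝ → ℝ) (c s : ℝ), deriv (deriv (fun t => f (t + c))) s = deriv (deriv f) (s + c) := by
    intro f c s
    have : deriv (fun t => f (t + c)) = fun t => deriv f (t + c) := by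
      funext t; exact deriv_comp_add_const f c t
    rw [this]; exact deriv_comp_add_const _ c s
  have := k (fun s => z (s, p.2 + e.2)) e.1 p.1
  have h2 := k (fun s => z (p.1 + e.1, s)) e.2 p.2
  simp only [Prod.add_def, this, h2]

lemma Sm.lin {z₁ z₂ : ℝ × ℝ → ℝ} (h₁ : Sm z₁) (h₂ : Sm z₂) (a b : ℝ) :
    Sm (fun q => a * z₁ q + b * z₂ q) :=
  ⟨(contDiff_const.mul h₁.1).add (contDiff_const.mul h₂.1),
    per_lin h₁.2 h₂.2 (fun s t => a * s + b * t)⟩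

lemma Sm.const (c : ℝ) : Sm (fun _ => c) := ⟨contDiff_const, fun _ _ => ⟨rfl, rfl⟩⟩

lemma lap_const (c : ℝ) (p : ℝ × ℝ) : posLaplacian (fun _ => c) p = 0 := by
  simp [posLaplacian]

lemma Sm.trans {z : ℝ × ℝ → ℝ} (h : Sm z) (e : ℝ × ℝ) : Sm (fun p => z (p + e)) :=
  ⟨h.1.comp (by fun_prop), per_trans h.2 e⟩

lemma lap_cont {z : ℝ × ℝ → ℝ} (hz : ContDiff ℝ (⊤ : ℕ∞) z) :
    Continuous (fun p : ℝ × ℝ => deriv (deriv (fun s => z (s, p.2))) p.1) ∧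
    Continuous (fun p : ℝ × ℝ => deriv (deriv (fun s => z (p.1, s))) p.2) := by
  have key1 : ∀ z : ℝ × ℝ → ℝ, ContDiff ℝ (⊤ : ℕ∞) z →
    ContDiff ℝ (⊤ : ℕ∞) (fun p : ℝ × ℝ => deriv (fun s => z (s, p.2)) p.1) := by
    intro z hz
    have : (fun p : ℝ × ℝ => deriv (fun s => z (s, p.2)) p.1) = fun p => fderiv ℝ z p (1, 0) := by
      funext p
      have h1 := (hz.differentiable (by simp) p).hasFDerivAt
      have h2 : HasDerivAt (fun s : ℝ => (s, p.2)) ((1:ℝ), (0:ℝ)) p.1 :=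
        (hasDerivAt_id _).prodMk (hasDerivAt_const _ _)
      exact (HasFDerivAt.comp_hasDerivAt (f := fun s : ℝ => (s, p.2)) p.1 h1 h2).deriv
    rw [this]
    exact (hz.fderiv_right (m := (⊤:ℕ∞)) (by simp)).clm_apply contDiff_const
  have key2 : ∀ z : ℝ × ℝ → ℝ, ContDiff ℝ (⊤ : ℕ∞) z →
    ContDiff ℝ (⊤ : ℕ∞) (fun p : ℝ × ℝ => deriv (fun s => z (p.1, s)) p.2) := by
    intro z hz
    have : (fun p : ℝ × ℝ => deriv (fun s => z (p.1, s)) p.2) = fun p => fderiv ℝ z p (0, 1) := by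
      funext p
      have h1 := (hz.differentiable (by simp) p).hasFDerivAt
      have h2 : HasDerivAt (fun s : ℝ => (p.1, s)) ((0:ℝ), (1:ℝ)) p.2 :=
        (hasDerivAt_const _ _).prodMk (hasDerivAt_id _)
      exact (HasFDerivAt.comp_hasDerivAt (f := fun s : ℝ => (p.1, s)) p.2 h1 h2).deriv
    rw [this]
    exact (hz.fderiv_right (m := (⊤:ℕ∞)) (by simp)).clm_apply contDiff_const
  exact ⟨(key1 _ (key1 z hz)).continuous, (key2 _ (key2 z hz)).continuous⟩

/-! ### maximum principle -/

lemma dd_nonpos {g : ℝ → ℝ} (hg : ContDiff ℝ (⊤ : ℕ∞) g) {s : ℝ} (hm : IsLocalMax g s) :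
    deriv (deriv g) s ≤ 0 := by
  by_contra! hpos
  have hmin := isLocalMin_of_deriv_deriv_pos hpos hm.deriv_eq_zero hg.continuous.continuousAt
  have hc : g =ᶠ[𝓝 s] fun _ => g s := by
    filter_upwards [hm, hmin] with t h1 h2
    exact le_antisymm h1 h2
  have h2 : deriv g =ᶠ[𝓝 s] deriv (fun _ => g s) := hc.deriv
  have := h2.deriv_eq
  simp at this
  linarith

lemma lap_nonneg_of_max {z : ℝ × ℝ → ℝ} (hz : ContDiff ℝ (⊤ : ℕ∞) z) {p : ℝ × ℝ}
    (hp : ∀ q, z q ≤ z p) : 0 ≤ posLaplacian z p := by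
  unfold posLaplacian
  have h1 := dd_nonpos (smooth_slice1 hz p.2) (s := p.1) (Eventually.of_forall fun s => hp _)
  have h2 := dd_nonpos (smooth_slice2 hz p.1) (s := p.2) (Eventually.of_forall fun s => hp _)
  linarith

/-- one-directional Lipschitz estimate from the maximum principle -/
lemma lip_aux {z : ℝ × ℝ → ℝ} (hz : Sm z) {M : ℝ} (hM : ∀ p, |posLaplacian z p| ≤ M)
    (x a y : ℝ) (hy : y ∈ Icc (0:ℝ) 1) : z (x, a + y) - z (x, a - y) ≤ M * y := by
  have hM0 : 0 ≤ M := (abs_nonneg _).trans (hM 0)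
  suffices H : ∀ M' > M, z (x, a + y) - z (x, a - y) ≤ M' * (y * (1 - y)) by
    have : z (x, a + y) - z (x, a - y) ≤ M * (y * (1 - y)) := by
      apply le_of_forall_gt_imp_ge_of_dense
      intro c hc
      by_cases hyy : y * (1 - y) = 0
      · have := H (M + 1) (by linarith)
        rw [hyy] at this hc; linarith
      · have h0 : 0 < y * (1 - y) :=
          lt_of_le_of_ne (mul_nonneg hy.1 (by linarith [hy.2])) (Ne.symm hyy)
        have := H (c / (y * (1 - y))) (by rwa [gt_iff_lt, lt_div_iff₀ h0])
        rwa [div_mul_cancel₀ _ hyy] at this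
    nlinarith [mul_nonneg hM0 (mul_nonneg hy.1 hy.1)]
  intro M' hM'
  set h : ℝ × ℝ → ℝ := fun q => z (q.1, a + q.2) - z (q.1, a - q.2) - M' * (q.2 * (1 - q.2)) with hh
  have hhs : ContDiff ℝ (⊤ : ℕ∞) h := by
    have h1 : ContDiff ℝ (⊤ : ℕ∞) (fun q : ℝ × ℝ => z (q.1, a + q.2)) := hz.1.comp (by fun_prop)
    have h2 : ContDiff ℝ (⊤ : ℕ∞) (fun q : ℝ × ℝ => z (q.1, a - q.2)) := hz.1.comp (by fun_prop)
    exact (h1.sub h2).sub (by fun_prop)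
  obtain ⟨p, hpS, hp⟩ := isCompact_Sq.exists_isMaxOn ⟨(0, 0), by simp [Sq]⟩
    hhs.continuous.continuousOn
  have hp' : ∀ (s t : ℝ), t ∈ Icc (0:ℝ) 1 → h (s, t) ≤ h p := by
    intro s t ht
    have hs : h (s, t) = h (Int.fract s, t) := by
      have e1 := per_int hz.2 (-⌊s⌋) 0 s (a + t)
      have e2 := per_int hz.2 (-⌊s⌋) 0 s (a - t)
      push_cast at e1 e2
      simp only [add_zero, ← sub_eq_add_neg] at e1 e2
      simp only [hh, Int.fract, e1, e2]
    rw [hs]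
    exact hp (show (Int.fract s, t) ∈ Sq from ⟨⟨Int.fract_nonneg _, (Int.fract_lt_one _).le⟩, ht⟩)
  suffices hp0 : h p ≤ 0 by
    have := hp' x y hy
    simp only [hh] at this hp0 ⊢
    linarith
  obtain ⟨p1, p2⟩ := p
  have hp2 : p2 ∈ Icc (0:ℝ) 1 := hpS.2
  rcases eq_or_lt_of_le hp2.1 with h0 | h0
  · simp [hh, ← h0]
  rcases eq_or_lt_of_le hp2.2 with h1 | h1
  · have e2 := (hz.2 p1 a).2
    have e3 := (hz.2 p1 (a-1)).2
    simp only [sub_add_cancel] at e3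
    simp [hh, h1, e2, e3]
  exfalso
  have d1 := dd_nonpos (smooth_slice1 hhs p2) (s := p1)
    (Eventually.of_forall fun s => hp' s p2 hp2)
  have d2 : deriv (deriv (fun t => h (p1, t))) p2 ≤ 0 := dd_nonpos (smooth_slice2 hhs p1) (by
    filter_upwards [Icc_mem_nhds h0 h1] with t ht using hp' p1 t ht)
  -- compute
  have c1 : deriv (deriv (fun s => h (s, p2))) p1 =
      deriv (deriv (fun s => z (s, a + p2))) p1 - deriv (deriv (fun s => z (s, a - p2))) p1 := by
    have := dd_lin (smooth_slice1 hz.1 (a + p2)) (smooth_slice1 hz.1 (a - p2)) 1 (-1) p1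
    have e : (fun s => h (s, p2)) = fun s => (1 * z (s, a + p2) + (-1) * z (s, a - p2)) - M' * (p2 * (1 - p2)) := by
      funext s; simp only [hh]; ring
    rw [e]
    simp only [deriv_sub_const_fun]
    rw [this]; ring
  have c2 : deriv (deriv (fun t => h (p1, t))) p2 =
      deriv (deriv (fun t => z (p1, t))) (a + p2) - deriv (deriv (fun t => z (p1, t))) (a - p2)
        + 2 * M' := by
    set f := fun t => z (p1, t) with hf
    have hfs : ContDiff ℝ (⊤ : ℕ∞) f := smooth_slice2 hz.1 p1
    have hd : ∀ t, HasDerivAt f (deriv f t) t := fun t =>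
      (hfs.differentiable (by simp) t).hasDerivAt
    have hd' : ∀ t, HasDerivAt (deriv f) (deriv (deriv f) t) t := fun t =>
      ((smooth_deriv hfs).differentiable (by simp) t).hasDerivAt
    have e1 : deriv (fun t => h (p1, t)) = fun t => deriv f (a + t) + deriv f (a - t) - M' * (1 - 2 * t) := by
      funext t
      have k1 := (hd (a + t)).comp_const_add a t
      have k2 := (hd (a - t)).comp_const_sub a t
      have k3 : HasDerivAt (fun t : ℝ => M' * (t * (1 - t))) (M' * (1 - 2 * t)) t := by
        have := ((hasDerivAt_id t).mul ((hasDerivAt_id t).const_sub 1)).const_mul M'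
        refine this.congr_deriv ?_
        simp only [id]; ring
      refine Eq.trans ((k1.sub k2).sub k3).deriv ?_
      ring
    rw [e1]
    have k1 := (hd' (a + p2)).comp_const_add a p2
    have k2 := (hd' (a - p2)).comp_const_sub a p2
    have k3 : HasDerivAt (fun t : ℝ => M' * (1 - 2 * t)) (M' * (- 2)) p2 := by
      have := (((hasDerivAt_id p2).const_mul 2).const_sub 1).const_mul M'
      refine this.congr_deriv ?_
      ring
    refine Eq.trans ((k1.add k2).sub k3).deriv ?_
    ring
  have m1 := abs_le.1 (hM (p1, a + p2))
  have m2 := abs_le.1 (hM (p1, a - p2))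
  simp only [posLaplacian] at m1 m2
  linarith [m1.1, m1.2, m2.1, m2.2]


lemma lap_swap (z : ℝ × ℝ → ℝ) (p : ℝ × ℝ) :
    posLaplacian (fun q => z (q.2, q.1)) p = posLaplacian z (p.2, p.1) := by
  simp only [posLaplacian]; rw [add_comm]

lemma lip_aux' {z : ℝ × ℝ → ℝ} (hz : Sm z) {M : ℝ} (hM : ∀ p, |posLaplacian z p| ≤ M)
    (x s t : ℝ) (hst : |s - t| ≤ 1) : |z (x, s) - z (x, t)| ≤ M * |s - t| := by
  have hM0 : 0 ≤ M := (abs_nonneg _).trans (hM 0)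
  wlog hle : t ≤ s generalizing s t
  · rw [abs_sub_comm, abs_sub_comm s]
    exact this t s (by rwa [abs_sub_comm]) (by linarith)
  rw [abs_of_nonneg (by linarith : 0 ≤ s - t)] at hst ⊢
  have hm : Sm (fun q => (-1) * z q + 0 * z q) := hz.lin hz (-1) 0
  have h1 := lip_aux hz hM x ((s + t) / 2) ((s - t) / 2) ⟨by linarith, by linarith⟩
  have h2 := lip_aux hm (M := M) (fun p => by
    rw [lap_lin hz.1 hz.1]; simpa using hM p) x ((s + t) / 2) ((s - t) / 2)
      ⟨by linarith, by linarith⟩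
  have e1 : (s + t) / 2 + (s - t) / 2 = s := by ring
  have e2 : (s + t) / 2 - (s - t) / 2 = t := by ring
  rw [e1, e2] at h1
  simp only [e1, e2] at h2
  have : 0 ≤ M * (s - t) := mul_nonneg hM0 (by linarith)
  rw [abs_le]; constructor <;> linarith

lemma fderiv_bound {z : ℝ × ℝ → ℝ} (hz : Sm z) {M : ℝ} (hM : ∀ p, |posLaplacian z p| ≤ M)
    (p : ℝ × ℝ) : ‖fderiv ℝ z p‖ ≤ 2 * M := by
  have hM0 : 0 ≤ M := (abs_nonneg _).trans (hM 0)
  have hs : Sm (fun q => z (q.2, q.1)) := ⟨hz.1.comp (by fun_prop),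
    fun x y => ⟨(hz.2 y x).2, (hz.2 y x).1⟩⟩
  apply norm_fderiv_le_of_lip' ℝ (by positivity)
  filter_upwards [Metric.ball_mem_nhds p one_pos] with q hq
  rw [Metric.mem_ball, dist_eq_norm] at hq
  have n1 : |q.1 - p.1| ≤ ‖q - p‖ := norm_fst_le (q - p)
  have n2 : |q.2 - p.2| ≤ ‖q - p‖ := norm_snd_le (q - p)
  have h1 := lip_aux' hz hM q.1 q.2 p.2 (by linarith)
  have h2 := lip_aux' hs (M := M) (fun r => by rw [lap_swap]; exact hM _) p.2 q.1 p.1 (by linarith)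
  simp only at h2
  have := abs_add_le (z (q.1, q.2) - z (q.1, p.2)) (z (q.1, p.2) - z (p.1, p.2))
  rw [sub_add_sub_cancel] at this
  rw [Real.norm_eq_abs]
  calc |z q - z p| ≤ _ := this
    _ ≤ M * ‖q - p‖ + M * ‖q - p‖ := by gcongr <;> exact le_trans ‹_› (by gcongr)
    _ = _ := by ring

lemma lip_global {z : ℝ × ℝ → ℝ} (hz : Sm z) {M : ℝ} (hM : ∀ p, |posLaplacian z p| ≤ M)
    (p q : ℝ × ℝ) : |z p - z q| ≤ 2 * M * ‖p - q‖ :=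
  Convex.norm_image_sub_le_of_norm_fderiv_le (𝕜 := ℝ) (s := univ)
    (fun x _ => hz.1.differentiable (by simp) x) (fun x _ => fderiv_bound hz hM x)
    convex_univ (mem_univ _) (mem_univ _)

/-- generalized solutions of `Δ v = w` -/
def R (v w : ℝ × ℝ → ℝ) : Prop :=
  ∀ ε > 0, ∃ z, Sm z ∧ (∀ p, |z p - v p| ≤ ε) ∧ ∀ p, |posLaplacian z p - w p| ≤ ε

lemma R.of_smooth {z : ℝ × ℝ → ℝ} (hz : Sm z) : R z (posLaplacian z) :=
  fun ε hε => ⟨z, hz, fun p => by simpa using hε.le, fun p => by simpa using hε.le⟩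

lemma lin_bound {a b s t s' t' ε : ℝ} (h1 : |s - s'| ≤ ε / (|a| + |b| + 1))
    (h2 : |t - t'| ≤ ε / (|a| + |b| + 1)) :
    |(a * s + b * t) - (a * s' + b * t')| ≤ ε := by
  have hp : 0 < |a| + |b| + 1 := by positivity
  have hε : 0 ≤ ε / (|a| + |b| + 1) := (abs_nonneg _).trans h1
  calc |(a * s + b * t) - (a * s' + b * t')| = |a * (s - s') + b * (t - t')| := by ring_nf
    _ ≤ |a| * |s - s'| + |b| * |t - t'| := by
        rw [← abs_mul, ← abs_mul]; exact abs_add_le _ _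
    _ ≤ |a| * (ε / (|a| + |b| + 1)) + |b| * (ε / (|a| + |b| + 1)) := by gcongr
    _ ≤ (|a| + |b| + 1) * (ε / (|a| + |b| + 1)) := by nlinarith
    _ = ε := by field_simp

lemma R.lin {v₁ v₂ w₁ w₂ : ℝ × ℝ → ℝ} (h₁ : R v₁ w₁) (h₂ : R v₂ w₂) (a b : ℝ) :
    R (fun q => a * v₁ q + b * v₂ q) (fun q => a * w₁ q + b * w₂ q) := by
  intro ε hε
  obtain ⟨z₁, s₁, k₁, l₁⟩ := h₁ (ε / (|a| + |b| + 1)) (by positivity)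
  obtain ⟨z₂, s₂, k₂, l₂⟩ := h₂ (ε / (|a| + |b| + 1)) (by positivity)
  refine ⟨_, s₁.lin s₂ a b, fun p => lin_bound (k₁ p) (k₂ p), fun p => ?_⟩
  rw [lap_lin s₁.1 s₂.1]
  exact lin_bound (l₁ p) (l₂ p)

lemma R.trans {v w : ℝ × ℝ → ℝ} (h : R v w) (e : ℝ × ℝ) :
    R (fun p => v (p + e)) (fun p => w (p + e)) := by
  intro ε hε
  obtain ⟨z, s, k, l⟩ := h ε hε
  exact ⟨_, s.trans e, fun p => k _, fun p => by rw [lap_trans]; exact l _⟩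

lemma R.closed {v w : ℝ × ℝ → ℝ}
    (h : ∀ ε > 0, ∃ v' w', R v' w' ∧ (∀ p, |v' p - v p| ≤ ε) ∧ ∀ p, |w' p - w p| ≤ ε) :
    R v w := by
  intro ε hε
  obtain ⟨v', w', h', k, l⟩ := h (ε / 2) (by positivity)
  obtain ⟨z, s, k', l'⟩ := h' (ε / 2) (by positivity)
  refine ⟨z, s, fun p => ?_, fun p => ?_⟩
  · have := abs_sub_le (z p) (v' p) (v p)
    linarith [k p, k' p]
  · have := abs_sub_le (posLaplacian z p) (w' p) (w p)
    linarith [l p, l' p]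

lemma R.lip {v w : ℝ × ℝ → ℝ} (h : R v w) {M : ℝ} (hM : ∀ p, |w p| ≤ M) (p q : ℝ × ℝ) :
    |v p - v q| ≤ 2 * M * ‖p - q‖ := by
  apply le_of_forall_pos_le_add
  intro ε hε
  have hpos : 0 < 2 + 2 * ‖p - q‖ := by positivity
  set δ := ε / (2 + 2 * ‖p - q‖) with hδ
  have hδ0 : 0 < δ := by positivity
  have hδe : δ * (2 + 2 * ‖p - q‖) = ε := by rw [hδ]; field_simp
  obtain ⟨z, s, k, l⟩ := h δ hδ0
  have h1 := lip_global s (M := M + δ) (fun p => by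
    have := abs_sub_abs_le_abs_sub (posLaplacian z p) (w p)
    linarith [l p, hM p]) p q
  have h2 := abs_le.1 (k p)
  have h3 := abs_le.1 (k q)
  have h4 := abs_le.1 h1
  have e : 2 * (M + δ) * ‖p - q‖ = 2 * M * ‖p - q‖ + ε - 2 * δ := by rw [← hδe]; ring
  rw [e] at h4
  rw [abs_le]; constructor <;> linarith

lemma R.contDiff_one {v w : ℝ × ℝ → ℝ} (h : R v w) : ContDiff ℝ 1 v := by
  choose z s k l using fun n : ℕ => h (1 / ((n : ℝ) + 1)) (by positivity)
  have hlim : Tendsto (fun n : ℕ => 1 / ((n : ℝ) + 1)) atTop (𝓝 0) :=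
    tendsto_one_div_add_atTop_nhds_zero_nat
  have hu : UniformCauchySeqOn (fun n => fderiv ℝ (z n)) atTop univ := by
    rw [Metric.uniformCauchySeqOn_iff]
    intro ε hε
    obtain ⟨N, hN⟩ := (Metric.tendsto_atTop.1 hlim) (ε / 5) (by positivity)
    have hN' : ∀ n ≥ N, 1 / ((n : ℝ) + 1) < ε / 5 := fun n hn => by
      have := hN n hn
      rw [Real.dist_eq, sub_zero] at this
      exact (le_abs_self _).trans_lt this
    refine ⟨N, fun m hm n hn p _ => ?_⟩
    have hd : Sm (fun q => 1 * z m q + (-1) * z n q) := (s m).lin (s n) 1 (-1)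
    have hb := fderiv_bound hd (M := 2 * (ε / 5)) (fun q => by
      rw [lap_lin (s m).1 (s n).1]
      have h1 := abs_le.1 (l m q)
      have h2 := abs_le.1 (l n q)
      have := hN' m hm
      have := hN' n hn
      rw [abs_le]; constructor <;> linarith) p
    have h1 := ((s m).1.differentiable (by simp) p).hasFDerivAt
    have h2 := ((s n).1.differentiable (by simp) p).hasFDerivAt
    have e : fderiv ℝ (fun q => 1 * z m q + (-1) * z n q) p = fderiv ℝ (z m) p - fderiv ℝ (z n) p := by
      have := (h1.sub h2).fderiv
      rw [← this]; congr 1; funext q; simp; ring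
    rw [e] at hb
    rw [dist_eq_norm]; linarith
  have hex : ∀ p, ∃ L, Tendsto (fun n => fderiv ℝ (z n) p) atTop (𝓝 L) := fun p =>
    cauchySeq_tendsto_of_complete (hu.cauchySeq (mem_univ p))
  choose L hL using hex
  have hU : TendstoUniformly (fun n => fderiv ℝ (z n)) L atTop := by
    rw [← tendstoUniformlyOn_univ]
    exact hu.tendstoUniformlyOn_of_tendsto (fun p _ => hL p)
  have hd : ∀ p, HasFDerivAt v (L p) p := fun p =>
    hasFDerivAt_of_tendstoUniformly hU
      (fun n p => ((s n).1.differentiable (by simp) p).hasFDerivAt)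
      (fun p => by
        rw [tendsto_iff_dist_tendsto_zero]
        refine squeeze_zero (fun _ => dist_nonneg) (fun n => ?_) hlim
        rw [Real.dist_eq]; exact k n p) p
  have hLc : Continuous L := hU.continuous (Frequently.of_forall fun n =>
    (s n).1.continuous_fderiv (by simp))
  rw [contDiff_one_iff_fderiv]
  refine ⟨fun p => (hd p).differentiableAt, ?_⟩
  have : fderiv ℝ v = L := funext fun p => (hd p).fderiv
  rwa [this]

lemma R.per {v w : ℝ × ℝ → ℝ} (h : R v w) : ZSqPeriodic v := by
  have key : ∀ p q : ℝ × ℝ, (∀ z, Sm z → z p = z q) → v p = v q := by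
    intro p q hz
    by_contra hne
    have hpos : 0 < |v p - v q| := abs_pos.2 (sub_ne_zero.2 hne)
    obtain ⟨z, s, k, -⟩ := h (|v p - v q| / 3) (by positivity)
    have h1 := k p
    have h2 := k q
    rw [hz z s] at h1
    have := abs_sub_le (v p) (z q) (v q)
    rw [abs_sub_comm] at h1
    linarith
  exact fun x y => ⟨key _ _ fun z s => (s.2 x y).1, key _ _ fun z s => (s.2 x y).2⟩

lemma R.cont {v w : ℝ × ℝ → ℝ} (h : R v w) : Continuous v := h.contDiff_one.continuous

/-- uniform convergence of difference quotients -/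
lemma dq_unif {f : ℝ × ℝ → ℝ} (hf : ContDiff ℝ 1 f) (hp : ZSqPeriodic f) (e : ℝ × ℝ) {ε : ℝ}
    (hε : 0 < ε) : ∀ᶠ h in 𝓝 (0:ℝ), h ≠ 0 → ∀ p,
      |(1/h) * f (p + h • e) + (-(1/h)) * f p - fderiv ℝ f p e| ≤ ε := by
  have hfd : Continuous (fun p => fderiv ℝ f p e) :=
    (hf.continuous_fderiv (by simp)).clm_apply continuous_const
  have hev : ∀ᶠ h in 𝓝 (0:ℝ), ∀ p ∈ Sq, |fderiv ℝ f (p + h • e) e - fderiv ℝ f p e| < ε := by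
    apply isCompact_Sq.eventually_forall_of_forall_eventually
    intro p _
    have hc : Continuous (fun q : ℝ × (ℝ × ℝ) => |fderiv ℝ f (q.2 + q.1 • e) e - fderiv ℝ f q.2 e|) :=
      ((hfd.comp (by fun_prop)).sub (hfd.comp (by fun_prop))).abs
    have := hc.tendsto (0, p)
    simp only [zero_smul, add_zero, sub_self, abs_zero] at this
    exact this.eventually (gt_mem_nhds hε)
  obtain ⟨δ, hδ, hball⟩ := Metric.eventually_nhds_iff.1 hev
  rw [Metric.eventually_nhds_iff]
  refine ⟨δ, hδ, fun h hh hne p => ?_⟩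
  rw [Real.dist_eq, sub_zero] at hh
  -- periodicity of the derivative
  have hperd : ZSqPeriodic (fun p => fderiv ℝ f p e) := by
    have key : ∀ c : ℝ × ℝ, (∀ q, f (q + c) = f q) → ∀ q, fderiv ℝ f (q + c) = fderiv ℝ f q := by
      intro c hc q
      rw [← fderiv_comp_add_right]; congr 1; funext q; exact hc q
    intro x y
    have k1 := key (1, 0) (fun q => by
      have := (hp q.1 q.2).1
      simpa [Prod.add_def] using this) (x, y)
    have k2 := key (0, 1) (fun q => by
      have := (hp q.1 q.2).2
      simpa [Prod.add_def] using this) (x, y)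
    simp only [Prod.mk_add_mk, add_zero] at k1 k2
    simp only [k1, k2, and_self]
  have hall : ∀ t : ℝ, |t| < δ → ∀ p, |fderiv ℝ f (p + t • e) e - fderiv ℝ f p e| ≤ ε := by
    intro t ht
    exact per_forall (f := fun p => |fderiv ℝ f (p + t • e) e - fderiv ℝ f p e|)
      (per_lin (per_trans hperd (t • e)) hperd (fun a b => |a - b|)) (T := fun r => r ≤ ε)
      (fun p hp => (hball (by rwa [Real.dist_eq, sub_zero]) p hp).le)
  -- mean value
  have hmv := Convex.norm_image_sub_le_of_norm_hasDerivWithin_le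
    (f := fun t : ℝ => f (p + t • e) - t * fderiv ℝ f p e)
    (f' := fun t => fderiv ℝ f (p + t • e) e - fderiv ℝ f p e) (s := Metric.ball (0:ℝ) δ)
    (C := ε) (fun t _ => by
      have h1 := (hf.differentiable (by simp) (p + t • e)).hasFDerivAt
      have h2 : HasDerivAt (fun t : ℝ => p + t • e) e t := by
        simpa using ((hasDerivAt_id t).smul_const e).const_add p
      have h3 := HasFDerivAt.comp_hasDerivAt (f := fun t : ℝ => p + t • e) t h1 h2
      have h4 := (hasDerivAt_id t).mul_const (fderiv ℝ f p e)
      rw [one_mul] at h4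
      exact (h3.sub h4).hasDerivWithinAt)
    (fun t ht => hall t (by simpa [Real.dist_eq] using ht) p)
    (convex_ball _ _) (Metric.mem_ball_self hδ)
    (show h ∈ Metric.ball (0:ℝ) δ by simpa [Real.dist_eq] using hh)
  simp only [zero_smul, add_zero, zero_mul, sub_zero, Real.norm_eq_abs] at hmv
  have e1 : (1/h) * f (p + h • e) + (-(1/h)) * f p - fderiv ℝ f p e
      = (f (p + h • e) - h * fderiv ℝ f p e - f p) / h := by field_simp; ring
  rw [e1, abs_div, div_le_iff₀ (abs_pos.2 hne)]
  exact hmv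

lemma R.deriv {v w : ℝ × ℝ → ℝ} (h : R v w) (hw : ContDiff ℝ 1 w) (hwp : ZSqPeriodic w)
    (e : ℝ × ℝ) : R (fun p => fderiv ℝ v p e) (fun p => fderiv ℝ w p e) := by
  apply R.closed
  intro ε hε
  have h1 := dq_unif h.contDiff_one h.per e hε
  have h2 := dq_unif hw hwp e hε
  have hne : ∃ t : ℝ, t ≠ 0 ∧ (t ≠ 0 → ∀ p,
      |(1/t) * v (p + t • e) + (-(1/t)) * v p - fderiv ℝ v p e| ≤ ε) ∧ (t ≠ 0 → ∀ p,
      |(1/t) * w (p + t • e) + (-(1/t)) * w p - fderiv ℝ w p e| ≤ ε) := by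
    obtain ⟨δ, hδ, hball⟩ := Metric.eventually_nhds_iff.1 (h1.and h2)
    refine ⟨δ / 2, by positivity, hball ?_⟩
    rw [Real.dist_eq, sub_zero, abs_of_pos (by positivity)]; linarith
  obtain ⟨t, ht, k1, k2⟩ := hne
  exact ⟨_, _, (h.trans (t • e)).lin h (1/t) (-(1/t)), k1 ht, k2 ht⟩

lemma R.contDiff (k : ℕ) : ∀ {v w : ℝ × ℝ → ℝ}, R v w → ContDiff ℝ k w → ZSqPeriodic w →
    ContDiff ℝ (k + 1 : ℕ) v := by
  induction k with
  | zero => intro v w h _ _; exact_mod_cast h.contDiff_one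
  | succ k ih =>
    intro v w h hw hwp
    have hw1 : ContDiff ℝ 1 w := hw.of_le (by exact_mod_cast Nat.le_add_left 1 k)
    have key : ∀ e, ContDiff ℝ (k + 1 : ℕ) (fun p => fderiv ℝ v p e) := by
      intro e
      have h2 := h.deriv hw1 hwp e
      refine ih h2 ?_ ?_
      · exact (hw.fderiv_right (m := (k : ℕ)) (by norm_cast)).clm_apply contDiff_const
      · have hk : ∀ c : ℝ × ℝ, (∀ q, w (q + c) = w q) → ∀ q, fderiv ℝ w (q + c) = fderiv ℝ w q := by
          intro c hc q
          rw [← fderiv_comp_add_right]; congr 1; funext q; exact hc q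
        intro x y
        have k1 := hk (1, 0) (fun q => by
          have := (hwp q.1 q.2).1
          simpa [Prod.add_def] using this) (x, y)
        have k2 := hk (0, 1) (fun q => by
          have := (hwp q.1 q.2).2
          simpa [Prod.add_def] using this) (x, y)
        simp only [Prod.mk_add_mk, add_zero] at k1 k2
        simp only [k1, k2, and_self]
    have : ContDiff ℝ ((k + 1 : ℕ) + 1) v := by
      rw [contDiff_succ_iff_fderiv]
      refine ⟨h.contDiff_one.differentiable (by simp), by simp, ?_⟩
      exact contDiff_clm_apply_iff.2 key
    exact_mod_cast this


lemma lap_nonneg_of_localMax {z : ℝ × ℝ → ℝ} (hz : ContDiff ℝ (⊤ : ℕ∞) z) {p : ℝ × ℝ}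
    (hp : IsLocalMax z p) : 0 ≤ posLaplacian z p := by
  unfold posLaplacian
  have c1 : Tendsto (fun s : ℝ => (s, p.2)) (𝓝 p.1) (𝓝 p) := by
    have : Continuous (fun s : ℝ => (s, p.2)) := by fun_prop
    exact this.tendsto p.1
  have c2 : Tendsto (fun s : ℝ => (p.1, s)) (𝓝 p.2) (𝓝 p) := by
    have : Continuous (fun s : ℝ => (p.1, s)) := by fun_prop
    exact this.tendsto p.2
  have h1 := dd_nonpos (smooth_slice1 hz p.2) (s := p.1) (c1.eventually hp)
  have h2 := dd_nonpos (smooth_slice2 hz p.1) (s := p.2) (c2.eventually hp)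
  linarith

lemma lap_quad (a p : ℝ × ℝ) :
    posLaplacian (fun q => (q.1 - a.1) ^ 2 + (q.2 - a.2) ^ 2) p = -4 := by
  have k : ∀ c d s : ℝ, deriv (deriv (fun t : ℝ => (t - c) ^ 2 + d)) s = 2 := by
    intro c d s
    have : deriv (fun t : ℝ => (t - c) ^ 2 + d) = fun t => 2 * (t - c) := by
      funext t
      have := (((hasDerivAt_id t).sub_const c).pow 2).add_const d
      refine Eq.trans this.deriv ?_
      simp
    rw [this]
    have := ((hasDerivAt_id s).sub_const c).const_mul 2
    refine Eq.trans this.deriv ?_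
    ring
  unfold posLaplacian
  have h1 := k a.1 ((p.2 - a.2) ^ 2) p.1
  have h2 := k a.2 ((p.1 - a.1) ^ 2) p.2
  rw [show (fun t : ℝ => (p.1 - a.1) ^ 2 + (t - a.2) ^ 2) = fun t => (t - a.2) ^ 2 + (p.1 - a.1) ^ 2
    from funext fun t => add_comm _ _, h2, h1]
  norm_num

lemma R.zero_nonneg {f g : ℝ × ℝ → ℝ} (h : R f g) (hf : ∀ p, f p = 0) (hg : Continuous g)
    (a : ℝ × ℝ) : 0 ≤ g a := by
  by_contra! hneg
  set δ := -(g a) / 2 with hδ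
  have hδ0 : 0 < δ := by rw [hδ]; linarith
  have hev : ∀ᶠ q in 𝓝 a, g q < -δ := hg.continuousAt.eventually (gt_mem_nhds (by rw [hδ]; linarith))
  obtain ⟨r, hr, hball⟩ := Metric.nhds_basis_closedBall.eventually_iff.1 hev
  set ε := min (δ / 4) (δ * r ^ 2 / 32) with hε
  have hε0 : 0 < ε := by rw [hε]; positivity
  have hε1 : ε ≤ δ / 4 := min_le_left _ _
  have hε2 : ε ≤ δ * r ^ 2 / 32 := min_le_right _ _
  obtain ⟨z, s, k, l⟩ := h ε hε0
  have hqs : ContDiff ℝ (⊤ : ℕ∞) (fun q : ℝ × ℝ => (q.1 - a.1) ^ 2 + (q.2 - a.2) ^ 2) := by fun_prop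
  set H : ℝ × ℝ → ℝ := fun q => 1 * z q + (-(δ / 8)) * ((q.1 - a.1) ^ 2 + (q.2 - a.2) ^ 2) with hH
  have hHs : ContDiff ℝ (⊤ : ℕ∞) H := (contDiff_const.mul s.1).add (contDiff_const.mul hqs)
  obtain ⟨p, hpB, hp⟩ := (isCompact_closedBall a r).exists_isMaxOn
    ⟨a, Metric.mem_closedBall_self hr.le⟩ hHs.continuous.continuousOn
  rcases (Metric.mem_closedBall.1 hpB).lt_or_eq with hlt | heq
  · have hloc : IsLocalMax H p := by
      filter_upwards [Metric.isOpen_ball.mem_nhds (Metric.mem_ball.2 hlt)] with q hq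
      exact hp (Metric.ball_subset_closedBall hq)
    have h1 := lap_nonneg_of_localMax hHs hloc
    rw [hH, lap_lin s.1 hqs, lap_quad] at h1
    have h2 := hball hpB
    have h3 := (abs_le.1 (l p)).2
    linarith
  · have h1 : H a ≤ H p := hp (Metric.mem_closedBall_self hr.le)
    have hsq : r ^ 2 ≤ (p.1 - a.1) ^ 2 + (p.2 - a.2) ^ 2 := by
      rw [← heq, Prod.dist_eq, Real.dist_eq, Real.dist_eq]
      rcases max_cases |p.1 - a.1| |p.2 - a.2| with ⟨e, _⟩ | ⟨e, _⟩ <;> rw [e, sq_abs] <;>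
      nlinarith [sq_nonneg (p.1 - a.1), sq_nonneg (p.2 - a.2)]
    simp only [hH] at h1
    have h2 := abs_le.1 (k a)
    have h3 := abs_le.1 (k p)
    rw [hf] at h2 h3
    have : δ / 8 * r ^ 2 ≤ δ / 8 * ((p.1 - a.1) ^ 2 + (p.2 - a.2) ^ 2) := by gcongr
    simp only [sub_self] at h1
    have : 0 < δ * r ^ 2 := by positivity
    linarith

lemma R.eq_lap {v w : ℝ × ℝ → ℝ} (h : R v w) (hv : Sm v) (hw : Continuous w) (p : ℝ × ℝ) :
    posLaplacian v p = w p := by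
  have hc : Continuous (posLaplacian v) := by
    have := lap_cont hv.1
    exact (this.1.add this.2).neg
  have h1 := (h.lin (R.of_smooth hv) 1 (-1)).zero_nonneg (fun p => by ring)
    ((continuous_const.mul hw).add (continuous_const.mul hc)) p
  have h2 := (h.lin (R.of_smooth hv) (-1) 1).zero_nonneg (fun p => by ring)
    ((continuous_const.mul hw).add (continuous_const.mul hc)) p
  linarith

/-! ### trigonometric approximation -/

lemma dd_trig (a b m c s : ℝ) :
    deriv (deriv (fun t : ℝ => a * Real.cos (m * t + c) + b * Real.sin (m * t + c))) s
      = -m ^ 2 * (a * Real.cos (m * s + c) + b * Real.sin (m * s + c)) := by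
  have key : ∀ a b s : ℝ, HasDerivAt (fun t : ℝ => a * Real.cos (m * t + c) + b * Real.sin (m * t + c))
      ((b * m) * Real.cos (m * s + c) + (-(a * m)) * Real.sin (m * s + c)) s := by
    intro a b s
    have h := ((hasDerivAt_id s).const_mul m).add_const c
    have h1 := h.cos.const_mul a
    have h2 := h.sin.const_mul b
    refine (h1.add h2).congr_deriv ?_
    simp only [id]; ring
  rw [show deriv (fun t : ℝ => a * Real.cos (m * t + c) + b * Real.sin (m * t + c)) = _ from
    funext fun s => (key a b s).deriv]
  rw [(key _ _ s).deriv]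
  ring

lemma sm_trig (a b : ℝ) (m n : ℤ) :
    Sm (fun p => a * Real.cos (2 * Real.pi * (m * p.1 + n * p.2))
      + b * Real.sin (2 * Real.pi * (m * p.1 + n * p.2))) ∧
    ∀ p, posLaplacian (fun p => a * Real.cos (2 * Real.pi * (m * p.1 + n * p.2))
      + b * Real.sin (2 * Real.pi * (m * p.1 + n * p.2))) p
      = (4 * Real.pi ^ 2 * (m ^ 2 + n ^ 2)) * (a * Real.cos (2 * Real.pi * (m * p.1 + n * p.2))
      + b * Real.sin (2 * Real.pi * (m * p.1 + n * p.2))) := by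
  refine ⟨⟨by fun_prop, fun x y => ?_⟩, fun p => ?_⟩
  · have e1 : 2 * Real.pi * (m * (x + 1) + n * y) = 2 * Real.pi * (m * x + n * y) + m * (2 * Real.pi) := by ring
    have e2 : 2 * Real.pi * (m * x + n * (y + 1)) = 2 * Real.pi * (m * x + n * y) + n * (2 * Real.pi) := by ring
    simp only [e1, e2, Real.cos_add_int_mul_two_pi, Real.sin_add_int_mul_two_pi, and_self]
  · unfold posLaplacian
    have h1 := dd_trig a b (2 * Real.pi * m) (2 * Real.pi * (n * p.2)) p.1
    have h2 := dd_trig a b (2 * Real.pi * n) (2 * Real.pi * (m * p.1)) p.2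
    have e1 : ∀ t : ℝ, 2 * Real.pi * m * t + 2 * Real.pi * (n * p.2) = 2 * Real.pi * (m * t + n * p.2) :=
      fun t => by ring
    have e2 : ∀ t : ℝ, 2 * Real.pi * n * t + 2 * Real.pi * (m * p.1) = 2 * Real.pi * (m * p.1 + n * t) :=
      fun t => by ring
    simp only [e1] at h1
    simp only [e2] at h2
    rw [h1, h2]; ring

noncomputable def toT (p : ℝ × ℝ) : UnitAddTorus (Fin 2) := fun i => ((![p.1, p.2] i : ℝ) : UnitAddCircle)

lemma exists_lift {h : ℝ × ℝ → ℝ} (hc : Continuous h) (hp : ZSqPeriodic h) :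
    ∃ H : C(UnitAddTorus (Fin 2), ℂ), ∀ p, H (toT p) = (h p : ℂ) := by
  let π : C(Fin 2 → ℝ, UnitAddTorus (Fin 2)) :=
    ⟨Pi.map (fun _ => ((↑) : ℝ → UnitAddCircle)), by
      refine continuous_pi fun i => ?_
      exact (AddCircle.continuous_mk' 1).comp (continuous_apply i)⟩
  have hπ : IsQuotientMap π :=
    (IsOpenQuotientMap.piMap (f := fun _ : Fin 2 => ((↑) : ℝ → UnitAddCircle))
      fun _ => QuotientAddGroup.isOpenQuotientMap_mk).isQuotientMap
  let g : C(Fin 2 → ℝ, ℂ) := ⟨fun f => (h (f 0, f 1) : ℂ), by fun_prop⟩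
  have hfac : Function.FactorsThrough g π := by
    intro f f' hff
    have key : ∀ i, ∃ n : ℤ, f i = f' i + n := by
      intro i
      have h1 : ((f i : ℝ) : UnitAddCircle) = ((f' i : ℝ) : UnitAddCircle) := congrFun hff i
      have := QuotientAddGroup.eq_iff_sub_mem.1 h1
      obtain ⟨n, hn⟩ := AddSubgroup.mem_zmultiples_iff.1 this
      refine ⟨n, ?_⟩
      simp at hn
      linarith
    obtain ⟨m, hm⟩ := key 0
    obtain ⟨n, hn⟩ := key 1
    change (h (f 0, f 1) : ℂ) = (h (f' 0, f' 1) : ℂ)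
    rw [hm, hn, per_int hp]
  refine ⟨hπ.lift g hfac, fun p => ?_⟩
  have := DFunLike.congr_fun (hπ.lift_comp g hfac) ![p.1, p.2]
  rw [ContinuousMap.comp_apply] at this
  exact this

lemma mFourier_toT (n : Fin 2 → ℤ) (c : ℂ) (p : ℝ × ℝ) :
    (c * UnitAddTorus.mFourier n (toT p)).re
      = c.re * Real.cos (2 * Real.pi * (n 0 * p.1 + n 1 * p.2))
        + (-c.im) * Real.sin (2 * Real.pi * (n 0 * p.1 + n 1 * p.2)) := by
  have : UnitAddTorus.mFourier n (toT p)
      = Complex.exp ((2 * Real.pi * (n 0 * p.1 + n 1 * p.2) : ℝ) * Complex.I) := by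
    simp only [UnitAddTorus.mFourier, ContinuousMap.coe_mk, Fin.prod_univ_two, toT,
      Matrix.cons_val_zero, Matrix.cons_val_one, fourier_coe_apply]
    rw [← Complex.exp_add]
    congr 1
    push_cast
    ring
  rw [this, Complex.mul_re, Complex.exp_ofReal_mul_I_re, Complex.exp_ofReal_mul_I_im]
  ring

lemma solve_span (K : ℝ) (hK : 0 ≤ K) (q : C(UnitAddTorus (Fin 2), ℂ))
    (hq : q ∈ Submodule.span ℂ (range (UnitAddTorus.mFourier (d := Fin 2)))) :
    ∀ c : ℂ, ∃ z κ, Sm z ∧ ∀ p, posLaplacian z p + K * z p + κ = (c * q (toT p)).re := by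
  induction hq using Submodule.span_induction with
  | mem x hx =>
    intro c
    obtain ⟨n, rfl⟩ := hx
    set lam := 4 * Real.pi ^ 2 * ((n 0 : ℝ) ^ 2 + (n 1 : ℝ) ^ 2) + K with hlam
    rcases (show 0 ≤ lam by positivity).eq_or_lt with h0 | h0
    · have hpi := Real.pi_pos
      have hs : 0 ≤ ((n 0 : ℝ) ^ 2 + (n 1 : ℝ) ^ 2) := by positivity
      have hz : ((n 0 : ℝ) ^ 2 + (n 1 : ℝ) ^ 2) = 0 := by
        by_contra hne
        have : 0 < ((n 0 : ℝ) ^ 2 + (n 1 : ℝ) ^ 2) := lt_of_le_of_ne hs (Ne.symm hne)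
        have : 0 < 4 * Real.pi ^ 2 * ((n 0 : ℝ) ^ 2 + (n 1 : ℝ) ^ 2) := by positivity
        linarith
      have n0 : (n 0 : ℝ) = 0 := by nlinarith [sq_nonneg (n 0 : ℝ), sq_nonneg (n 1 : ℝ)]
      have n1 : (n 1 : ℝ) = 0 := by nlinarith [sq_nonneg (n 0 : ℝ), sq_nonneg (n 1 : ℝ)]
      refine ⟨fun _ => 0, c.re, Sm.const 0, fun p => ?_⟩
      rw [mFourier_toT, n0, n1, lap_const]; simp
    · obtain ⟨h1, h2⟩ := sm_trig (c.re / lam) (-c.im / lam) (n 0) (n 1)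
      refine ⟨_, 0, h1, fun p => ?_⟩
      rw [h2, mFourier_toT]
      have : lam ≠ 0 := h0.ne'
      rw [← add_mul, add_zero, ← hlam]
      field_simp
  | zero => exact fun c => ⟨fun _ => 0, 0, Sm.const 0, fun p => by rw [lap_const]; simp⟩
  | add x y _ _ hx hy =>
    intro c
    obtain ⟨z₁, κ₁, s₁, h₁⟩ := hx c
    obtain ⟨z₂, κ₂, s₂, h₂⟩ := hy c
    refine ⟨_, κ₁ + κ₂, s₁.lin s₂ 1 1, fun p => ?_⟩
    rw [lap_lin s₁.1 s₂.1, ContinuousMap.add_apply, mul_add c, Complex.add_re, ← h₁, ← h₂]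
    ring
  | smul a x _ hx =>
    intro c
    obtain ⟨z, κ, s, h⟩ := hx (c * a)
    refine ⟨z, κ, s, fun p => ?_⟩
    rw [h, ContinuousMap.smul_apply, smul_eq_mul, mul_assoc]

lemma approx {h : ℝ × ℝ → ℝ} (hc : Continuous h) (hp : ZSqPeriodic h) {K : ℝ} (hK : 0 ≤ K)
    {ε : ℝ} (hε : 0 < ε) :
    ∃ z κ, Sm z ∧ ∀ p, |posLaplacian z p + K * z p + κ - h p| ≤ ε := by
  obtain ⟨H, hH⟩ := exists_lift hc hp
  have hmem : H ∈ (Submodule.span ℂ (range (UnitAddTorus.mFourier (d := Fin 2)))).topologicalClosure := by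
    rw [UnitAddTorus.span_mFourier_closure_eq_top]; trivial
  obtain ⟨q, hq, hd⟩ := Metric.mem_closure_iff.1 hmem ε hε
  obtain ⟨z, κ, s, hz⟩ := solve_span K hK q hq 1
  refine ⟨z, κ, s, fun p => ?_⟩
  rw [hz, one_mul]
  have h1 : ‖(q - H) (toT p)‖ ≤ ‖q - H‖ := (q - H).norm_coe_le_norm _
  rw [← dist_eq_norm, dist_comm, ContinuousMap.sub_apply, hH] at h1
  have h2 := Complex.abs_re_le_norm (q (toT p) - (h p : ℂ))
  rw [Complex.sub_re, Complex.ofReal_re] at h2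
  linarith

lemma approx_pos {h : ℝ × ℝ → ℝ} (hc : Continuous h) (hp : ZSqPeriodic h) {K : ℝ} (hK : 0 < K)
    {ε : ℝ} (hε : 0 < ε) :
    ∃ z, Sm z ∧ ∀ p, |posLaplacian z p + K * z p - h p| ≤ ε := by
  obtain ⟨z, κ, s, hz⟩ := approx hc hp hK.le hε
  refine ⟨_, s.lin (Sm.const κ) 1 (1/K), fun p => ?_⟩
  rw [lap_lin s.1 (Sm.const κ).1, lap_const]
  convert hz p using 2
  field_simp
  ring

noncomputable def mean (h : ℝ × ℝ → ℝ) : ℝ := ∫ x in (0:ℝ)..1, ∫ y in (0:ℝ)..1, h (x, y)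

lemma mean_swap {h : ℝ × ℝ → ℝ} (hc : Continuous h) :
    mean h = ∫ y in (0:ℝ)..1, ∫ x in (0:ℝ)..1, h (x, y) := by
  unfold mean
  apply MeasureTheory.intervalIntegral_intervalIntegral_swap (F := fun x y => h (x, y))
  have : IsCompact (Icc (0:ℝ) 1 ×ˢ Icc (0:ℝ) 1) := isCompact_Icc.prod isCompact_Icc
  refine (hc.continuousOn.integrableOn_compact this).mono_set ?_
  rw [uIoc_of_le zero_le_one]
  exact prod_mono Ioc_subset_Icc_self Ioc_subset_Icc_self

lemma cont_inner {h : ℝ × ℝ → ℝ} (hc : Continuous h) :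
    Continuous (fun x => ∫ y in (0:ℝ)..1, h (x, y)) :=
  intervalIntegral.continuous_parametric_intervalIntegral_of_continuous' (f := fun x y => h (x, y)) (by exact hc) 0 1

lemma mean_lin {f g : ℝ × ℝ → ℝ} (hf : Continuous f) (hg : Continuous g) (a b : ℝ) :
    mean (fun p => a * f p + b * g p) = a * mean f + b * mean g := by
  unfold mean
  have e : ∀ x, ∫ y in (0:ℝ)..1, (a * f (x, y) + b * g (x, y))
      = a * (∫ y in (0:ℝ)..1, f (x, y)) + b * ∫ y in (0:ℝ)..1, g (x, y) := by
    intro x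
    rw [intervalIntegral.integral_add, intervalIntegral.integral_const_mul,
      intervalIntegral.integral_const_mul]
    · exact Continuous.intervalIntegrable (by fun_prop) _ _
    · exact Continuous.intervalIntegrable (by fun_prop) _ _
  simp only [e]
  have cf := cont_inner hf
  have cg := cont_inner hg
  rw [intervalIntegral.integral_add, intervalIntegral.integral_const_mul,
      intervalIntegral.integral_const_mul]
  · exact Continuous.intervalIntegrable (by fun_prop) _ _
  · exact Continuous.intervalIntegrable (by fun_prop) _ _

lemma mean_const (c : ℝ) : mean (fun _ => c) = c := by simp [mean]

lemma mean_abs_le {f : ℝ × ℝ → ℝ} {ε : ℝ} (h : ∀ p, |f p| ≤ ε) : |mean f| ≤ ε := by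
  unfold mean
  have h1 : ∀ x, ‖∫ y in (0:ℝ)..1, f (x, y)‖ ≤ ε := fun x => by
    have := intervalIntegral.norm_integral_le_of_norm_le_const (a := 0) (b := 1)
      (f := fun y => f (x, y)) (C := ε) (fun y _ => h _)
    simpa using this
  have := intervalIntegral.norm_integral_le_of_norm_le_const (a := 0) (b := 1)
      (f := fun x => ∫ y in (0:ℝ)..1, f (x, y)) (C := ε) (fun x _ => h1 x)
  simpa using this

lemma int_dd {f : ℝ → ℝ} (hf : ContDiff ℝ (⊤ : ℕ∞) f) (hp : ∀ x, f (x + 1) = f x) :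
    ∫ x in (0:ℝ)..1, deriv (deriv f) x = 0 := by
  rw [intervalIntegral.integral_deriv_eq_sub
    (fun x _ => (smooth_deriv hf).differentiable (by simp) x)
    ((smooth_deriv (smooth_deriv hf)).continuous.intervalIntegrable _ _)]
  have : deriv f (0 + 1) = deriv f 0 := by
    rw [← deriv_comp_add_const]; congr 1; funext x; exact hp x
  rw [zero_add] at this
  rw [this, sub_self]

lemma mean_lap {z : ℝ × ℝ → ℝ} (hz : Sm z) : mean (posLaplacian z) = 0 := by
  obtain ⟨c1, c2⟩ := lap_cont hz.1
  have e : posLaplacian z = fun p => (-1) * (deriv (deriv (fun s => z (s, p.2))) p.1)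
      + (-1) * (deriv (deriv (fun t => z (p.1, t))) p.2) := by
    funext p; unfold posLaplacian; ring
  rw [e, mean_lin c1 c2, mean_swap c1]
  have h1 : ∀ y, ∫ x in (0:ℝ)..1, deriv (deriv (fun s => z (s, y))) x = 0 := fun y =>
    int_dd (smooth_slice1 hz.1 y) (fun x => (hz.2 x y).1)
  have h2 : ∀ x, ∫ y in (0:ℝ)..1, deriv (deriv (fun s => z (x, s))) y = 0 := fun x =>
    int_dd (smooth_slice2 hz.1 x) (fun y => (hz.2 x y).2)
  simp [h1, mean, h2]

lemma approx_poisson {h : ℝ × ℝ → ℝ} (hc : Continuous h) (hp : ZSqPeriodic h)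
    {ε : ℝ} (hε : 0 < ε) :
    ∃ z, Sm z ∧ ∀ p, |posLaplacian z p - (h p - mean h)| ≤ ε := by
  obtain ⟨z, κ, s, hz⟩ := approx hc hp le_rfl (half_pos hε)
  have hcl : Continuous (posLaplacian z) := by
    have := lap_cont s.1
    exact (this.1.add this.2).neg
  have hm : |κ - mean h| ≤ ε / 2 := by
    have h1 := mean_abs_le (f := fun p => 1 * (1 * posLaplacian z p + κ * 1) + (-1) * h p)
      (fun p => by convert hz p using 2; ring)
    rw [mean_lin (by fun_prop) hc, mean_lin hcl (by fun_prop), mean_lap s, mean_const] at h1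
    convert h1 using 2; ring
  refine ⟨z, s, fun p => ?_⟩
  have h1 := abs_le.1 hm
  have h2 := abs_le.1 (hz p)
  rw [abs_le]; constructor <;> linarith


lemma mp_le {z : ℝ × ℝ → ℝ} (hz : Sm z) {K M : ℝ} (hK : 0 < K)
    (h : ∀ p, posLaplacian z p + K * z p ≤ M) (q : ℝ × ℝ) : K * z q ≤ M := by
  obtain ⟨p, hp⟩ := exists_max hz.1.continuous hz.2
  have h1 := lap_nonneg_of_max hz.1 hp
  have h2 := h p
  have h3 : K * z q ≤ K * z p := by gcongr; exact hp q
  linarith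

lemma exists_resolvent {h : ℝ × ℝ → ℝ} (hc : Continuous h) (hp : ZSqPeriodic h) {K : ℝ} (hK : 0 < K) :
    ∃ v, R v (fun p => h p - K * v p) := by
  choose z s l using fun n : ℕ => approx_pos hc hp hK (ε := 1 / ((n : ℝ) + 1)) (by positivity)
  have hlim : Tendsto (fun n : ℕ => 1 / ((n : ℝ) + 1)) atTop (𝓝 0) :=
    tendsto_one_div_add_atTop_nhds_zero_nat
  have hsmall : ∀ ε > 0, ∃ N : ℕ, ∀ n ≥ N, 1 / ((n : ℝ) + 1) < ε := by
    intro ε hε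
    obtain ⟨N, hN⟩ := (Metric.tendsto_atTop.1 hlim) ε hε
    refine ⟨N, fun n hn => ?_⟩
    have := hN n hn
    rw [Real.dist_eq, sub_zero] at this
    exact (le_abs_self _).trans_lt this
  have hdiff : ∀ m n p, K * (z m p - z n p) ≤ 1 / ((m : ℝ) + 1) + 1 / ((n : ℝ) + 1) := by
    intro m n p
    have := mp_le ((s m).lin (s n) 1 (-1)) hK (M := 1 / ((m : ℝ) + 1) + 1 / ((n : ℝ) + 1)) (fun q => by
      rw [lap_lin (s m).1 (s n).1]
      have h1 := abs_le.1 (l m q)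
      have h2 := abs_le.1 (l n q)
      linarith) p
    linarith
  have hu : UniformCauchySeqOn z atTop univ := by
    rw [Metric.uniformCauchySeqOn_iff]
    intro ε hε
    obtain ⟨N, hN⟩ := hsmall (K * ε / 2) (by positivity)
    refine ⟨N, fun m hm n hn p _ => ?_⟩
    have h1 := hN m hm
    have h2 := hN n hn
    have h3 := hdiff m n p
    have h4 := hdiff n m p
    rw [Real.dist_eq, abs_lt]
    constructor <;> nlinarith
  have hex : ∀ p, ∃ L, Tendsto (fun n => z n p) atTop (𝓝 L) := fun p =>
    cauchySeq_tendsto_of_complete (hu.cauchySeq (mem_univ p))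
  choose v hv using hex
  have hU := hu.tendstoUniformlyOn_of_tendsto (fun p _ => hv p)
  rw [Metric.tendstoUniformlyOn_iff] at hU
  refine ⟨v, fun ε hε => ?_⟩
  obtain ⟨N, hN⟩ := hsmall (ε / 2) (by positivity)
  obtain ⟨n, hn1, hn2⟩ := ((hU (min ε (ε / (2 * K))) (by positivity)).and
    (eventually_ge_atTop N)).exists
  have key : ∀ p, |z n p - v p| ≤ min ε (ε / (2 * K)) := fun p => by
    have := hn1 p (mem_univ p)
    rw [dist_comm, Real.dist_eq] at this
    exact this.le
  refine ⟨z n, s n, fun p => (key p).trans (min_le_left _ _), fun p => ?_⟩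
  have h1 := abs_le.1 (l n p)
  have h2 := hN n hn2
  have h3 : K * |z n p - v p| ≤ ε / 2 := by
    calc K * |z n p - v p| ≤ K * (ε / (2 * K)) := by
          gcongr; exact (key p).trans (min_le_right _ _)
      _ = ε / 2 := by field_simp
  have h3b : |K * (z n p - v p)| ≤ ε / 2 := by rw [abs_mul, abs_of_pos hK]; exact h3
  have h4 := abs_le.1 h3b
  rw [abs_le]; constructor <;> linarith

lemma R.nonneg {v f : ℝ × ℝ → ℝ} (h : R v f) {K : ℝ} (hK : 0 < K)
    (hf : ∀ p, 0 ≤ f p + K * v p) (q : ℝ × ℝ) : 0 ≤ v q := by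
  suffices 0 ≤ K * v q by nlinarith
  apply le_of_forall_pos_le_add
  intro ε hε
  set δ := ε / (1 + 2 * K) with hδ
  have hδ0 : 0 < δ := by positivity
  have hδe : δ * (1 + 2 * K) = ε := by rw [hδ]; field_simp
  obtain ⟨z, s, k, l⟩ := h δ hδ0
  have := mp_le (s.lin s (-1) 0) hK (M := (1 + K) * δ) (fun p => by
    rw [lap_lin s.1 s.1]
    have h1 := abs_le.1 (k p)
    have h2 := abs_le.1 (l p)
    have h3 := hf p
    nlinarith) q
  have h1 := abs_le.1 (k q)
  nlinarith

lemma R.cmp {v₁ v₂ h₁ h₂ : ℝ × ℝ → ℝ} {K : ℝ} (hK : 0 < K) (r₁ : R v₁ (fun p => h₁ p - K * v₁ p))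
    (r₂ : R v₂ (fun p => h₂ p - K * v₂ p)) (h : ∀ p, h₁ p ≤ h₂ p) (q : ℝ × ℝ) : v₁ q ≤ v₂ q := by
  have := (r₂.lin r₁ 1 (-1)).nonneg hK (fun p => by linarith [h p]) q
  linarith

lemma exp_diff_le {s t : ℝ} : Real.exp t - Real.exp s ≤ Real.exp t * (t - s) := by
  have h := Real.add_one_le_exp (s - t)
  have e : Real.exp s = Real.exp t * Real.exp (s - t) := by rw [← Real.exp_add]; ring_nf
  rw [e]
  nlinarith [Real.exp_pos t]

lemma exp_diff_ge {s t : ℝ} : Real.exp s * (t - s) ≤ Real.exp t - Real.exp s := by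
  have := exp_diff_le (s := t) (t := s)
  linarith

lemma mean_pos {P : ℝ × ℝ → ℝ} (hc : Continuous P) (hp : ZSqPeriodic P) (h0 : ∀ p, 0 ≤ P p)
    (hne : ¬ ∀ p, P p = 0) : 0 < mean P := by
  push Not at hne
  obtain ⟨p, hp0⟩ := hne
  obtain ⟨m, n, hmn⟩ := per_rep p
  have hpos : 0 < P (p.1 + m, p.2 + n) := by
    rw [per_int hp]; exact lt_of_le_of_ne (h0 p) (Ne.symm hp0)
  unfold mean
  refine intervalIntegral.integral_pos one_pos (cont_inner hc).continuousOn
    (fun x _ => intervalIntegral.integral_nonneg zero_le_one fun y _ => h0 _) ⟨_, hmn.1, ?_⟩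
  exact intervalIntegral.integral_pos one_pos (Continuous.continuousOn (by fun_prop))
    (fun y _ => h0 _) ⟨_, hmn.2, hpos⟩

lemma barrier {P Q w : ℝ × ℝ → ℝ} (cP : Continuous P) (cQ : Continuous Q) (cw : Continuous w)
    (pP : ZSqPeriodic P) (pQ : ZSqPeriodic Q) (pw : ZSqPeriodic w) (hP : ∀ p, 0 ≤ P p)
    (hQ : ∀ p, 0 ≤ Q p) (hne : ¬ ∀ p, P p = 0) (hw : mean w = 0) :
    ∃ φ C₀, Sm φ ∧ ∀ C ≥ C₀, ∀ p,
      w p ≤ posLaplacian φ p + P p * Real.exp (φ p + C) - Q p * Real.exp (-(φ p + C)) := by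
  have hμ := mean_pos cP pP hP hne
  set μ := mean P with hμd
  obtain ⟨φ, s, hφ⟩ := approx_poisson (h := fun p => 1 * w p + (-1) * P p) (by fun_prop)
    (per_lin pw pP (fun a b => 1 * a + (-1) * b)) (ε := μ / 4) (by positivity)
  rw [mean_lin cw cP, hw, ← hμd] at hφ
  obtain ⟨B, hB0, hB⟩ := bdd_per s.1.continuous s.2
  obtain ⟨BQ, hBQ0, hBQ⟩ := bdd_per cQ pQ
  refine ⟨φ, B + 2 * BQ / μ, s, fun C hC p => ?_⟩
  set t := φ p + C with ht
  have h1 := abs_le.1 (hB p)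
  have hdiv : 0 < 2 * BQ / μ := by positivity
  have htge : 2 * BQ / μ ≤ t := by rw [ht]; linarith
  have ht0 : 0 ≤ t := by linarith
  have e1 : 1 ≤ Real.exp t := Real.one_le_exp ht0
  have e2 : Q p * Real.exp (-t) ≤ μ / 2 := by
    rw [Real.exp_neg, ← div_eq_mul_inv, div_le_iff₀ (Real.exp_pos t)]
    have h2 := abs_le.1 (hBQ p)
    have h3 := Real.add_one_le_exp t
    have h4 : 2 * BQ ≤ t * μ := by rwa [div_le_iff₀ hμ] at htge
    nlinarith
  have h3 := abs_le.1 (hφ p)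
  have h4 : P p ≤ P p * Real.exp t := le_mul_of_one_le_right (hP p) e1
  linarith

lemma exists_sol_between {P Q w : ℝ × ℝ → ℝ}
    (sP : ContDiff ℝ (⊤ : ℕ∞) P) (sQ : ContDiff ℝ (⊤ : ℕ∞) Q) (sw : ContDiff ℝ (⊤ : ℕ∞) w)
    (pP : ZSqPeriodic P) (pQ : ZSqPeriodic Q) (pw : ZSqPeriodic w)
    (hP : ∀ p, 0 ≤ P p) (hQ : ∀ p, 0 ≤ Q p) {a b : ℝ × ℝ → ℝ} (sa : Sm a) (sb : Sm b)
    (hab : ∀ p, a p ≤ b p)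
    (ha : ∀ p, posLaplacian a p + P p * Real.exp (a p) - Q p * Real.exp (-(a p)) ≤ w p)
    (hb : ∀ p, w p ≤ posLaplacian b p + P p * Real.exp (b p) - Q p * Real.exp (-(b p))) :
    ∃ u, Sm u ∧ ∀ p, posLaplacian u p + P p * Real.exp (u p) - Q p * Real.exp (-(u p)) = w p := by
  have cP := sP.continuous
  have cQ := sQ.continuous
  have cw := sw.continuous
  obtain ⟨Na, Na0, hNa⟩ := bdd_per sa.1.continuous sa.2
  obtain ⟨Nb, Nb0, hNb⟩ := bdd_per sb.1.continuous sb.2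
  obtain ⟨BP, BP0, hBP⟩ := bdd_per cP pP
  obtain ⟨BQ, BQ0, hBQ⟩ := bdd_per cQ pQ
  obtain ⟨Bw, Bw0, hBw⟩ := bdd_per cw pw
  set N := Na + Nb with hN
  set K := (BP + BQ) * Real.exp N + 1 with hKd
  have hK : 0 < K := by positivity
  set F : ℝ × ℝ → ℝ → ℝ := fun p s => P p * Real.exp s - Q p * Real.exp (-s) - w p with hF
  set H : ℝ × ℝ → ℝ → ℝ := fun p s => K * s - F p s with hH
  have Hmono : ∀ p s t, s ≤ t → -N ≤ s → t ≤ N → H p s ≤ H p t := by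
    intro p s t hst hs ht
    have e1 : Real.exp t - Real.exp s ≤ Real.exp N * (t - s) :=
      exp_diff_le.trans (by gcongr)
    have e2 : Real.exp (-s) - Real.exp (-t) ≤ Real.exp N * (t - s) := by
      have := exp_diff_le (s := -t) (t := -s)
      refine this.trans ?_
      rw [show -s - -t = t - s by ring]
      gcongr; linarith
    have p1 := abs_le.1 (hBP p)
    have p2 := abs_le.1 (hBQ p)
    have hE : 0 ≤ Real.exp N * (t - s) := mul_nonneg (Real.exp_pos _).le (by linarith)
    have m1 := mul_le_mul_of_nonneg_left e1 (hP p)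
    have m2 := mul_le_mul_of_nonneg_left e2 (hQ p)
    have m3 := mul_le_mul_of_nonneg_right p1.2 hE
    have m4 := mul_le_mul_of_nonneg_right p2.2 hE
    have : K * (t - s) = BP * (Real.exp N * (t - s)) + BQ * (Real.exp N * (t - s)) + (t - s) := by
      rw [hKd]; ring
    simp only [hH, hF]
    linarith
  have Fmono : ∀ p s t, s ≤ t → F p s ≤ F p t := by
    intro p s t hst
    have m1 := mul_le_mul_of_nonneg_left (Real.exp_le_exp.2 hst) (hP p)
    have m2 := mul_le_mul_of_nonneg_left (Real.exp_le_exp.2 (neg_le_neg hst)) (hQ p)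
    simp only [hF]; linarith
  have Hlip : ∀ p s t, |s| ≤ N → |t| ≤ N → |H p s - H p t| ≤ K * |s - t| := by
    intro p s t hs ht
    wlog hst : t ≤ s generalizing s t
    · rw [abs_sub_comm, abs_sub_comm s]; exact this t s ht hs (by linarith)
    have h1 := Hmono p t s hst (abs_le.1 ht).1 (abs_le.1 hs).2
    have h2 := Fmono p t s hst
    rw [abs_of_nonneg (by linarith), abs_of_nonneg (by linarith)]
    simp only [hH]; linarith
  have Hc : ∀ u : ℝ × ℝ → ℝ, Continuous u → Continuous (fun p => H p (u p)) := by
    intro u hu; simp only [hH, hF]; fun_prop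
  have Hp : ∀ u : ℝ × ℝ → ℝ, ZSqPeriodic u → ZSqPeriodic (fun p => H p (u p)) := by
    intro u hu x y
    simp only [hH, hF, (hu x y).1, (hu x y).2, (pP x y).1, (pP x y).2, (pQ x y).1, (pQ x y).2,
      (pw x y).1, (pw x y).2, and_self]
  have hstep : ∀ u : {u : ℝ × ℝ → ℝ // Continuous u ∧ ZSqPeriodic u},
      ∃ v : {u : ℝ × ℝ → ℝ // Continuous u ∧ ZSqPeriodic u},
        R v.1 (fun p => H p (u.1 p) - K * v.1 p) := by
    rintro ⟨u, uc, up⟩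
    obtain ⟨v, hv⟩ := exists_resolvent (Hc u uc) (Hp u up) hK
    exact ⟨⟨v, hv.cont, hv.per⟩, hv⟩
  choose step hs using hstep
  set V : ℕ → {u : ℝ × ℝ → ℝ // Continuous u ∧ ZSqPeriodic u} :=
    fun n => step^[n] ⟨b, sb.1.continuous, sb.2⟩ with hV
  set U : ℕ → ℝ × ℝ → ℝ := fun n => (V n).1 with hU
  have hU0 : U 0 = b := rfl
  have hR : ∀ n, R (U (n + 1)) (fun p => H p (U n p) - K * U (n + 1) p) := by
    intro n
    have := hs (V n)
    have e : V (n + 1) = step (V n) := Function.iterate_succ_apply' _ _ _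
    rw [← e] at this
    exact this
  have Ra : R a (fun p => (posLaplacian a p + K * a p) - K * a p) := by
    have := R.of_smooth sa
    simpa only [add_sub_cancel_right] using this
  have Rb : R b (fun p => (posLaplacian b p + K * b p) - K * b p) := by
    have := R.of_smooth sb
    simpa only [add_sub_cancel_right] using this
  have Na' : ∀ p, -N ≤ a p := fun p => by have := (abs_le.1 (hNa p)).1; rw [hN]; linarith
  have Nb' : ∀ p, b p ≤ N := fun p => by have := (abs_le.1 (hNb p)).2; rw [hN]; linarith
  have hAll : ∀ n, (∀ p, a p ≤ U n p) ∧ (∀ p, U n p ≤ b p) ∧ ∀ p, U (n + 1) p ≤ U n p := by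
    intro n
    induction n with
    | zero =>
      refine ⟨hab, fun p => le_rfl, ?_⟩
      exact R.cmp hK (hR 0) Rb (fun p => by
        have := hb p
        simp only [hU0, hH, hF]; linarith)
    | succ n ih =>
      obtain ⟨i1, i2, i3⟩ := ih
      have j1 : ∀ p, a p ≤ U (n + 1) p := R.cmp hK Ra (hR n) (fun p => by
        have h1 := ha p
        have h2 := Hmono p _ _ (i1 p) (Na' p) ((i2 p).trans (Nb' p))
        refine le_trans ?_ h2
        simp only [hH, hF]; linarith)
      refine ⟨j1, fun p => (i3 p).trans (i2 p), ?_⟩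
      exact R.cmp hK (hR (n + 1)) (hR n) (fun p =>
        Hmono p _ _ (i3 p) ((Na' p).trans (j1 p)) ((i2 p).trans (Nb' p)))
  have hUN : ∀ n p, |U n p| ≤ N := fun n p =>
    abs_le.2 ⟨(Na' p).trans ((hAll n).1 p), ((hAll n).2.1 p).trans (Nb' p)⟩
  have hanti : ∀ p, Antitone (fun n => U n p) := fun p => antitone_nat_of_succ_le fun n => (hAll n).2.2 p
  set u : ℝ × ℝ → ℝ := fun p => ⨅ n, U n p with hu
  have hlim : ∀ p, Tendsto (fun n => U n p) atTop (𝓝 (u p)) := fun p =>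
    tendsto_atTop_ciInf (hanti p) ⟨-N, by rintro _ ⟨n, rfl⟩; exact (abs_le.1 (hUN n p)).1⟩
  have huN : ∀ p, |u p| ≤ N := fun p =>
    le_of_tendsto (hlim p).abs (Eventually.of_forall fun n => hUN n p)
  have hup : ZSqPeriodic u := fun x y => by
    constructor
    · simp only [hu]; congr 1; funext n; exact ((V n).2.2 x y).1
    · simp only [hu]; congr 1; funext n; exact ((V n).2.2 x y).2
  -- uniform Lipschitz bound
  have hucont : Continuous u := by
    set M := 2 * (K * N) + (BP * Real.exp N + BQ * Real.exp N + Bw) with hM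
    have hb1 : ∀ n p, |H p (U n p) - K * U (n + 1) p| ≤ M := by
      intro n p
      have h1 := abs_le.1 (hUN n p)
      have h2 := abs_le.1 (hUN (n + 1) p)
      have p1 := abs_le.1 (hBP p)
      have p2 := abs_le.1 (hBQ p)
      have p3 := abs_le.1 (hBw p)
      have k1 : K * U n p ≤ K * N := by gcongr; exact h1.2
      have k2 : K * (-N) ≤ K * U n p := by gcongr; exact h1.1
      have k3 : K * U (n + 1) p ≤ K * N := by gcongr; exact h2.2
      have k4 : K * (-N) ≤ K * U (n + 1) p := by gcongr; exact h2.1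
      have q1 : P p * Real.exp (U n p) ≤ BP * Real.exp N := by
        gcongr
        · exact p1.2
        · exact h1.2
      have q2 : Q p * Real.exp (-(U n p)) ≤ BQ * Real.exp N := by
        gcongr
        · exact p2.2
        · linarith
      have q3 : 0 ≤ P p * Real.exp (U n p) := mul_nonneg (hP p) (Real.exp_pos _).le
      have q4 : 0 ≤ Q p * Real.exp (-(U n p)) := mul_nonneg (hQ p) (Real.exp_pos _).le
      simp only [hH, hF, hM]
      rw [abs_le]; constructor <;> linarith
    refine (LipschitzWith.of_dist_le' (K := 2 * M) fun p q => ?_).continuous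
    rw [Real.dist_eq, dist_eq_norm]
    have ht : Tendsto (fun n => |U (n + 1) p - U (n + 1) q|) atTop (𝓝 |u p - u q|) :=
      (((hlim p).comp (tendsto_add_atTop_nat 1)).sub ((hlim q).comp (tendsto_add_atTop_nat 1))).abs
    exact le_of_tendsto ht (Eventually.of_forall fun n => (hR n).lip (hb1 n) p q)
  have hunif : ∀ ε > 0, ∃ n₀, ∀ n ≥ n₀, ∀ p, |U n p - u p| ≤ ε := by
    have hT := Antitone.tendstoUniformlyOn_of_forall_tendsto (F := U) (f := u) isCompact_Sq
      (fun n => (V n).2.1.continuousOn) (fun p _ => hanti p) hucont.continuousOn (fun p _ => hlim p)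
    rw [Metric.tendstoUniformlyOn_iff] at hT
    intro ε hε
    obtain ⟨n₀, hn₀⟩ := eventually_atTop.1 (hT ε hε)
    refine ⟨n₀, fun n hn => ?_⟩
    refine per_forall (f := fun p => |U n p - u p|) (T := fun t => t ≤ ε)
      (per_lin (V n).2.2 hup (fun s t => |s - t|)) (fun p hp => ?_)
    have := hn₀ n hn p hp
    rw [dist_comm, Real.dist_eq] at this
    exact this.le
  have hRu : R u (fun p => H p (u p) - K * u p) := by
    apply R.closed
    intro ε hε
    obtain ⟨n, hn⟩ := hunif (min ε (ε / (2 * K))) (by positivity)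
    refine ⟨_, _, hR n, fun p => (hn (n + 1) (by omega) p).trans (min_le_left _ _), fun p => ?_⟩
    have h1 := (hn n le_rfl p).trans (min_le_right _ _)
    have h2 := (hn (n + 1) (by omega) p).trans (min_le_right _ _)
    have h3 := Hlip p _ _ (hUN n p) (huN p)
    have h4 : K * (ε / (2 * K)) = ε / 2 := by field_simp
    have k1 := mul_le_mul_of_nonneg_left h1 hK.le
    have k2 := mul_le_mul_of_nonneg_left h2 hK.le
    have h5 : |K * U (n + 1) p - K * u p| ≤ ε / 2 := by
      rw [← mul_sub, abs_mul, abs_of_pos hK]; linarith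
    have h6 := abs_le.1 h5
    have h7 := abs_le.1 (h3.trans (k1.trans h4.le))
    rw [abs_le]; constructor <;> linarith
  have hRu' : R u (fun p => -F p (u p)) := by
    convert hRu using 2
    simp only [hH]; ring
  have pF : ZSqPeriodic (fun p => -F p (u p)) := by
    intro x y
    simp only [hF, (hup x y).1, (hup x y).2, (pP x y).1, (pP x y).2, (pQ x y).1, (pQ x y).2,
      (pw x y).1, (pw x y).2, and_self]
  have hFk : ∀ k : ℕ, ContDiff ℝ k u → ContDiff ℝ k (fun p => -F p (u p)) := by
    intro k hk
    have tP : ContDiff ℝ k P := contDiff_infty.1 sP k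
    have tQ : ContDiff ℝ k Q := contDiff_infty.1 sQ k
    have tw : ContDiff ℝ k w := contDiff_infty.1 sw k
    simp only [hF]
    exact (((tP.mul hk.exp).sub (tQ.mul hk.neg.exp)).sub tw).neg
  have hus : ∀ k : ℕ, ContDiff ℝ k u := by
    intro k
    induction k with
    | zero => exact contDiff_zero.2 hucont
    | succ k ih => exact R.contDiff k hRu' (hFk k ih) pF
  have hSm : Sm u := ⟨contDiff_infty.2 hus, hup⟩
  refine ⟨u, hSm, fun p => ?_⟩
  have := hRu'.eq_lap hSm (hFk 0 (hus 0)).continuous p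
  rw [this]
  simp only [hF]; ring

lemma unique_le {P Q w : ℝ × ℝ → ℝ} (cP : Continuous P) (pP : ZSqPeriodic P) (hP : ∀ p, 0 ≤ P p)
    (hQ : ∀ p, 0 ≤ Q p) (hne : ¬ ∀ p, P p = 0) {u v : ℝ × ℝ → ℝ} (su : Sm u) (sv : Sm v)
    (hu : ∀ p, posLaplacian u p + P p * Real.exp (u p) - Q p * Real.exp (-(u p)) = w p)
    (hv : ∀ p, posLaplacian v p + P p * Real.exp (v p) - Q p * Real.exp (-(v p)) = w p)
    (a : ℝ × ℝ) : u a ≤ v a := by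
  by_contra! hlt
  have hμ := mean_pos cP pP hP hne
  set μ := mean P with hμd
  obtain ⟨ψ, s, hψ⟩ := approx_poisson (h := fun p => (-1) * P p + 0 * P p) (by fun_prop)
    (per_lin pP pP (fun a b => (-1) * a + 0 * b)) (ε := μ / 2) (by positivity)
  rw [mean_lin cP cP, ← hμd] at hψ
  obtain ⟨B, hB0, hB⟩ := bdd_per s.1.continuous s.2
  obtain ⟨Bv, hBv0, hBv⟩ := bdd_per sv.1.continuous sv.2
  set m := u a - v a with hm
  have hm0 : 0 < m := by rw [hm]; linarith
  set c := Real.exp (-Bv) with hc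
  have hc0 : 0 < c := Real.exp_pos _
  set τ := min (m / (4 * B)) (c * m / 2) with hτ
  have hτ0 : 0 < τ := by rw [hτ]; positivity
  have hτ1 : τ * B ≤ m / 4 := by
    calc τ * B ≤ m / (4 * B) * B := by gcongr; exact min_le_left _ _
      _ = m / 4 := by field_simp
  have hτ2 : τ ≤ c * m / 2 := min_le_right _ _
  have sd : Sm (fun q => 1 * u q + (-1) * v q) := su.lin sv 1 (-1)
  have sD := sd.lin s 1 (-τ)
  obtain ⟨p, hp⟩ := exists_max sD.1.continuous sD.2
  have h1 := lap_nonneg_of_max sD.1 hp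
  rw [lap_lin sd.1 s.1, lap_lin su.1 sv.1] at h1
  have h2 := hp a
  have h3 := abs_le.1 (hB p)
  have h4 := abs_le.1 (hB a)
  have hd : m / 2 ≤ u p - v p := by
    have k1 : τ * ψ a ≤ τ * B := by gcongr; exact h4.2
    have k2 : τ * (-B) ≤ τ * ψ p := by gcongr; exact h3.1
    linarith
  have h5 := abs_le.1 (hψ p)
  have h6 : τ * (μ / 2 - P p) ≤ τ * posLaplacian ψ p := by gcongr; linarith
  have h7 : c * (m / 2) ≤ Real.exp (u p) - Real.exp (v p) := by
    refine le_trans ?_ exp_diff_ge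
    have : c ≤ Real.exp (v p) := Real.exp_le_exp.2 (abs_le.1 (hBv p)).1
    gcongr
  have h8 := mul_le_mul_of_nonneg_left h7 (hP p)
  have h9 : Real.exp (-(u p)) ≤ Real.exp (-(v p)) := Real.exp_le_exp.2 (by linarith)
  have h10 := mul_le_mul_of_nonneg_left h9 (hQ p)
  have h11 := hu p
  have h12 := hv p
  have h13 : P p * τ ≤ P p * (c * m / 2) := mul_le_mul_of_nonneg_left hτ2 (hP p)
  have h14 : 0 < τ * μ := by positivity
  nlinarith

end

/-- For smooth `ℤ²`-periodic `P, Q, w : ℝ² → ℝ` with `P ≥ 0`,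
`Q ≥ 0`, neither `P` nor `Q` identically zero, and `∫_{[0,1]²} w = 0`, there is
a unique smooth `ℤ²`-periodic `u : ℝ² → ℝ` with
`Δu + P e^u − Q e^{−u} = w` on `ℝ²` (with `Δ` the positive Laplacian). -/
theorem statement4 (P Q w : ℝ × ℝ → ℝ)
    (hPsmooth : ContDiff ℝ (⊤ : ℕ∞) P) (hQsmooth : ContDiff ℝ (⊤ : ℕ∞) Q)
    (hwsmooth : ContDiff ℝ (⊤ : ℕ∞) w)
    (hPper : ZSqPeriodic P) (hQper : ZSqPeriodic Q) (hwper : ZSqPeriodic w)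
    (hPnonneg : ∀ p, 0 ≤ P p) (hQnonneg : ∀ p, 0 ≤ Q p)
    (hPne : ¬ ∀ p, P p = 0) (hQne : ¬ ∀ p, Q p = 0)
    (hwint : (∫ x in (0:ℝ)..1, ∫ y in (0:ℝ)..1, w (x, y)) = 0) :
    ∃! u : ℝ × ℝ → ℝ, ContDiff ℝ (⊤ : ℕ∞) u ∧ ZSqPeriodic u ∧
      ∀ p : ℝ × ℝ,
        posLaplacian u p + P p * Real.exp (u p) - Q p * Real.exp (-(u p)) = w p := by
  have cP := hPsmooth.continuous
  have cQ := hQsmooth.continuous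
  have cw := hwsmooth.continuous
  have hw : mean w = 0 := hwint
  obtain ⟨φ, C₁, sφ, hφ⟩ := barrier cP cQ cw hPper hQper hwper hPnonneg hQnonneg hPne hw
  have hw' : mean (fun p => (-1) * w p + 0 * w p) = 0 := by rw [mean_lin cw cw, hw]; ring
  obtain ⟨χ, C₂, sχ, hχ⟩ := barrier cQ cP (w := fun p => (-1) * w p + 0 * w p) (by fun_prop)
    hQper hPper (per_lin hwper hwper (fun a b => (-1) * a + 0 * b)) hQnonneg hPnonneg hQne hw'
  obtain ⟨Bφ, -, hBφ⟩ := bdd_per sφ.1.continuous sφ.2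
  obtain ⟨Bχ, -, hBχ⟩ := bdd_per sχ.1.continuous sχ.2
  set C := max (max C₁ C₂) (max Bφ Bχ) with hC
  have c1 : C₁ ≤ C := (le_max_left _ _).trans (le_max_left _ _)
  have c2 : C₂ ≤ C := (le_max_right _ _).trans (le_max_left _ _)
  have c3 : Bφ ≤ C := (le_max_left _ _).trans (le_max_right _ _)
  have c4 : Bχ ≤ C := (le_max_right _ _).trans (le_max_right _ _)
  have sb := sφ.lin (Sm.const C) 1 1
  have sa := sχ.lin (Sm.const C) (-1) (-1)
  obtain ⟨u, su, hu⟩ := exists_sol_between hPsmooth hQsmooth hwsmooth hPper hQper hwper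
    hPnonneg hQnonneg sa sb
    (fun p => by
      have h1 := abs_le.1 (hBφ p)
      have h2 := abs_le.1 (hBχ p)
      linarith)
    (fun p => by
      rw [lap_lin sχ.1 (Sm.const C).1, lap_const]
      have := hχ C c2 p
      rw [show -1 * χ p + -1 * C = -(χ p + C) by ring, neg_neg]
      linarith)
    (fun p => by
      rw [lap_lin sφ.1 (Sm.const C).1, lap_const]
      have := hφ C c1 p
      rw [show 1 * φ p + 1 * C = φ p + C by ring]
      linarith)
  refine ⟨u, ⟨su.1, su.2, hu⟩, ?_⟩
  rintro v ⟨hv1, hv2, hv3⟩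
  funext p
  exact le_antisymm (unique_le cP hPper hPnonneg hQnonneg hPne ⟨hv1, hv2⟩ su hv3 hu p)
    (unique_le cP hPper hPnonneg hQnonneg hPne su ⟨hv1, hv2⟩ hu hv3 p)
end

section
/- Let P, Q, w : ℝ² → ℝ be smooth functions that are ℤ²-periodic (i.e., periodic with period 1 in each of the two variables). Assume P ≥ 0 and Q ≥ 0 everywhere, ∫_{[0,1]²} (P − Q) > 0, and ∫_{[0,1]²} w > 0. Then there exists a unique smooth ℤ²-periodic function u : ℝ² → ℝ satisfying Δu + P·e^u − Q·e^{−u} = w on ℝ², where Δu = −(∂²u/∂x² + ∂²u/∂y²) is the positive (geometers') Laplacian on the flat torus. -/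
namespace KW

open MeasureTheory ProbabilityTheory Set Filter Topology

noncomputable section

/-- standard Gaussian -/
abbrev G : Measure ℝ := gaussianReal 0 1

abbrev nu : Measure (ℝ × ℝ × ℝ) := (volume.restrict (Ioi (0:ℝ))).prod (G.prod G)

def sh (p : ℝ × ℝ) (ω : ℝ × ℝ × ℝ) : ℝ × ℝ := (p.1 + ω.1 * ω.2.1, p.2 + ω.1 * ω.2.2)

def Av (κ : ℝ × ℝ × ℝ → ℝ) (f : ℝ × ℝ → ℝ) (p : ℝ × ℝ) : ℝ :=
  ∫ ω, κ ω * f (sh p ω) ∂nu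

def BC (f : ℝ × ℝ → ℝ) : Prop := Continuous f ∧ ∃ C, ∀ p, |f p| ≤ C

def dx (f : ℝ × ℝ → ℝ) (p : ℝ × ℝ) : ℝ := deriv (fun s => f (s, p.2)) p.1
def dy (f : ℝ × ℝ → ℝ) (p : ℝ × ℝ) : ℝ := deriv (fun s => f (p.1, s)) p.2

lemma sh_cont : Continuous (fun q : (ℝ × ℝ) × (ℝ × ℝ × ℝ) => sh q.1 q.2) := by
  unfold sh; fun_prop

lemma sh_cont' (p) : Continuous (sh p) := by
  unfold sh; fun_prop

lemma BC.integrable {κ f} (hκ : Integrable κ nu) (hf : BC f) (p) :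
    Integrable (fun ω => κ ω * f (sh p ω)) nu := by
  obtain ⟨hc, C, hC⟩ := hf
  refine hκ.mul_bdd (c := C) (hc.comp (sh_cont' p)).aestronglyMeasurable ?_
  exact ae_of_all _ fun ω => hC _

lemma Av_abs_le {κ : ℝ × ℝ × ℝ → ℝ} {f : ℝ × ℝ → ℝ} (hκ : Integrable κ nu) {C : ℝ} (hC : ∀ p, |f p| ≤ C) (p) :
    |Av κ f p| ≤ C * ∫ ω, |κ ω| ∂nu := by
  unfold Av
  rw [← integral_const_mul, ← Real.norm_eq_abs]
  refine norm_integral_le_of_norm_le (hκ.abs.const_mul C) (ae_of_all _ fun ω => ?_)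
  rw [Real.norm_eq_abs, abs_mul, mul_comm]
  exact mul_le_mul_of_nonneg_right (hC _) (abs_nonneg _)

lemma Av_cont {κ f} (hκ : Integrable κ nu) (hf : BC f) : Continuous (Av κ f) := by
  obtain ⟨hc, C, hC⟩ := hf
  refine continuous_of_dominated (bound := fun ω => C * |κ ω|) ?_ ?_ (hκ.abs.const_mul C) ?_
  · intro p
    exact (BC.integrable hκ ⟨hc, C, hC⟩ p).aestronglyMeasurable
  · intro p
    refine ae_of_all _ fun ω => ?_
    rw [Real.norm_eq_abs, abs_mul, mul_comm]
    exact mul_le_mul_of_nonneg_right (hC _) (abs_nonneg _)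
  · refine ae_of_all _ fun ω => ?_
    have : Continuous fun p => sh p ω := by unfold sh; fun_prop
    exact continuous_const.mul (hc.comp this)

lemma Av_BC {κ f} (hκ : Integrable κ nu) (hf : BC f) : BC (Av κ f) := by
  refine ⟨Av_cont hκ hf, ?_⟩
  obtain ⟨hc, C, hC⟩ := hf
  exact ⟨_, Av_abs_le hκ hC⟩

lemma Av_per {κ f} (hf : ZSqPeriodic f) : ZSqPeriodic (Av κ f) := by
  intro x y
  unfold Av sh
  constructor <;> (congr 1; ext ω; congr 1; simp only)
  · rw [add_right_comm]; exact (hf _ _).1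
  · rw [add_right_comm]; exact (hf _ _).2

lemma Av_add {κ f g} (hκ : Integrable κ nu) (hf : BC f) (hg : BC g) (p) :
    Av κ (fun q => f q + g q) p = Av κ f p + Av κ g p := by
  unfold Av
  rw [← integral_add (hf.integrable hκ p) (hg.integrable hκ p)]
  congr 1; ext ω; ring

lemma Av_sub {κ f g} (hκ : Integrable κ nu) (hf : BC f) (hg : BC g) (p) :
    Av κ (fun q => f q - g q) p = Av κ f p - Av κ g p := by
  unfold Av
  rw [← integral_sub (hf.integrable hκ p) (hg.integrable hκ p)]
  congr 1; ext ω; ring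

lemma Av_smul {κ f} (c : ℝ) (p) :
    Av κ (fun q => c * f q) p = c * Av κ f p := by
  unfold Av
  rw [← integral_const_mul]
  congr 1; ext ω; ring

/-! periodic bounded -/

lemma per_int {f : ℝ × ℝ → ℝ} (hf : ZSqPeriodic f) (m n : ℤ) (x y : ℝ) : f (x + m, y + n) = f (x, y) := by
  have h1 : Function.Periodic (fun s => f (s, y + n)) 1 := fun s => (hf s _).1
  have h2 : Function.Periodic (fun s => f (x, s)) 1 := fun s => (hf x s).2
  have h3 := h1.int_mul m x
  have h4 := h2.int_mul n y
  simp only [mul_one] at h3 h4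
  rw [h3, h4]

lemma per_fract {f : ℝ × ℝ → ℝ} (hf : ZSqPeriodic f) (p : ℝ × ℝ) :
    f (Int.fract p.1, Int.fract p.2) = f p := by
  have := per_int hf (⌊p.1⌋) (⌊p.2⌋) (Int.fract p.1) (Int.fract p.2)
  rw [Int.fract_add_floor, Int.fract_add_floor] at this
  exact this.symm

lemma fract_mem (p : ℝ × ℝ) : (Int.fract p.1, Int.fract p.2) ∈ Icc (0:ℝ) 1 ×ˢ Icc (0:ℝ) 1 :=
  ⟨⟨Int.fract_nonneg _, (Int.fract_lt_one _).le⟩, ⟨Int.fract_nonneg _, (Int.fract_lt_one _).le⟩⟩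

lemma per_BC {f : ℝ × ℝ → ℝ} (hf : ZSqPeriodic f) (hc : Continuous f) : BC f := by
  refine ⟨hc, ?_⟩
  obtain ⟨C, hC⟩ := (isCompact_Icc.prod isCompact_Icc : IsCompact
    (Icc (0:ℝ) 1 ×ˢ Icc (0:ℝ) 1)).exists_bound_of_continuousOn hc.continuousOn
  exact ⟨C, fun p => by rw [← per_fract hf]; exact hC _ (fract_mem p)⟩

lemma per_pos {f : ℝ × ℝ → ℝ} (hf : ZSqPeriodic f) (hc : Continuous f) (h : ∀ p, 0 < f p) :
    ∃ δ > 0, ∀ p, δ ≤ f p := by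
  obtain ⟨q, hq, hm⟩ := (isCompact_Icc.prod isCompact_Icc : IsCompact
    (Icc (0:ℝ) 1 ×ˢ Icc (0:ℝ) 1)).exists_isMinOn ⟨((0:ℝ),(0:ℝ)), by simp⟩ hc.continuousOn
  exact ⟨f q, h q, fun p => by
    rw [← per_fract hf p]; exact hm (fract_mem p)⟩

/-! partial derivatives -/

lemma contDiff_of_partials {f fx fy : ℝ × ℝ → ℝ} {k : ℕ}
    (hx : ∀ p : ℝ × ℝ, HasDerivAt (fun s => f (s, p.2)) (fx p) p.1)
    (hy : ∀ p : ℝ × ℝ, HasDerivAt (fun s => f (p.1, s)) (fy p) p.2)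
    (cx : ContDiff ℝ k fx) (cy : ContDiff ℝ k fy) : ContDiff ℝ (k + 1 : ℕ) f := by
  rw [Nat.cast_add, Nat.cast_one, contDiff_succ_iff_hasFDerivAt]
  refine ⟨fun p => fx p • ContinuousLinearMap.fst ℝ ℝ ℝ + fy p • ContinuousLinearMap.snd ℝ ℝ ℝ,
    by fun_prop, fun p => ?_⟩
  have := hasStrictFDerivAt_uncurry_coprod (𝕜 := ℝ) (u := p) (f := fun a b => f (a, b))
    (f₁ := fun a b => ContinuousLinearMap.toSpanSingleton ℝ (fx (a, b)))
    (f₂ := fun a b => ContinuousLinearMap.toSpanSingleton ℝ (fy (a, b)))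
    (Eventually.of_forall fun v => (hx v).hasFDerivAt)
    (Eventually.of_forall fun v => (hy v).hasFDerivAt)
    (by
      have h := cx.continuous
      have : Continuous fun v : ℝ × ℝ => ContinuousLinearMap.toSpanSingleton ℝ (fx v) :=
        (ContinuousLinearMap.toSpanSingletonCLE (𝕜 := ℝ) (E := ℝ)).continuous.comp h
      exact this.continuousAt)
    (by
      have h := cy.continuous
      have : Continuous fun v : ℝ × ℝ => ContinuousLinearMap.toSpanSingleton ℝ (fy v) :=
        (ContinuousLinearMap.toSpanSingletonCLE (𝕜 := ℝ) (E := ℝ)).continuous.comp h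
      exact this.continuousAt)
  have h2 : HasFDerivAt f ((ContinuousLinearMap.toSpanSingleton ℝ (fx p)).coprod
    (ContinuousLinearMap.toSpanSingleton ℝ (fy p))) p := this.hasFDerivAt
  have h3 : fx p • ContinuousLinearMap.fst ℝ ℝ ℝ + fy p • ContinuousLinearMap.snd ℝ ℝ ℝ =
    (ContinuousLinearMap.toSpanSingleton ℝ (fx p)).coprod
    (ContinuousLinearMap.toSpanSingleton ℝ (fy p)) := by ext <;> simp
  simp only [h3]
  exact h2

lemma hasDerivAt_dx {f : ℝ × ℝ → ℝ} (hf : ContDiff ℝ 1 f) (p : ℝ × ℝ) :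
    HasDerivAt (fun s => f (s, p.2)) (dx f p) p.1 := by
  have : ContDiff ℝ 1 (fun s => f (s, p.2)) := by fun_prop
  exact (this.differentiable (by simp)).differentiableAt.hasDerivAt

lemma hasDerivAt_dy {f : ℝ × ℝ → ℝ} (hf : ContDiff ℝ 1 f) (p : ℝ × ℝ) :
    HasDerivAt (fun s => f (p.1, s)) (dy f p) p.2 := by
  have : ContDiff ℝ 1 (fun s => f (p.1, s)) := by fun_prop
  exact (this.differentiable (by simp)).differentiableAt.hasDerivAt

lemma dx_eq {f : ℝ × ℝ → ℝ} (hf : ContDiff ℝ 1 f) (p : ℝ × ℝ) :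
    dx f p = fderiv ℝ f p (1, 0) := by
  have h1 : HasFDerivAt f (fderiv ℝ f p) (p.1, p.2) :=
    (hf.differentiable (by simp)).differentiableAt.hasFDerivAt
  have h2 : HasDerivAt (fun s : ℝ => (s, p.2)) (1, 0) p.1 :=
    (hasDerivAt_id _).prodMk (hasDerivAt_const _ _)
  exact (HasFDerivAt.comp_hasDerivAt p.1 h1 h2).deriv

lemma dy_eq {f : ℝ × ℝ → ℝ} (hf : ContDiff ℝ 1 f) (p : ℝ × ℝ) :
    dy f p = fderiv ℝ f p (0, 1) := by
  have h1 : HasFDerivAt f (fderiv ℝ f p) (p.1, p.2) :=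
    (hf.differentiable (by simp)).differentiableAt.hasFDerivAt
  have h2 : HasDerivAt (fun s : ℝ => (p.1, s)) (0, 1) p.2 :=
    (hasDerivAt_const _ _).prodMk (hasDerivAt_id _)
  exact (HasFDerivAt.comp_hasDerivAt p.2 h1 h2).deriv

lemma dx_contDiff {f : ℝ × ℝ → ℝ} {k : ℕ} (hf : ContDiff ℝ (k + 1 : ℕ) f) :
    ContDiff ℝ k (dx f) := by
  have h1 : ContDiff ℝ 1 f := hf.of_le (by exact_mod_cast Nat.le_add_left 1 k)
  have : dx f = fun p => fderiv ℝ f p (1, 0) := funext (dx_eq h1)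
  rw [this]
  exact (hf.fderiv_right (m := k) (by simp)).clm_apply contDiff_const

lemma dy_contDiff {f : ℝ × ℝ → ℝ} {k : ℕ} (hf : ContDiff ℝ (k + 1 : ℕ) f) :
    ContDiff ℝ k (dy f) := by
  have h1 : ContDiff ℝ 1 f := hf.of_le (by exact_mod_cast Nat.le_add_left 1 k)
  have : dy f = fun p => fderiv ℝ f p (0, 1) := funext (dy_eq h1)
  rw [this]
  exact (hf.fderiv_right (m := k) (by simp)).clm_apply contDiff_const

lemma dx_per {f : ℝ × ℝ → ℝ} (hf : ZSqPeriodic f) : ZSqPeriodic (dx f) := by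
  intro x y
  unfold dx
  simp only
  constructor
  · rw [← deriv_comp_add_const]
    congr 1; ext s; exact (hf _ _).1
  · congr 1; ext s; exact (hf _ _).2

lemma dy_per {f : ℝ × ℝ → ℝ} (hf : ZSqPeriodic f) : ZSqPeriodic (dy f) := by
  intro x y
  unfold dy
  simp only
  constructor
  · congr 1; ext s; exact (hf _ _).1
  · rw [← deriv_comp_add_const]
    congr 1; ext s; exact (hf _ _).2

lemma Av_hasDeriv_x {κ f fx} (hκ : Integrable κ nu) (hf : BC f) (hfx : BC fx)
    (hd : ∀ p : ℝ × ℝ, HasDerivAt (fun s => f (s, p.2)) (fx p) p.1) (p : ℝ × ℝ) :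
    HasDerivAt (fun s => Av κ f (s, p.2)) (Av κ fx p) p.1 := by
  obtain ⟨C, hC⟩ := hfx.2
  refine (hasDerivAt_integral_of_dominated_loc_of_deriv_le (s := univ)
    (F := fun s ω => κ ω * f (sh (s, p.2) ω)) (F' := fun s ω => κ ω * fx (sh (s, p.2) ω))
    (bound := fun ω => C * |κ ω|) univ_mem
    (Eventually.of_forall fun s => (hf.integrable hκ _).aestronglyMeasurable)
    (hf.integrable hκ _) (hfx.integrable hκ _).aestronglyMeasurable
    (ae_of_all _ fun ω s _ => ?_) (hκ.abs.const_mul C) (ae_of_all _ fun ω s _ => ?_)).2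
  · rw [Real.norm_eq_abs, abs_mul, mul_comm]
    exact mul_le_mul_of_nonneg_right (hC _) (abs_nonneg _)
  · have := hd (sh (s, p.2) ω)
    exact (HasDerivAt.comp_add_const s _ this).const_mul (κ ω)

lemma Av_hasDeriv_y {κ f fy} (hκ : Integrable κ nu) (hf : BC f) (hfy : BC fy)
    (hd : ∀ p : ℝ × ℝ, HasDerivAt (fun s => f (p.1, s)) (fy p) p.2) (p : ℝ × ℝ) :
    HasDerivAt (fun s => Av κ f (p.1, s)) (Av κ fy p) p.2 := by
  obtain ⟨C, hC⟩ := hfy.2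
  refine (hasDerivAt_integral_of_dominated_loc_of_deriv_le (s := univ)
    (F := fun s ω => κ ω * f (sh (p.1, s) ω)) (F' := fun s ω => κ ω * fy (sh (p.1, s) ω))
    (bound := fun ω => C * |κ ω|) univ_mem
    (Eventually.of_forall fun s => (hf.integrable hκ _).aestronglyMeasurable)
    (hf.integrable hκ _) (hfy.integrable hκ _).aestronglyMeasurable
    (ae_of_all _ fun ω s _ => ?_) (hκ.abs.const_mul C) (ae_of_all _ fun ω s _ => ?_)).2
  · rw [Real.norm_eq_abs, abs_mul, mul_comm]
    exact mul_le_mul_of_nonneg_right (hC _) (abs_nonneg _)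
  · have := hd (sh (p.1, s) ω)
    exact (HasDerivAt.comp_add_const s _ this).const_mul (κ ω)

lemma Av_contDiff {κ} (hκ : Integrable κ nu) (k : ℕ) : ∀ f, ContDiff ℝ k f → ZSqPeriodic f →
    ContDiff ℝ k (Av κ f) := by
  induction k with
  | zero =>
    intro f hf hp
    rw [Nat.cast_zero, contDiff_zero] at *
    exact Av_cont hκ (per_BC hp hf)
  | succ k ih =>
    intro f hf hp
    have h1 : ContDiff ℝ 1 f := hf.of_le (by exact_mod_cast Nat.le_add_left 1 k)
    have cx := dx_contDiff hf
    have cy := dy_contDiff hf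
    exact contDiff_of_partials
      (Av_hasDeriv_x hκ (per_BC hp hf.continuous) (per_BC (dx_per hp) cx.continuous)
        (hasDerivAt_dx h1))
      (Av_hasDeriv_y hκ (per_BC hp hf.continuous) (per_BC (dy_per hp) cy.continuous)
        (hasDerivAt_dy h1))
      (ih _ cx (dx_per hp)) (ih _ cy (dy_per hp))


def eE (l s : ℝ) : ℝ := Real.exp (-(l/2) * s^2)
def kR (l : ℝ) (ω : ℝ × ℝ × ℝ) : ℝ := ω.1 * eE l ω.1
def k1 (l : ℝ) (ω : ℝ × ℝ × ℝ) : ℝ := eE l ω.1 * ω.2.1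
def k2 (l : ℝ) (ω : ℝ × ℝ × ℝ) : ℝ := eE l ω.1 * ω.2.2

lemma eE_int {l : ℝ} (hl : 0 < l) : Integrable (eE l) (volume.restrict (Ioi (0:ℝ))) :=
  (integrable_exp_neg_mul_sq (half_pos hl)).restrict

lemma seE_int {l : ℝ} (hl : 0 < l) :
    Integrable (fun s => s * eE l s) (volume.restrict (Ioi (0:ℝ))) :=
  (integrable_mul_exp_neg_mul_sq (half_pos hl)).restrict

lemma id_int : Integrable (fun z : ℝ => z) G := by
  have := memLp_id_gaussianReal (μ := 0) (v := 1) 1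
  exact memLp_one_iff_integrable.1 this

lemma z1_int : Integrable (fun z : ℝ × ℝ => z.1) (G.prod G) := by
  have := id_int.mul_prod (integrable_const (1:ℝ) : Integrable _ G)
  simpa using this

lemma z2_int : Integrable (fun z : ℝ × ℝ => z.2) (G.prod G) := by
  have := (integrable_const (1:ℝ) : Integrable _ G).mul_prod id_int
  simpa using this

lemma kR_int {l : ℝ} (hl : 0 < l) : Integrable (kR l) nu := by
  have := (seE_int hl).mul_prod (integrable_const (1:ℝ) : Integrable _ (G.prod G))
  simp only [mul_one] at this
  exact this

lemma k1_int {l : ℝ} (hl : 0 < l) : Integrable (k1 l) nu := (eE_int hl).mul_prod z1_int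
lemma k2_int {l : ℝ} (hl : 0 < l) : Integrable (k2 l) nu := (eE_int hl).mul_prod z2_int

lemma k1_norm {l : ℝ} : ∫ ω, |k1 l ω| ∂nu =
    (√(Real.pi / (l/2)) / 2) * ∫ z : ℝ × ℝ, |z.1| ∂(G.prod G) := by
  rw [← integral_gaussian_Ioi, ← integral_prod_mul]
  congr 1; ext ω
  rw [k1, abs_mul, eE, Real.abs_exp]

lemma k2_norm {l : ℝ} : ∫ ω, |k2 l ω| ∂nu =
    (√(Real.pi / (l/2)) / 2) * ∫ z : ℝ × ℝ, |z.2| ∂(G.prod G) := by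
  rw [← integral_gaussian_Ioi, ← integral_prod_mul]
  congr 1; ext ω
  rw [k2, abs_mul, eE, Real.abs_exp]

lemma stein1 {h h' : ℝ → ℝ} (hd : ∀ z, HasDerivAt h (h' z) z) (hc : Continuous h')
    {C C' : ℝ} (hb : ∀ z, |h z| ≤ C) (hb' : ∀ z, |h' z| ≤ C') :
    ∫ z, z * h z ∂G = ∫ z, h' z ∂G := by
  have hch : Continuous h := continuous_iff_continuousAt.2 fun z => (hd z).continuousAt
  have hpdf : gaussianPDFReal 0 1 = fun z => (√(2 * Real.pi))⁻¹ * Real.exp (-(1/2) * z^2) := by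
    ext z
    simp only [gaussianPDFReal, NNReal.coe_one]
    ring_nf
  have hdp : ∀ z, HasDerivAt (gaussianPDFReal 0 1) (- (z * gaussianPDFReal 0 1 z)) z := by
    intro z
    rw [hpdf]
    have h1 : HasDerivAt (fun z : ℝ => -(1/2) * z^2) (-z) z := by
      refine ((hasDerivAt_pow 2 z).const_mul (-(1/2) : ℝ)).congr_deriv ?_
      simp
    refine ((h1.exp).const_mul ((√(2 * Real.pi))⁻¹)).congr_deriv ?_
    ring
  have ip : Integrable (gaussianPDFReal 0 1) := integrable_gaussianPDFReal 0 1
  have izp : Integrable (fun z => - (z * gaussianPDFReal 0 1 z)) := by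
    have := (integrable_mul_exp_neg_mul_sq (b := 1/2) (by norm_num)).const_mul
      (-(√(2 * Real.pi))⁻¹)
    refine this.congr (ae_of_all _ fun z => ?_)
    simp only [hpdf]; ring
  have key := integral_mul_deriv_eq_deriv_mul_of_integrable (u := h) (u' := h')
    (v := gaussianPDFReal 0 1) (v' := fun z => - (z * gaussianPDFReal 0 1 z))
    (fun z _ => hd z) (fun z _ => hdp z)
    (izp.bdd_mul (c := C) hch.aestronglyMeasurable (ae_of_all _ hb))
    (ip.bdd_mul (c := C') hc.aestronglyMeasurable (ae_of_all _ hb'))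
    (ip.bdd_mul (c := C) hch.aestronglyMeasurable (ae_of_all _ hb))
  rw [integral_gaussianReal_eq_integral_smul one_ne_zero,
    integral_gaussianReal_eq_integral_smul one_ne_zero]
  have e1 : ∫ z, gaussianPDFReal 0 1 z • (z * h z) =
      - ∫ z, h z * - (z * gaussianPDFReal 0 1 z) := by
    rw [← integral_neg]; congr 1; ext z; simp only [smul_eq_mul]; ring
  rw [e1, key, neg_neg]
  congr 1; ext z; simp only [smul_eq_mul]; ring

lemma BC.int2 {f} (hf : BC f) (p : ℝ × ℝ) (s : ℝ) {g : ℝ × ℝ → ℝ} (hg : Integrable g (G.prod G)) :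
    Integrable (fun z => g z * f (sh p (s, z))) (G.prod G) := by
  obtain ⟨hc, C, hC⟩ := hf
  refine hg.mul_bdd (c := C) (hc.comp ?_).aestronglyMeasurable (ae_of_all _ fun ω => hC _)
  unfold sh; fun_prop

lemma BC.int2' {f} (hf : BC f) (p : ℝ × ℝ) (s : ℝ) :
    Integrable (fun z => f (sh p (s, z))) (G.prod G) := by
  simpa using hf.int2 p s (integrable_const (1:ℝ))

lemma stein_x {B b : ℝ × ℝ → ℝ} (hB : BC B) (hb : BC b)
    (hd : ∀ p : ℝ × ℝ, HasDerivAt (fun s => B (s, p.2)) (b p) p.1) (p : ℝ × ℝ) (s : ℝ) :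
    ∫ z : ℝ × ℝ, z.1 * B (sh p (s, z)) ∂(G.prod G) =
      s * ∫ z : ℝ × ℝ, b (sh p (s, z)) ∂(G.prod G) := by
  rw [integral_prod_symm _ (hB.int2 p s z1_int), ← integral_const_mul,
    integral_prod_symm _ ((hb.int2' p s).const_mul s)]
  congr 1; ext z2
  obtain ⟨C, hC⟩ := hB.2
  obtain ⟨C', hC'⟩ := hb.2
  refine stein1 (h := fun z => B (sh p (s, (z, z2)))) (h' := fun z => s * b (sh p (s, (z, z2))))
    ?_ ?_ (C := C) (C' := |s| * C') (fun z => hC _) ?_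
  · intro z
    have h1 : HasDerivAt (fun z : ℝ => p.1 + s * z) s z := by
      simpa using ((hasDerivAt_id z).const_mul s).const_add p.1
    have := (hd (sh p (s, (z, z2)))).comp z h1
    rw [mul_comm]
    exact this
  · have := hb.1
    unfold sh; fun_prop
  · intro z
    rw [abs_mul]
    exact mul_le_mul_of_nonneg_left (hC' _) (abs_nonneg _)

lemma stein_y {B b : ℝ × ℝ → ℝ} (hB : BC B) (hb : BC b)
    (hd : ∀ p : ℝ × ℝ, HasDerivAt (fun s => B (p.1, s)) (b p) p.2) (p : ℝ × ℝ) (s : ℝ) :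
    ∫ z : ℝ × ℝ, z.2 * B (sh p (s, z)) ∂(G.prod G) =
      s * ∫ z : ℝ × ℝ, b (sh p (s, z)) ∂(G.prod G) := by
  rw [integral_prod _ (hB.int2 p s z2_int), ← integral_const_mul,
    integral_prod _ ((hb.int2' p s).const_mul s)]
  congr 1; ext z1
  obtain ⟨C, hC⟩ := hB.2
  obtain ⟨C', hC'⟩ := hb.2
  refine stein1 (h := fun z => B (sh p (s, (z1, z)))) (h' := fun z => s * b (sh p (s, (z1, z))))
    ?_ ?_ (C := C) (C' := |s| * C') (fun z => hC _) ?_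
  · intro z
    have h1 : HasDerivAt (fun z : ℝ => p.2 + s * z) s z := by
      simpa using ((hasDerivAt_id z).const_mul s).const_add p.2
    have := (hd (sh p (s, (z1, z)))).comp z h1
    rw [mul_comm]
    exact this
  · have := hb.1
    unfold sh; fun_prop
  · intro z
    rw [abs_mul]
    exact mul_le_mul_of_nonneg_left (hC' _) (abs_nonneg _)

lemma Av_stein_x {l : ℝ} (hl : 0 < l) {B b : ℝ × ℝ → ℝ} (hB : BC B) (hb : BC b)
    (hd : ∀ p : ℝ × ℝ, HasDerivAt (fun s => B (s, p.2)) (b p) p.1) (p : ℝ × ℝ) :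
    Av (k1 l) B p = Av (kR l) b p := by
  unfold Av
  rw [integral_prod _ (hB.integrable (k1_int hl) p), integral_prod _ (hb.integrable (kR_int hl) p)]
  congr 1; ext s
  simp only [k1, kR]
  rw [integral_const_mul]
  simp_rw [mul_assoc]
  rw [integral_const_mul, stein_x hB hb hd]
  ring

lemma Av_stein_y {l : ℝ} (hl : 0 < l) {B b : ℝ × ℝ → ℝ} (hB : BC B) (hb : BC b)
    (hd : ∀ p : ℝ × ℝ, HasDerivAt (fun s => B (p.1, s)) (b p) p.2) (p : ℝ × ℝ) :
    Av (k2 l) B p = Av (kR l) b p := by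
  unfold Av
  rw [integral_prod _ (hB.integrable (k2_int hl) p), integral_prod _ (hb.integrable (kR_int hl) p)]
  congr 1; ext s
  simp only [k2, kR]
  rw [integral_const_mul]
  simp_rw [mul_assoc]
  rw [integral_const_mul, stein_y hB hb hd]
  ring


def Ix (f : ℝ × ℝ → ℝ) (q : ℝ × ℝ) : ℝ := ∫ t in (0:ℝ)..q.1, f (t, q.2)
def Iy (f : ℝ × ℝ → ℝ) (q : ℝ × ℝ) : ℝ := ∫ t in (0:ℝ)..q.2, f (q.1, t)

lemma Ix_cont {f} (hf : Continuous f) : Continuous (Ix f) := by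
  refine intervalIntegral.continuous_parametric_intervalIntegral_of_continuous
    (f := fun (q : ℝ × ℝ) t => f (t, q.2)) ?_ continuous_fst
  unfold Function.uncurry; fun_prop

lemma Iy_cont {f} (hf : Continuous f) : Continuous (Iy f) := by
  refine intervalIntegral.continuous_parametric_intervalIntegral_of_continuous
    (f := fun (q : ℝ × ℝ) t => f (q.1, t)) ?_ continuous_snd
  unfold Function.uncurry; fun_prop

lemma Ix_deriv {f} (hf : Continuous f) (p : ℝ × ℝ) :
    HasDerivAt (fun s => Ix f (s, p.2)) (f p) p.1 := by
  have hc : Continuous fun t => f (t, p.2) := by fun_prop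
  exact intervalIntegral.integral_hasDerivAt_right (hc.intervalIntegrable _ _)
    (hc.stronglyMeasurableAtFilter _ _) hc.continuousAt

lemma Iy_deriv {f} (hf : Continuous f) (p : ℝ × ℝ) :
    HasDerivAt (fun s => Iy f (p.1, s)) (f p) p.2 := by
  have hc : Continuous fun t => f (p.1, t) := by fun_prop
  exact intervalIntegral.integral_hasDerivAt_right (hc.intervalIntegrable _ _)
    (hc.stronglyMeasurableAtFilter _ _) hc.continuousAt

lemma R_deriv_x {l : ℝ} (hl : 0 < l) {f} (hf : BC f) (p : ℝ × ℝ) :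
    HasDerivAt (fun s => Av (kR l) f (s, p.2)) (Av (k1 l) f p) p.1 := by
  obtain ⟨hc, C, hC⟩ := id hf
  set B : ℝ → ℝ × ℝ → ℝ := fun h q => Ix f (q.1 + h, q.2) - Ix f q with hBdef
  have hBb : ∀ h q, |B h q| ≤ C * |h| := by
    intro h q
    have hcc : Continuous fun t => f (t, q.2) := by fun_prop
    have : B h q = ∫ t in q.1..(q.1 + h), f (t, q.2) := by
      simp only [hBdef, Ix]
      rw [intervalIntegral.integral_interval_sub_left] <;> exact hcc.intervalIntegrable _ _
    rw [this]
    have := intervalIntegral.norm_integral_le_of_norm_le_const (f := fun t => f (t, q.2))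
      (a := q.1) (b := q.1 + h) (C := C) (fun t _ => hC _)
    simpa using this
  have hIc := Ix_cont hc
  have hBBC : ∀ h, BC (B h) := fun h => ⟨by simp only [hBdef]; fun_prop, _, hBb h⟩
  have hfs : ∀ h, BC (fun q => f (q.1 + h, q.2)) := fun h => ⟨by fun_prop, C, fun q => hC _⟩
  have hsub : ∀ h, BC (fun q => f (q.1 + h, q.2) - f q) := fun h =>
    ⟨by fun_prop, C + C, fun q => (abs_sub _ _).trans (add_le_add (hC _) (hC _))⟩
  have hBd : ∀ h (q : ℝ × ℝ), HasDerivAt (fun s => B h (s, q.2)) (f (q.1 + h, q.2) - f q) q.1 := by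
    intro h q
    exact (HasDerivAt.comp_add_const q.1 h (Ix_deriv hc (q.1 + h, q.2))).sub (Ix_deriv hc q)
  have key : ∀ h, Av (kR l) f (p.1 + h, p.2) = Av (kR l) f p + Av (k1 l) (B h) p := by
    intro h
    rw [Av_stein_x hl (hBBC h) (hsub h) (hBd h), Av_sub (kR_int hl) (hfs h) hf]
    have : Av (kR l) f (p.1 + h, p.2) = Av (kR l) (fun q => f (q.1 + h, q.2)) p := by
      unfold Av sh
      simp only [add_right_comm]
    rw [this]; ring
  have hder : HasDerivAt (fun h => Av (k1 l) (B h) p) (Av (k1 l) (fun q => f (q.1 + 0, q.2)) p) 0 := by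
    refine (hasDerivAt_integral_of_dominated_loc_of_deriv_le (s := univ)
      (F := fun h ω => k1 l ω * B h (sh p ω))
      (F' := fun h ω => k1 l ω * f ((sh p ω).1 + h, (sh p ω).2))
      (bound := fun ω => C * |k1 l ω|) univ_mem
      (Eventually.of_forall fun s => ((hBBC s).integrable (k1_int hl) _).aestronglyMeasurable)
      ((hBBC 0).integrable (k1_int hl) _)
      ((hfs 0).integrable (k1_int hl) _).aestronglyMeasurable
      (ae_of_all _ fun ω s _ => ?_) ((k1_int hl).abs.const_mul C) (ae_of_all _ fun ω s _ => ?_)).2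
    · rw [Real.norm_eq_abs, abs_mul, mul_comm]
      exact mul_le_mul_of_nonneg_right (hC _) (abs_nonneg _)
    · exact ((HasDerivAt.comp_const_add (sh p ω).1 s
        (Ix_deriv hc ((sh p ω).1 + s, (sh p ω).2))).sub_const _).const_mul (k1 l ω)
  simp only [add_zero] at hder
  have h2 : HasDerivAt (fun h => Av (kR l) f (p.1 + h, p.2)) (Av (k1 l) f p) 0 := by
    simp only [key]
    exact hder.const_add _
  have h3 := HasDerivAt.comp_sub_const p.1 p.1 (f := fun h => Av (kR l) f (p.1 + h, p.2))
    (f' := Av (k1 l) f p) (by simpa using h2)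
  simpa using h3

lemma R_deriv_y {l : ℝ} (hl : 0 < l) {f} (hf : BC f) (p : ℝ × ℝ) :
    HasDerivAt (fun s => Av (kR l) f (p.1, s)) (Av (k2 l) f p) p.2 := by
  obtain ⟨hc, C, hC⟩ := id hf
  set B : ℝ → ℝ × ℝ → ℝ := fun h q => Iy f (q.1, q.2 + h) - Iy f q with hBdef
  have hBb : ∀ h q, |B h q| ≤ C * |h| := by
    intro h q
    have hcc : Continuous fun t => f (q.1, t) := by fun_prop
    have : B h q = ∫ t in q.2..(q.2 + h), f (q.1, t) := by
      simp only [hBdef, Iy]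
      rw [intervalIntegral.integral_interval_sub_left] <;> exact hcc.intervalIntegrable _ _
    rw [this]
    have := intervalIntegral.norm_integral_le_of_norm_le_const (f := fun t => f (q.1, t))
      (a := q.2) (b := q.2 + h) (C := C) (fun t _ => hC _)
    simpa using this
  have hIc := Iy_cont hc
  have hBBC : ∀ h, BC (B h) := fun h => ⟨by simp only [hBdef]; fun_prop, _, hBb h⟩
  have hfs : ∀ h, BC (fun q => f (q.1, q.2 + h)) := fun h => ⟨by fun_prop, C, fun q => hC _⟩
  have hsub : ∀ h, BC (fun q => f (q.1, q.2 + h) - f q) := fun h =>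
    ⟨by fun_prop, C + C, fun q => (abs_sub _ _).trans (add_le_add (hC _) (hC _))⟩
  have hBd : ∀ h (q : ℝ × ℝ), HasDerivAt (fun s => B h (q.1, s)) (f (q.1, q.2 + h) - f q) q.2 := by
    intro h q
    exact (HasDerivAt.comp_add_const q.2 h (Iy_deriv hc (q.1, q.2 + h))).sub (Iy_deriv hc q)
  have key : ∀ h, Av (kR l) f (p.1, p.2 + h) = Av (kR l) f p + Av (k2 l) (B h) p := by
    intro h
    rw [Av_stein_y hl (hBBC h) (hsub h) (hBd h), Av_sub (kR_int hl) (hfs h) hf]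
    have : Av (kR l) f (p.1, p.2 + h) = Av (kR l) (fun q => f (q.1, q.2 + h)) p := by
      unfold Av sh
      simp only [add_right_comm]
    rw [this]; ring
  have hder : HasDerivAt (fun h => Av (k2 l) (B h) p) (Av (k2 l) (fun q => f (q.1, q.2 + 0)) p) 0 := by
    refine (hasDerivAt_integral_of_dominated_loc_of_deriv_le (s := univ)
      (F := fun h ω => k2 l ω * B h (sh p ω))
      (F' := fun h ω => k2 l ω * f ((sh p ω).1, (sh p ω).2 + h))
      (bound := fun ω => C * |k2 l ω|) univ_mem
      (Eventually.of_forall fun s => ((hBBC s).integrable (k2_int hl) _).aestronglyMeasurable)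
      ((hBBC 0).integrable (k2_int hl) _)
      ((hfs 0).integrable (k2_int hl) _).aestronglyMeasurable
      (ae_of_all _ fun ω s _ => ?_) ((k2_int hl).abs.const_mul C) (ae_of_all _ fun ω s _ => ?_)).2
    · rw [Real.norm_eq_abs, abs_mul, mul_comm]
      exact mul_le_mul_of_nonneg_right (hC _) (abs_nonneg _)
    · exact ((HasDerivAt.comp_const_add (sh p ω).2 s
        (Iy_deriv hc ((sh p ω).1, (sh p ω).2 + s))).sub_const _).const_mul (k2 l ω)
  simp only [add_zero] at hder
  have h2 : HasDerivAt (fun h => Av (kR l) f (p.1, p.2 + h)) (Av (k2 l) f p) 0 := by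
    simp only [key]
    exact hder.const_add _
  have h3 := HasDerivAt.comp_sub_const p.2 p.2 (f := fun h => Av (kR l) f (p.1, p.2 + h))
    (f' := Av (k2 l) f p) (by simpa using h2)
  simpa using h3

lemma R_gain {l : ℝ} (hl : 0 < l) {k : ℕ} {f} (hf : ContDiff ℝ k f) (hp : ZSqPeriodic f) :
    ContDiff ℝ (k + 1 : ℕ) (Av (kR l) f) :=
  have hb := per_BC hp hf.continuous
  contDiff_of_partials (R_deriv_x hl hb) (R_deriv_y hl hb)
    (Av_contDiff (k1_int hl) k f hf hp) (Av_contDiff (k2_int hl) k f hf hp)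

lemma R_smooth {l : ℝ} (hl : 0 < l) {f} (hf : ContDiff ℝ (⊤ : ℕ∞) f) (hp : ZSqPeriodic f) :
    ContDiff ℝ (⊤ : ℕ∞) (Av (kR l) f) := by
  rw [contDiff_infty]
  intro k
  exact Av_contDiff (kR_int hl) k f (hf.of_le (by exact_mod_cast le_top)) hp

def lap (f : ℝ × ℝ → ℝ) (p : ℝ × ℝ) : ℝ := dx (dx f) p + dy (dy f) p

lemma eE_deriv (l s : ℝ) : HasDerivAt (eE l) (-(l * (s * eE l s))) s := by
  have h1 : HasDerivAt (fun z : ℝ => -(l/2) * z^2) (-(l * s)) s := by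
    refine ((hasDerivAt_pow 2 s).const_mul (-(l/2) : ℝ)).congr_deriv ?_
    simp; ring
  refine h1.exp.congr_deriv ?_
  simp only [eE]; ring

lemma f_line {f : ℝ × ℝ → ℝ} (hf : ContDiff ℝ 1 f) (p z : ℝ × ℝ) (s : ℝ) :
    HasDerivAt (fun s => f (sh p (s, z)))
      (z.1 * dx f (sh p (s, z)) + z.2 * dy f (sh p (s, z))) s := by
  have h1 : HasFDerivAt f (fderiv ℝ f (sh p (s, z))) (sh p (s, z)) :=
    (hf.differentiable (by simp)).differentiableAt.hasFDerivAt
  have h2 : HasDerivAt (fun s : ℝ => sh p (s, z)) z s := by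
    have a : HasDerivAt (fun s : ℝ => p.1 + s * z.1) z.1 s := by
      simpa using ((hasDerivAt_id s).mul_const z.1).const_add p.1
    have b : HasDerivAt (fun s : ℝ => p.2 + s * z.2) z.2 s := by
      simpa using ((hasDerivAt_id s).mul_const z.2).const_add p.2
    exact a.prodMk b
  refine (HasFDerivAt.comp_hasDerivAt s h1 h2).congr_deriv ?_
  rw [dx_eq hf, dy_eq hf]
  have : z = z.1 • ((1:ℝ), (0:ℝ)) + z.2 • ((0:ℝ), (1:ℝ)) := by ext <;> simp
  calc fderiv ℝ f (sh p (s, z)) z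
      = fderiv ℝ f (sh p (s, z)) (z.1 • ((1:ℝ), (0:ℝ)) + z.2 • ((0:ℝ), (1:ℝ))) :=
        congrArg _ this
    _ = _ := by rw [map_add, map_smul, map_smul]; rfl

lemma eE_tendsto {l : ℝ} (hl : 0 < l) : Tendsto (eE l) atTop (𝓝 0) := by
  unfold eE
  refine Real.tendsto_exp_atBot.comp ?_
  have : Tendsto (fun s : ℝ => (l/2) * s^2) atTop atTop :=
    (tendsto_pow_atTop two_ne_zero).const_mul_atTop (half_pos hl)
  simp only [neg_mul]
  exact tendsto_neg_atTop_atBot.comp this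

lemma resolvent {l : ℝ} (hl : 0 < l) {f} (hf : ContDiff ℝ (2:ℕ) f) (hp : ZSqPeriodic f) (p) :
    Av (kR l) (fun q => l * f q - lap f q) p = f p := by
  have hf1 : ContDiff ℝ 1 f := hf.of_le (by norm_num)
  have cx : ContDiff ℝ (1:ℕ) (dx f) := dx_contDiff hf
  have cy : ContDiff ℝ (1:ℕ) (dy f) := dy_contDiff hf
  have cxx : ContDiff ℝ (0:ℕ) (dx (dx f)) := dx_contDiff cx
  have cyy : ContDiff ℝ (0:ℕ) (dy (dy f)) := dy_contDiff cy
  have bf := per_BC hp hf.continuous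
  have bx := per_BC (dx_per hp) cx.continuous
  have by' := per_BC (dy_per hp) cy.continuous
  have bxx := per_BC (dx_per (dx_per hp)) cxx.continuous
  have byy := per_BC (dy_per (dy_per hp)) cyy.continuous
  have bl : BC (lap f) := by
    obtain ⟨C, hC⟩ := bxx.2
    obtain ⟨D, hD⟩ := byy.2
    exact ⟨bxx.1.add byy.1, C + D, fun q => (abs_add_le _ _).trans (add_le_add (hC _) (hD _))⟩
  have blf : BC (fun q => l * f q) := by
    obtain ⟨C, hC⟩ := bf.2
    exact ⟨continuous_const.mul bf.1, |l| * C, fun q => by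
      rw [abs_mul]; exact mul_le_mul_of_nonneg_left (hC _) (abs_nonneg _)⟩
  rw [Av_sub (kR_int hl) blf bl]
  have e1 : Av (kR l) (lap f) p = Av (k1 l) (dx f) p + Av (k2 l) (dy f) p := by
    rw [Av_stein_x hl bx bxx (hasDerivAt_dx (by exact_mod_cast cx)),
      Av_stein_y hl by' byy (hasDerivAt_dy (by exact_mod_cast cy)), ← Av_add (kR_int hl) bxx byy]
    rfl
  rw [e1]
  have i1 := blf.integrable (kR_int hl) p
  have i2 := bx.integrable (k1_int hl) p
  have i3 := by'.integrable (k2_int hl) p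
  unfold Av
  have i23 : Integrable (fun ω => k1 l ω * dx f (sh p ω) + k2 l ω * dy f (sh p ω)) nu := i2.add i3
  have i4 : Integrable (fun ω => kR l ω * (l * f (sh p ω)) -
    (k1 l ω * dx f (sh p ω) + k2 l ω * dy f (sh p ω))) nu := i1.sub i23
  rw [← integral_add i2 i3]
  simp only []
  rw [← integral_sub i1 i23, integral_prod_symm _ i4]
  have inner : ∀ z : ℝ × ℝ, ∫ s in Ioi (0:ℝ), (kR l (s, z) * (l * f (sh p (s, z))) -
      (k1 l (s, z) * dx f (sh p (s, z)) + k2 l (s, z) * dy f (sh p (s, z)))) = f p := by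
    intro z
    have shc : Continuous fun s => sh p (s, z) := by unfold sh; fun_prop
    have hd : ∀ s ∈ Ioi (0:ℝ), HasDerivAt (fun s => -(eE l s * f (sh p (s, z))))
        (kR l (s, z) * (l * f (sh p (s, z))) -
      (k1 l (s, z) * dx f (sh p (s, z)) + k2 l (s, z) * dy f (sh p (s, z)))) s := by
      intro s _
      refine ((eE_deriv l s).mul (f_line hf1 p z s)).neg.congr_deriv ?_
      simp only [kR, k1, k2]; ring
    have bdi : ∀ {κ : ℝ → ℝ} {g : ℝ × ℝ → ℝ}, Integrable κ (volume.restrict (Ioi (0:ℝ))) → BC g →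
        Integrable (fun s => κ s * g (sh p (s, z))) (volume.restrict (Ioi (0:ℝ))) := by
      intro κ g hκ hg
      obtain ⟨hc, C, hC⟩ := hg
      exact hκ.mul_bdd (c := C) (hc.comp shc).aestronglyMeasurable (ae_of_all _ fun ω => hC _)
    have hi := (bdi (seE_int hl) blf).sub ((bdi ((eE_int hl).mul_const z.1) bx).add
      (bdi ((eE_int hl).mul_const z.2) by'))
    have hcw : Continuous (fun s => -(eE l s * f (sh p (s, z)))) := by
      have := bf.1
      unfold eE; fun_prop
    have ht : Tendsto (fun s => -(eE l s * f (sh p (s, z)))) atTop (𝓝 0) := by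
      obtain ⟨C, hC⟩ := bf.2
      have := ((eE_tendsto hl).mul_const C)
      rw [zero_mul] at this
      refine squeeze_zero_norm (fun s => ?_) this
      rw [norm_neg, norm_mul]
      refine mul_le_mul (le_of_eq ?_) (hC _) (norm_nonneg _) (Real.exp_pos _).le
      rw [eE, Real.norm_eq_abs, Real.abs_exp]
    rw [integral_Ioi_of_hasDerivAt_of_tendsto hcw.continuousWithinAt hd hi ht]
    simp [eE, sh]
  simp_rw [inner]
  simp


lemma lap_Av {κ} (hκ : Integrable κ nu) {f} (hf : ContDiff ℝ (2:ℕ) f) (hp : ZSqPeriodic f) (p) :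
    lap (Av κ f) p = Av κ (lap f) p := by
  have hf1 : ContDiff ℝ 1 f := hf.of_le (by norm_num)
  have cx : ContDiff ℝ (1:ℕ) (dx f) := dx_contDiff hf
  have cy : ContDiff ℝ (1:ℕ) (dy f) := dy_contDiff hf
  have cxx : ContDiff ℝ (0:ℕ) (dx (dx f)) := dx_contDiff cx
  have cyy : ContDiff ℝ (0:ℕ) (dy (dy f)) := dy_contDiff cy
  have bf := per_BC hp hf.continuous
  have bx := per_BC (dx_per hp) cx.continuous
  have by' := per_BC (dy_per hp) cy.continuous
  have bxx := per_BC (dx_per (dx_per hp)) cxx.continuous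
  have byy := per_BC (dy_per (dy_per hp)) cyy.continuous
  have e1 : dx (Av κ f) = Av κ (dx f) :=
    funext fun q => (Av_hasDeriv_x hκ bf bx (hasDerivAt_dx hf1) q).deriv
  have e2 : dy (Av κ f) = Av κ (dy f) :=
    funext fun q => (Av_hasDeriv_y hκ bf by' (hasDerivAt_dy hf1) q).deriv
  have e3 : dx (Av κ (dx f)) = Av κ (dx (dx f)) :=
    funext fun q => (Av_hasDeriv_x hκ bx bxx (hasDerivAt_dx (by exact_mod_cast cx)) q).deriv
  have e4 : dy (Av κ (dy f)) = Av κ (dy (dy f)) :=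
    funext fun q => (Av_hasDeriv_y hκ by' byy (hasDerivAt_dy (by exact_mod_cast cy)) q).deriv
  have := Av_add hκ bxx byy p
  simp only [lap, e1, e2, e3, e4]
  exact this.symm

lemma lap_per {f} (hp : ZSqPeriodic f) : ZSqPeriodic (lap f) := by
  intro x y
  have h1 := dx_per (dx_per hp) x y
  have h2 := dy_per (dy_per hp) x y
  unfold lap
  exact ⟨by rw [h1.1, h2.1], by rw [h1.2, h2.2]⟩

lemma lap_cont {f} (hf : ContDiff ℝ (2:ℕ) f) : Continuous (lap f) := by
  have cx : ContDiff ℝ (1:ℕ) (dx f) := dx_contDiff hf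
  have cy : ContDiff ℝ (1:ℕ) (dy f) := dy_contDiff hf
  have cxx : ContDiff ℝ (0:ℕ) (dx (dx f)) := dx_contDiff cx
  have cyy : ContDiff ℝ (0:ℕ) (dy (dy f)) := dy_contDiff cy
  exact cxx.continuous.add cyy.continuous

lemma per_map2 {f g : ℝ × ℝ → ℝ} (hf : ZSqPeriodic f) (hg : ZSqPeriodic g) (φ : ℝ → ℝ → ℝ) :
    ZSqPeriodic (fun q => φ (f q) (g q)) := fun x y =>
  ⟨by simp only [(hf x y).1, (hg x y).1], by simp only [(hf x y).2, (hg x y).2]⟩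

lemma per_map {f : ℝ × ℝ → ℝ} (hf : ZSqPeriodic f) (φ : ℝ → ℝ) :
    ZSqPeriodic (fun q => φ (f q)) := fun x y =>
  ⟨by simp only [(hf x y).1], by simp only [(hf x y).2]⟩

lemma per_const (c : ℝ) : ZSqPeriodic (fun _ => c) := fun _ _ => ⟨rfl, rfl⟩

lemma right_inv {l : ℝ} (hl : 0 < l) {f} (hf : ContDiff ℝ (2:ℕ) f) (hp : ZSqPeriodic f) (p) :
    l * Av (kR l) f p - lap (Av (kR l) f) p = f p := by
  rw [lap_Av (kR_int hl) hf hp, ← Av_smul, ← Av_sub (kR_int hl)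
    (per_BC (per_map hp (fun t => l * t)) (continuous_const.mul hf.continuous))
    (per_BC (lap_per hp) (lap_cont hf))]
  exact resolvent hl hf hp p

lemma lap_const (c : ℝ) (p) : lap (fun _ => c) p = 0 := by
  simp [lap, dx, dy]

lemma R_const {l : ℝ} (hl : 0 < l) (c : ℝ) (p) : Av (kR l) (fun _ => c) p = c / l := by
  have := resolvent hl (f := fun _ => c / l) contDiff_const (per_const _) p
  simp only [lap_const, sub_zero] at this
  rw [mul_div_cancel₀ _ hl.ne'] at this
  exact this

lemma kR_nonneg (l : ℝ) : ∀ᵐ ω ∂nu, 0 < kR l ω := by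
  have h : ∀ᵐ s ∂(volume.restrict (Ioi (0:ℝ))), 0 < s := ae_restrict_mem measurableSet_Ioi
  have h2 : ∀ᵐ ω ∂nu, 0 < ω.1 := Measure.quasiMeasurePreserving_fst.ae h
  filter_upwards [h2] with ω hω
  exact mul_pos hω (Real.exp_pos _)

lemma R_mono {l : ℝ} (hl : 0 < l) {f g} (hf : BC f) (hg : BC g) (h : ∀ p, f p ≤ g p) (p) :
    Av (kR l) f p ≤ Av (kR l) g p := by
  refine integral_mono_ae (hf.integrable (kR_int hl) p) (hg.integrable (kR_int hl) p) ?_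
  filter_upwards [kR_nonneg l] with ω hω
  exact mul_le_mul_of_nonneg_left (h _) hω.le

instance : Measure.IsOpenPosMeasure G :=
  (gaussianReal_absolutelyContinuous' 0 one_ne_zero).isOpenPosMeasure

lemma R_pos {l : ℝ} (hl : 0 < l) {V} (hV : BC V) (h0 : ∀ p, 0 ≤ V p) {q} (hq : 0 < V q) (p) :
    0 < Av (kR l) V p := by
  unfold Av
  rw [integral_pos_iff_support_of_nonneg_ae _ (hV.integrable (kR_int hl) p)]
  · have hU : IsOpen {ω : ℝ × ℝ × ℝ | 0 < ω.1 ∧ 0 < V (sh p ω)} :=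
      (isOpen_lt continuous_const continuous_fst).inter
        (isOpen_lt continuous_const (hV.1.comp (sh_cont' p)))
    have hne : ({ω : ℝ × ℝ × ℝ | 0 < ω.1 ∧ 0 < V (sh p ω)}).Nonempty := by
      refine ⟨(1, q.1 - p.1, q.2 - p.2), by norm_num, ?_⟩
      simpa [sh] using hq
    have hpos : 0 < (volume.prod (G.prod G)) {ω : ℝ × ℝ × ℝ | 0 < ω.1 ∧ 0 < V (sh p ω)} :=
      hU.measure_pos _ hne
    have hnu : nu = (volume.prod (G.prod G)).restrict (Ioi (0:ℝ) ×ˢ univ) := by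
      rw [← Measure.prod_restrict, Measure.restrict_univ]
    have h1 : nu {ω : ℝ × ℝ × ℝ | 0 < ω.1 ∧ 0 < V (sh p ω)} =
        (volume.prod (G.prod G)) {ω : ℝ × ℝ × ℝ | 0 < ω.1 ∧ 0 < V (sh p ω)} := by
      rw [hnu, Measure.restrict_eq_self]
      intro ω hω
      exact ⟨hω.1, trivial⟩
    rw [← h1] at hpos
    refine hpos.trans_le (measure_mono ?_)
    intro ω hω
    exact (mul_pos (mul_pos hω.1 (Real.exp_pos _)) hω.2).ne'
  · filter_upwards [kR_nonneg l] with ω hω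
    exact mul_nonneg hω.le (h0 _)

lemma Ix_per {g} (hc : Continuous g) (hp : ZSqPeriodic g)
    (h0 : ∀ y, ∫ t in (0:ℝ)..1, g (t, y) = 0) : ZSqPeriodic (Ix g) := by
  intro x y
  have hcc : Continuous fun t => g (t, y) := by fun_prop
  have hper : Function.Periodic (fun t => g (t, y)) 1 := fun s => (hp s y).1
  constructor
  · have h1 := hper.intervalIntegral_add_eq x 0
    rw [zero_add, h0] at h1
    have := intervalIntegral.integral_add_adjacent_intervals (μ := volume)
      (hcc.intervalIntegrable 0 x) (hcc.intervalIntegrable x (x+1))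
    rw [h1, add_zero] at this
    exact this.symm
  · unfold Ix
    simp only [(hp _ y).2]

lemma Iy_per {g} (hc : Continuous g) (hp : ZSqPeriodic g)
    (h0 : ∀ x, ∫ t in (0:ℝ)..1, g (x, t) = 0) : ZSqPeriodic (Iy g) := by
  intro x y
  have hcc : Continuous fun t => g (x, t) := by fun_prop
  have hper : Function.Periodic (fun t => g (x, t)) 1 := fun s => (hp x s).2
  constructor
  · unfold Iy
    simp only [(hp x _).1]
  · have h1 := hper.intervalIntegral_add_eq y 0
    rw [zero_add, h0] at h1
    have := intervalIntegral.integral_add_adjacent_intervals (μ := volume)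
      (hcc.intervalIntegrable 0 y) (hcc.intervalIntegrable y (y+1))
    rw [h1, add_zero] at this
    exact this.symm

lemma poisson {f : ℝ × ℝ → ℝ} (hf : ContDiff ℝ (⊤ : ℕ∞) f) (hp : ZSqPeriodic f) {ε : ℝ}
    (hε : 0 < ε) : ∃ η : ℝ × ℝ → ℝ, ContDiff ℝ (⊤ : ℕ∞) η ∧ ZSqPeriodic η ∧
      ∀ p, |-lap η p - (f p - ∫ x in (0:ℝ)..1, ∫ y in (0:ℝ)..1, f (x, y))| ≤ ε := by
  set m := ∫ x in (0:ℝ)..1, ∫ y in (0:ℝ)..1, f (x, y) with hm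
  have fc := hf.continuous
  set h1 : ℝ × ℝ → ℝ := fun q => (∫ y in (0:ℝ)..1, f (q.1, y)) - m with hh1
  set h2 : ℝ × ℝ → ℝ := fun q => f q - ∫ y in (0:ℝ)..1, f (q.1, y) with hh2
  have jc : Continuous fun x : ℝ => ∫ y in (0:ℝ)..1, f (x, y) :=
    intervalIntegral.continuous_parametric_intervalIntegral_of_continuous'
      (f := fun (x:ℝ) t => f (x, t)) (by unfold Function.uncurry; fun_prop) 0 1
  have c1 : Continuous h1 := by
    have := jc.comp (continuous_fst (X := ℝ) (Y := ℝ))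
    exact this.sub continuous_const
  have c2 : Continuous h2 := by
    have := jc.comp (continuous_fst (X := ℝ) (Y := ℝ))
    exact fc.sub this
  have p1 : ZSqPeriodic h1 := by
    intro x y
    simp only [hh1, (hp x _).1, and_self]
  have p2 : ZSqPeriodic h2 := by
    intro x y
    simp only [hh2, (hp x _).1, (hp x _).2, and_self]
  have z1 : ∀ y, ∫ t in (0:ℝ)..1, h1 (t, y) = 0 := by
    intro y
    simp only [hh1]
    rw [intervalIntegral.integral_sub (jc.intervalIntegrable _ _) (by simp)]
    simp [hm]
  have z2 : ∀ x, ∫ t in (0:ℝ)..1, h2 (x, t) = 0 := by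
    intro x
    simp only [hh2]
    have : Continuous fun t => f (x, t) := by fun_prop
    rw [intervalIntegral.integral_sub (this.intervalIntegrable _ _) (by simp)]
    simp
  have bA := per_BC (Ix_per c1 p1 z1) (Ix_cont c1)
  have bB := per_BC (Iy_per c2 p2 z2) (Iy_cont c2)
  obtain ⟨CA, hA⟩ := bA.2
  obtain ⟨CB, hB⟩ := bB.2
  set a1 := ∫ z : ℝ × ℝ, |z.1| ∂(G.prod G) with ha1
  set a2 := ∫ z : ℝ × ℝ, |z.2| ∂(G.prod G) with ha2
  have a1n : 0 ≤ a1 := integral_nonneg fun _ => abs_nonneg _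
  have a2n : 0 ≤ a2 := integral_nonneg fun _ => abs_nonneg _
  have CAn : 0 ≤ CA := (abs_nonneg _).trans (hA 0)
  have CBn : 0 ≤ CB := (abs_nonneg _).trans (hB 0)
  set K := CA * a1 + CB * a2 with hK
  have Kn : 0 ≤ K := by positivity
  set t := ε / (Real.pi * (K + 1)) with ht
  have tp : 0 < t := by have := Real.pi_pos; positivity
  set l := 2 * Real.pi * t^2 with hldef
  have hl : 0 < l := by have := Real.pi_pos; positivity
  have hsq : √(Real.pi / (l/2)) = 1 / t := by
    have : Real.pi / (l/2) = (1/t)^2 := by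
      rw [hldef]; have := Real.pi_pos; field_simp
    rw [this, Real.sqrt_sq (by positivity)]
  have hbd : ∀ p, |l * Av (kR l) (fun q => f q - m) p| ≤ ε := by
    intro p
    have e : (fun q => f q - m) = fun q => h1 q + h2 q := by
      ext q; simp only [hh1, hh2]; ring
    rw [e, Av_add (kR_int hl) (per_BC p1 c1) (per_BC p2 c2),
      ← Av_stein_x hl bA (per_BC p1 c1) (Ix_deriv c1),
      ← Av_stein_y hl bB (per_BC p2 c2) (Iy_deriv c2), abs_mul, abs_of_pos hl]
    have b1 := Av_abs_le (k1_int hl) hA p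
    have b2 := Av_abs_le (k2_int hl) hB p
    rw [k1_norm, hsq, ← ha1] at b1
    rw [k2_norm, hsq, ← ha2] at b2
    have b3 : |Av (k1 l) (Ix h1) p + Av (k2 l) (Iy h2) p| ≤ K * (1 / t / 2) := by
      refine (abs_add_le _ _).trans ((add_le_add b1 b2).trans (le_of_eq ?_))
      rw [hK]; ring
    calc l * |Av (k1 l) (Ix h1) p + Av (k2 l) (Iy h2) p| ≤ l * (K * (1 / t / 2)) :=
          mul_le_mul_of_nonneg_left b3 hl.le
      _ = K * (Real.pi * t) := by rw [hldef]; field_simp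
      _ ≤ (K + 1) * (Real.pi * t) := by
          have := Real.pi_pos
          exact mul_le_mul_of_nonneg_right (by linarith) (by positivity)
      _ = ε := by rw [ht]; have := Real.pi_pos; field_simp
  have hs : ContDiff ℝ (⊤ : ℕ∞) (fun q => f q - m) := hf.sub contDiff_const
  have hps : ZSqPeriodic (fun q => f q - m) := per_map hp (fun t => t - m)
  refine ⟨Av (kR l) (fun q => f q - m), R_smooth hl hs hps, Av_per hps, fun p => ?_⟩
  have := right_inv hl (contDiff_infty.1 hs 2) hps p
  have e : -lap (Av (kR l) fun q => f q - m) p - (f p - m) =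
    -(l * Av (kR l) (fun q => f q - m) p) := by
    linarith
  rw [e, abs_neg]
  exact hbd p


lemma scalar {l M a b P Q w : ℝ} (hP : 0 ≤ P) (hQ : 0 ≤ Q) (hl : Real.exp M * (P + Q) ≤ l)
    (hab : b ≤ a) (ha : |a| ≤ M) (hb : |b| ≤ M) :
    0 ≤ (l * a - P * Real.exp a + Q * Real.exp (-a) + w) -
      (l * b - P * Real.exp b + Q * Real.exp (-b) + w) ∧
    (l * a - P * Real.exp a + Q * Real.exp (-a) + w) -
      (l * b - P * Real.exp b + Q * Real.exp (-b) + w) ≤ (l - Real.exp (-M) * P) * (a - b) := by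
  obtain ⟨ha1, ha2⟩ := abs_le.1 ha
  obtain ⟨hb1, hb2⟩ := abs_le.1 hb
  have hd : 0 ≤ a - b := sub_nonneg.2 hab
  have key : ∀ s t : ℝ, Real.exp t * (s - t) ≤ Real.exp s - Real.exp t := by
    intro s t
    have h1 := Real.add_one_le_exp (s - t)
    have h2 : Real.exp s = Real.exp t * Real.exp (s - t) := by rw [← Real.exp_add]; ring_nf
    rw [h2]
    nlinarith [Real.exp_pos t]
  have e1 := key a b
  have e2 := key b a
  have e3 := key (-b) (-a)
  have e4 := key (-a) (-b)
  have m1 : Real.exp (-M) ≤ Real.exp b := Real.exp_le_exp.2 hb1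
  have m2 : Real.exp a ≤ Real.exp M := Real.exp_le_exp.2 ha2
  have m3 : Real.exp (-b) ≤ Real.exp M := Real.exp_le_exp.2 (by linarith)
  have m4 := Real.exp_pos (-a)
  have f1 : Real.exp (-M) * (a - b) ≤ Real.exp a - Real.exp b :=
    (mul_le_mul_of_nonneg_right m1 hd).trans e1
  have f2 : Real.exp a - Real.exp b ≤ Real.exp M * (a - b) := by
    have := mul_le_mul_of_nonneg_right m2 hd
    linarith
  have f3 : Real.exp (-b) - Real.exp (-a) ≤ Real.exp M * (a - b) := by
    have := mul_le_mul_of_nonneg_right m3 hd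
    linarith
  have f4 : 0 ≤ Real.exp (-b) - Real.exp (-a) := by
    have := mul_nonneg m4.le hd
    linarith
  have g1 := mul_le_mul_of_nonneg_left f1 hP
  have g2 := mul_le_mul_of_nonneg_left f2 hP
  have g3 := mul_le_mul_of_nonneg_left f3 hQ
  have g4 := mul_nonneg hQ f4
  have g5 := mul_le_mul_of_nonneg_right hl hd
  constructor <;> linarith

def FF (P Q w : ℝ × ℝ → ℝ) (l : ℝ) (u : ℝ × ℝ → ℝ) (q : ℝ × ℝ) : ℝ :=
  l * u q - P q * Real.exp (u q) + Q q * Real.exp (-(u q)) + w q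

lemma FF_per {P Q w u : ℝ × ℝ → ℝ} (l : ℝ) (hP : ZSqPeriodic P) (hQ : ZSqPeriodic Q)
    (hw : ZSqPeriodic w) (hu : ZSqPeriodic u) : ZSqPeriodic (FF P Q w l u) := by
  intro x y
  unfold FF
  simp only [(hP x y).1, (hQ x y).1, (hw x y).1, (hu x y).1,
    (hP x y).2, (hQ x y).2, (hw x y).2, (hu x y).2, and_self]

lemma FF_contDiff {P Q w u : ℝ × ℝ → ℝ} (l : ℝ) {n : WithTop ℕ∞} (hP : ContDiff ℝ n P)
    (hQ : ContDiff ℝ n Q)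
    (hw : ContDiff ℝ n w) (hu : ContDiff ℝ n u) : ContDiff ℝ n (FF P Q w l u) := by
  unfold FF
  exact (((contDiff_const.mul hu).sub (hP.mul hu.exp)).add (hQ.mul hu.neg.exp)).add hw

lemma FF_cont {P Q w u : ℝ × ℝ → ℝ} (l : ℝ) (hP : Continuous P) (hQ : Continuous Q)
    (hw : Continuous w) (hu : Continuous u) : Continuous (FF P Q w l u) := by
  unfold FF
  fun_prop

/-- the nonlinear map is a strict contraction in the sup norm -/
lemma contraction {P Q w : ℝ × ℝ → ℝ} (cP : Continuous P) (cQ : Continuous Q) (cw : Continuous w)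
    (hP : ZSqPeriodic P) (hQ : ZSqPeriodic Q) (hw : ZSqPeriodic w)
    (P0 : ∀ p, 0 ≤ P p) (Q0 : ∀ p, 0 ≤ Q p) {q} (hq : 0 < P q) {l M : ℝ} (hl : 0 < l)
    (hlM : ∀ p, Real.exp M * (P p + Q p) ≤ l) (hM : 0 ≤ M) :
    ∃ K : ℝ, 0 ≤ K ∧ K < 1 ∧ ∀ u v : ℝ × ℝ → ℝ, Continuous u → Continuous v → ZSqPeriodic u →
      ZSqPeriodic v → (∀ p, |u p| ≤ M) → (∀ p, |v p| ≤ M) → ∀ D, (∀ p, |u p - v p| ≤ D) →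
      ∀ p, |Av (kR l) (FF P Q w l u) p - Av (kR l) (FF P Q w l v) p| ≤ K * D := by
  set V : ℝ × ℝ → ℝ := fun p => Real.exp (-M) * P p with hVdef
  have cV : Continuous V := by fun_prop
  have pV : ZSqPeriodic V := per_map hP (fun t => Real.exp (-M) * t)
  have V0 : ∀ p, 0 ≤ V p := fun p => mul_nonneg (Real.exp_pos _).le (P0 p)
  have bV := per_BC pV cV
  have Vl : ∀ p, V p ≤ l := by
    intro p
    refine le_trans ?_ (hlM p)
    refine mul_le_mul (Real.exp_le_exp.2 (by linarith)) (by linarith [Q0 p]) (P0 p)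
      (Real.exp_pos _).le
  obtain ⟨δ, δ0, hδ⟩ := per_pos (Av_per pV) (Av_cont (kR_int hl) bV)
    (R_pos hl bV V0 (q := q) (mul_pos (Real.exp_pos _) hq))
  have bc : ∀ c : ℝ, BC (fun _ => c) := fun c => per_BC (per_const c) continuous_const
  have δ1 : δ ≤ 1 := by
    refine (hδ 0).trans ?_
    have := R_mono hl bV (bc l) Vl 0
    rwa [R_const hl, div_self hl.ne'] at this
  refine ⟨1 - δ, by linarith, by linarith, ?_⟩
  intro u v cu cv pu pv uM vM D hD p
  have D0 : 0 ≤ D := (abs_nonneg _).trans (hD p)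
  have bFu := per_BC (FF_per l hP hQ hw pu) (FF_cont l cP cQ cw cu)
  have bFv := per_BC (FF_per l hP hQ hw pv) (FF_cont l cP cQ cw cv)
  have pt : ∀ p, |FF P Q w l u p - FF P Q w l v p| ≤ (l - V p) * D := by
    intro p
    have hlV : 0 ≤ l - V p := sub_nonneg.2 (Vl p)
    refine le_trans ?_ (mul_le_mul_of_nonneg_left (hD p) hlV)
    rcases le_total (v p) (u p) with h | h
    · obtain ⟨s1, s2⟩ := scalar (w := w p) (P0 p) (Q0 p) (hlM p) h (uM p) (vM p)
      have s1' : 0 ≤ FF P Q w l u p - FF P Q w l v p := s1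
      rw [abs_of_nonneg (sub_nonneg.2 h), abs_of_nonneg s1']
      exact s2
    · obtain ⟨s1, s2⟩ := scalar (w := w p) (P0 p) (Q0 p) (hlM p) h (vM p) (uM p)
      have s1' : 0 ≤ FF P Q w l v p - FF P Q w l u p := s1
      rw [abs_sub_comm, abs_sub_comm (u p), abs_of_nonneg (sub_nonneg.2 h), abs_of_nonneg s1']
      exact s2
  have pg : ZSqPeriodic (fun q => (l - V q) * D) := per_map pV (fun t => (l - t) * D)
  have bg : BC (fun q => (l - V q) * D) := per_BC pg (by fun_prop)
  have bg' : BC (fun q => -((l - V q) * D)) := per_BC (per_map pg (fun t => -t)) (by fun_prop)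
  have bd : BC (fun q => FF P Q w l u q - FF P Q w l v q) :=
    per_BC (per_map2 (FF_per l hP hQ hw pu) (FF_per l hP hQ hw pv) (fun a b => a - b))
      (bFu.1.sub bFv.1)
  have Rg : Av (kR l) (fun q => (l - V q) * D) p = D * (1 - Av (kR l) V p) := by
    have e : (fun q => (l - V q) * D) = fun q => D * (l - V q) := by ext q; ring
    rw [e, Av_smul, Av_sub (kR_int hl) (bc l) bV, R_const hl, div_self hl.ne']
  have Rg' : Av (kR l) (fun q => -((l - V q) * D)) p = -(D * (1 - Av (kR l) V p)) := by
    have e : (fun q => -((l - V q) * D)) = fun q => (-1) * ((l - V q) * D) := by ext q; ring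
    rw [e, Av_smul, Rg]; ring
  have up := R_mono hl bd bg (fun q => (abs_le.1 (pt q)).2) p
  have lo := R_mono hl bg' bd (fun q => (abs_le.1 (pt q)).1) p
  rw [Av_sub (kR_int hl) bFu bFv] at up lo
  rw [Rg] at up
  rw [Rg'] at lo
  have fin : D * (1 - Av (kR l) V p) ≤ (1 - δ) * D := by nlinarith [hδ p]
  exact abs_le.2 ⟨by linarith, by linarith⟩

lemma exists_l {P Q : ℝ × ℝ → ℝ} (cP : Continuous P) (cQ : Continuous Q)
    (hP : ZSqPeriodic P) (hQ : ZSqPeriodic Q) (M : ℝ) :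
    ∃ l : ℝ, 0 < l ∧ ∀ p, Real.exp M * (P p + Q p) ≤ l := by
  obtain ⟨C, hC⟩ := (per_BC (per_map2 hP hQ (fun a b => Real.exp M * (a + b)))
    (by fun_prop)).2
  refine ⟨max C 1, by positivity, fun p => (le_abs_self _).trans ((hC p).trans (le_max_left _ _))⟩

/-- a solution is a fixed point -/
lemma sol_fixed {P Q w u : ℝ × ℝ → ℝ} {l : ℝ} (hl : 0 < l) (hu : ContDiff ℝ (⊤ : ℕ∞) u)
    (pu : ZSqPeriodic u)
    (h : ∀ p, posLaplacian u p + P p * Real.exp (u p) - Q p * Real.exp (-(u p)) = w p) (p) :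
    Av (kR l) (FF P Q w l u) p = u p := by
  rw [← resolvent hl (contDiff_infty.1 hu 2) pu p]
  congr 1; ext q
  have := h q
  have e : posLaplacian u q = -lap u q := rfl
  rw [e] at this
  unfold FF
  linarith

lemma uniq {P Q w : ℝ × ℝ → ℝ} (cP : Continuous P) (cQ : Continuous Q) (cw : Continuous w)
    (hP : ZSqPeriodic P) (hQ : ZSqPeriodic Q) (hw : ZSqPeriodic w)
    (P0 : ∀ p, 0 ≤ P p) (Q0 : ∀ p, 0 ≤ Q p) {q} (hq : 0 < P q) {u v : ℝ × ℝ → ℝ}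
    (hu : ContDiff ℝ (⊤ : ℕ∞) u) (pu : ZSqPeriodic u)
    (h : ∀ p, posLaplacian u p + P p * Real.exp (u p) - Q p * Real.exp (-(u p)) = w p)
    (hv : ContDiff ℝ (⊤ : ℕ∞) v) (pv : ZSqPeriodic v)
    (h' : ∀ p, posLaplacian v p + P p * Real.exp (v p) - Q p * Real.exp (-(v p)) = w p) :
    u = v := by
  obtain ⟨M1, h1⟩ := (per_BC pu hu.continuous).2
  obtain ⟨M2, h2⟩ := (per_BC pv hv.continuous).2
  have M10 : 0 ≤ M1 := (abs_nonneg _).trans (h1 0)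
  have M20 : 0 ≤ M2 := (abs_nonneg _).trans (h2 0)
  obtain ⟨l, hl, hlM⟩ := exists_l cP cQ hP hQ (M1 + M2)
  obtain ⟨K, K0, K1, hK⟩ := contraction cP cQ cw hP hQ hw P0 Q0 hq hl hlM (by linarith)
  have step : ∀ D, (∀ p, |u p - v p| ≤ D) → ∀ p, |u p - v p| ≤ K * D := by
    intro D hD p
    have := hK u v hu.continuous hv.continuous pu pv (fun p => (h1 p).trans (by linarith))
      (fun p => (h2 p).trans (by linarith)) D hD p
    rwa [sol_fixed hl hu pu h, sol_fixed hl hv pv h'] at this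
  have it : ∀ n : ℕ, ∀ p, |u p - v p| ≤ K^n * (M1 + M2) := by
    intro n
    induction n with
    | zero =>
      intro p
      simpa using (abs_sub _ _).trans (add_le_add (h1 p) (h2 p))
    | succ n ih =>
      intro p
      refine (step _ ih p).trans (le_of_eq ?_)
      ring
  ext p
  have lim : Tendsto (fun n : ℕ => K^n * (M1 + M2)) atTop (𝓝 0) := by
    simpa using (tendsto_pow_atTop_nhds_zero_of_lt_one K0 K1).mul_const (M1 + M2)
  have := ge_of_tendsto' lim (fun n => it n p)
  exact sub_eq_zero.1 (abs_eq_zero.1 (le_antisymm this (abs_nonneg _)))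


lemma dx_lin {f g : ℝ × ℝ → ℝ} (hf : ContDiff ℝ 1 f) (hg : ContDiff ℝ 1 g) (a c : ℝ) :
    dx (fun q => f q - a * g q + c) = fun q => dx f q - a * dx g q + 0 := by
  ext p
  have := ((hasDerivAt_dx hf p).sub ((hasDerivAt_dx hg p).const_mul a)).add_const c
  rw [add_zero]
  exact this.deriv

lemma dy_lin {f g : ℝ × ℝ → ℝ} (hf : ContDiff ℝ 1 f) (hg : ContDiff ℝ 1 g) (a c : ℝ) :
    dy (fun q => f q - a * g q + c) = fun q => dy f q - a * dy g q + 0 := by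
  ext p
  have := ((hasDerivAt_dy hf p).sub ((hasDerivAt_dy hg p).const_mul a)).add_const c
  rw [add_zero]
  exact this.deriv

lemma lap_lin {f g : ℝ × ℝ → ℝ} (hf : ContDiff ℝ (2:ℕ) f) (hg : ContDiff ℝ (2:ℕ) g) (a c : ℝ) (p) :
    lap (fun q => f q - a * g q + c) p = lap f p - a * lap g p := by
  have hf1 : ContDiff ℝ 1 f := hf.of_le (by norm_num)
  have hg1 : ContDiff ℝ 1 g := hg.of_le (by norm_num)
  have cx : ContDiff ℝ (1:ℕ) (dx f) := dx_contDiff hf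
  have cy : ContDiff ℝ (1:ℕ) (dy f) := dy_contDiff hf
  have gx : ContDiff ℝ (1:ℕ) (dx g) := dx_contDiff hg
  have gy : ContDiff ℝ (1:ℕ) (dy g) := dy_contDiff hg
  unfold lap
  rw [dx_lin hf1 hg1, dy_lin hf1 hg1, dx_lin (by exact_mod_cast cx) (by exact_mod_cast gx),
    dy_lin (by exact_mod_cast cy) (by exact_mod_cast gy)]
  ring

/-- existence between ordered sub and super solutions -/
lemma exist_between {P Q w : ℝ × ℝ → ℝ} (sP : ContDiff ℝ (⊤ : ℕ∞) P) (sQ : ContDiff ℝ (⊤ : ℕ∞) Q)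
    (sw : ContDiff ℝ (⊤ : ℕ∞) w)
    (hP : ZSqPeriodic P) (hQ : ZSqPeriodic Q) (hw : ZSqPeriodic w)
    (P0 : ∀ p, 0 ≤ P p) (Q0 : ∀ p, 0 ≤ Q p) {q} (hq : 0 < P q) {a b : ℝ × ℝ → ℝ}
    (sa : ContDiff ℝ (⊤ : ℕ∞) a) (sb : ContDiff ℝ (⊤ : ℕ∞) b) (pa : ZSqPeriodic a)
    (pb : ZSqPeriodic b) (hab : ∀ p, a p ≤ b p)
    (ha : ∀ p, -lap a p + P p * Real.exp (a p) - Q p * Real.exp (-(a p)) ≤ w p)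
    (hb : ∀ p, w p ≤ -lap b p + P p * Real.exp (b p) - Q p * Real.exp (-(b p))) :
    ∃ u, ContDiff ℝ (⊤ : ℕ∞) u ∧ ZSqPeriodic u ∧
      ∀ p, posLaplacian u p + P p * Real.exp (u p) - Q p * Real.exp (-(u p)) = w p := by
  have cP := sP.continuous
  have cQ := sQ.continuous
  have cw := sw.continuous
  obtain ⟨M1, h1⟩ := (per_BC pa sa.continuous).2
  obtain ⟨M2, h2⟩ := (per_BC pb sb.continuous).2
  have M10 : 0 ≤ M1 := (abs_nonneg _).trans (h1 0)
  have M20 : 0 ≤ M2 := (abs_nonneg _).trans (h2 0)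
  obtain ⟨l, hl, hlM⟩ := exists_l cP cQ hP hQ (M1 + M2)
  obtain ⟨K, K0, K1, hK⟩ := contraction cP cQ cw hP hQ hw P0 Q0 hq hl hlM (by linarith)
  have bd : ∀ u : ℝ × ℝ → ℝ, (∀ p, a p ≤ u p ∧ u p ≤ b p) → ∀ p, |u p| ≤ M1 + M2 := by
    intro u hu p
    have e1 := (abs_le.1 (h1 p)).1
    have e2 := (abs_le.1 (h2 p)).2
    have := hu p
    exact abs_le.2 ⟨by linarith, by linarith⟩
  have bF : ∀ u : ℝ × ℝ → ℝ, Continuous u → ZSqPeriodic u → BC (FF P Q w l u) := fun u cu pu =>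
    per_BC (FF_per l hP hQ hw pu) (FF_cont l cP cQ cw cu)
  have mono : ∀ u v : ℝ × ℝ → ℝ, Continuous u → ZSqPeriodic u → Continuous v → ZSqPeriodic v →
      (∀ p, |u p| ≤ M1 + M2) → (∀ p, |v p| ≤ M1 + M2) → (∀ p, u p ≤ v p) →
      ∀ p, Av (kR l) (FF P Q w l u) p ≤ Av (kR l) (FF P Q w l v) p := by
    intro u v cu pu cv pv hu hv huv p
    refine R_mono hl (bF u cu pu) (bF v cv pv) (fun p => ?_) p
    exact sub_nonneg.1 (scalar (w := w p) (P0 p) (Q0 p) (hlM p) (huv p) (hv p) (hu p)).1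
  have bl : ∀ u : ℝ × ℝ → ℝ, ContDiff ℝ (⊤ : ℕ∞) u → ZSqPeriodic u →
      BC (fun q => l * u q - lap u q) := by
    intro u su pu
    have c1 := su.continuous
    have c2 := lap_cont (contDiff_infty.1 su 2)
    exact per_BC (per_map2 pu (lap_per pu) (fun s t => l * s - t)) (by fun_prop)
  have am : ∀ p, |a p| ≤ M1 + M2 := bd a (fun p => ⟨le_rfl, hab p⟩)
  have bm : ∀ p, |b p| ≤ M1 + M2 := bd b (fun p => ⟨hab p, le_rfl⟩)
  have low : ∀ p, a p ≤ Av (kR l) (FF P Q w l a) p := by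
    intro p
    rw [← resolvent hl (contDiff_infty.1 sa 2) pa p]
    refine R_mono hl (bl a sa pa) (bF a sa.continuous pa) (fun q => ?_) p
    have := ha q
    unfold FF
    linarith
  have high : ∀ p, Av (kR l) (FF P Q w l b) p ≤ b p := by
    intro p
    conv_rhs => rw [← resolvent hl (contDiff_infty.1 sb 2) pb p]
    refine R_mono hl (bF b sb.continuous pb) (bl b sb pb) (fun q => ?_) p
    have := hb q
    unfold FF
    linarith
  classical
  let T : BoundedContinuousFunction (ℝ × ℝ) ℝ → BoundedContinuousFunction (ℝ × ℝ) ℝ := fun u =>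
    if h : BC (Av (kR l) (FF P Q w l u)) then
      BoundedContinuousFunction.ofNormedAddCommGroup _ h.1 h.2.choose h.2.choose_spec else u
  have Tval : ∀ u : BoundedContinuousFunction (ℝ × ℝ) ℝ, ZSqPeriodic u → ∀ p,
      T u p = Av (kR l) (FF P Q w l u) p := by
    intro u pu p
    have h : BC (Av (kR l) (FF P Q w l u)) := Av_BC (kR_int hl) (bF u u.continuous pu)
    simp only [T, dif_pos h]
    rfl
  let S : Set (BoundedContinuousFunction (ℝ × ℝ) ℝ) :=
    {u | ZSqPeriodic u ∧ ∀ p, a p ≤ u p ∧ u p ≤ b p}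
  have ev : ∀ p, Continuous (fun u : BoundedContinuousFunction (ℝ × ℝ) ℝ => u p) := fun p =>
    continuous_eval_const p
  have Scl : IsClosed S := by
    have e : S = (⋂ x : ℝ, ⋂ y : ℝ, ({u | u (x + 1, y) = u (x, y)} ∩ {u | u (x, y + 1) = u (x, y)})) ∩
        ⋂ p, ({u | a p ≤ u p} ∩ {u | u p ≤ b p}) := by
      ext u
      simp only [mem_inter_iff, mem_iInter]
      exact Iff.rfl
    rw [e]
    refine IsClosed.inter ?_ ?_
    · refine isClosed_iInter fun x => isClosed_iInter fun y => ?_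
      exact (isClosed_eq (ev _) (ev _)).inter (isClosed_eq (ev _) (ev _))
    · refine isClosed_iInter fun x => ?_
      exact (isClosed_le continuous_const (ev _)).inter (isClosed_le (ev _) continuous_const)
  have Smap : MapsTo T S S := by
    rintro u ⟨pu, hu⟩
    have e : (T u : ℝ × ℝ → ℝ) = Av (kR l) (FF P Q w l u) := funext (Tval u pu)
    refine ⟨?_, fun p => ?_⟩
    · rw [e]; exact Av_per (FF_per l hP hQ hw pu)
    · rw [Tval u pu]
      exact ⟨(low p).trans (mono a u sa.continuous pa u.continuous pu am (bd u hu)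
          (fun p => (hu p).1) p),
        (mono u b u.continuous pu sb.continuous pb (bd u hu) bm
          (fun p => (hu p).2) p).trans (high p)⟩
  have Tc : ContractingWith (⟨K, K0⟩ : NNReal) (Smap.restrict T S S) := by
    refine ⟨by exact_mod_cast K1, LipschitzWith.of_dist_le_mul ?_⟩
    rintro ⟨u, pu, hu⟩ ⟨v, pv, hv⟩
    change dist (T u) (T v) ≤ K * dist u v
    refine (BoundedContinuousFunction.dist_le (by positivity)).2 fun p => ?_
    rw [Tval u pu, Tval v pv, Real.dist_eq]
    refine hK u v u.continuous v.continuous pu pv (bd u hu) (bd v hv) _ (fun p => ?_) p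
    rw [← Real.dist_eq]
    exact BoundedContinuousFunction.dist_coe_le_dist p
  obtain ⟨Ca, hCa⟩ := (per_BC pa sa.continuous).2
  let a0 : BoundedContinuousFunction (ℝ × ℝ) ℝ :=
    BoundedContinuousFunction.ofNormedAddCommGroup a sa.continuous Ca hCa
  have a0S : a0 ∈ S := ⟨pa, fun p => ⟨le_rfl, hab p⟩⟩
  obtain ⟨u, ⟨pu, hu⟩, fix, -⟩ := Tc.exists_fixedPoint' Scl.isComplete Smap a0S (edist_ne_top _ _)
  have fx : (u : ℝ × ℝ → ℝ) = Av (kR l) (FF P Q w l u) := by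
    ext p
    rw [← Tval u pu p, fix]
  have reg : ∀ k : ℕ, ContDiff ℝ k (u : ℝ × ℝ → ℝ) := by
    intro k
    induction k with
    | zero => exact_mod_cast contDiff_zero.2 u.continuous
    | succ k ih =>
      rw [fx]
      exact R_gain hl (FF_contDiff l (contDiff_infty.1 sP k) (contDiff_infty.1 sQ k)
        (contDiff_infty.1 sw k) ih) (FF_per l hP hQ hw pu)
  refine ⟨u, contDiff_infty.2 reg, pu, fun p => ?_⟩
  have := right_inv hl (FF_contDiff l (contDiff_infty.1 sP 2) (contDiff_infty.1 sQ 2)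
        (contDiff_infty.1 sw 2) (reg 2)) (FF_per l hP hQ hw pu) p
  rw [← fx] at this
  have e : posLaplacian u p = -lap u p := rfl
  rw [e]
  unfold FF at this
  linarith

lemma int_mono {f g : ℝ × ℝ → ℝ} (hf : Continuous f) (hg : Continuous g) (h : ∀ p, f p ≤ g p) :
    (∫ x in (0:ℝ)..1, ∫ y in (0:ℝ)..1, f (x, y)) ≤ ∫ x in (0:ℝ)..1, ∫ y in (0:ℝ)..1, g (x, y) := by
  have c : ∀ f : ℝ × ℝ → ℝ, Continuous f → Continuous (fun x => ∫ y in (0:ℝ)..1, f (x, y)) :=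
    fun f hf => intervalIntegral.continuous_parametric_intervalIntegral_of_continuous'
      (f := fun x y => f (x, y)) (by simpa [Function.uncurry_def] using hf) 0 1
  refine intervalIntegral.integral_mono_on zero_le_one ((c f hf).intervalIntegrable _ _)
    ((c g hg).intervalIntegrable _ _) fun x _ => ?_
  have cf : Continuous fun y => f (x, y) := by fun_prop
  have cg : Continuous fun y => g (x, y) := by fun_prop
  exact intervalIntegral.integral_mono_on zero_le_one (cf.intervalIntegrable _ _)
    (cg.intervalIntegrable _ _) fun y _ => h _

lemma main {P Q w : ℝ × ℝ → ℝ} (sP : ContDiff ℝ (⊤ : ℕ∞) P) (sQ : ContDiff ℝ (⊤ : ℕ∞) Q)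
    (sw : ContDiff ℝ (⊤ : ℕ∞) w)
    (hP : ZSqPeriodic P) (hQ : ZSqPeriodic Q) (hw : ZSqPeriodic w)
    (P0 : ∀ p, 0 ≤ P p) (Q0 : ∀ p, 0 ≤ Q p)
    (hPQ : 0 < ∫ x in (0:ℝ)..1, ∫ y in (0:ℝ)..1, (P (x, y) - Q (x, y)))
    (hwi : 0 < ∫ x in (0:ℝ)..1, ∫ y in (0:ℝ)..1, w (x, y)) :
    (∃ q, 0 < P q) ∧ ∃ u, ContDiff ℝ (⊤ : ℕ∞) u ∧ ZSqPeriodic u ∧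
      ∀ p, posLaplacian u p + P p * Real.exp (u p) - Q p * Real.exp (-(u p)) = w p := by
  have cP := sP.continuous
  have cQ := sQ.continuous
  have iP : 0 < ∫ x in (0:ℝ)..1, ∫ y in (0:ℝ)..1, P (x, y) :=
    hPQ.trans_le (int_mono (f := fun q => P q - Q q) (cP.sub cQ) cP
      (fun p => by linarith [Q0 p]))
  have hex : ∃ q, 0 < P q := by
    by_contra! hn
    have : ∀ q, P q = 0 := fun q => le_antisymm (hn q) (P0 q)
    simp [this] at iP
  refine ⟨hex, ?_⟩
  obtain ⟨q, hq⟩ := hex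
  obtain ⟨f, sf, pf, hf⟩ := poisson sw hw (half_pos hwi)
  obtain ⟨g, sg, pg, hg⟩ := poisson sP hP (half_pos iP)
  generalize (∫ x in (0:ℝ)..1, ∫ y in (0:ℝ)..1, w (x, y)) = W at *
  generalize (∫ x in (0:ℝ)..1, ∫ y in (0:ℝ)..1, P (x, y)) = I at *
  have f2 := contDiff_infty.1 sf 2
  have g2 := contDiff_infty.1 sg 2
  set A := (3 * W + 2) / I with hA
  have AI : A * I = 3 * W + 2 := by rw [hA]; field_simp
  have A0 : 0 < A := by positivity
  obtain ⟨CP, hCP⟩ := (per_BC hP cP).2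
  obtain ⟨CQ, hCQ⟩ := (per_BC hQ cQ).2
  obtain ⟨C1, h1⟩ := (per_BC pf sf.continuous).2
  have ph : ZSqPeriodic (fun q => f q - A * g q) := per_map2 pf pg (fun s t => s - A * t)
  obtain ⟨C2, h2⟩ := (per_BC ph (sf.continuous.sub (sg.continuous.const_mul A) :)).2
  have lim : ∀ c d : ℝ, Tendsto (fun t => c * Real.exp (d - t)) atTop (𝓝 0) := by
    intro c d
    have : Tendsto (fun t : ℝ => d - t) atTop atBot :=
      tendsto_atBot_add_const_left _ d tendsto_neg_atTop_atBot
    simpa using (Real.tendsto_exp_atBot.comp this).const_mul c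
  have limt : ∀ d : ℝ, Tendsto (fun t => Real.exp (t - d)) atTop atTop := fun d =>
    Real.tendsto_exp_atTop.comp (tendsto_atTop_add_const_right _ (-d) tendsto_id)
  obtain ⟨β, hβ⟩ := ((lim CP C1).eventually (ge_mem_nhds (half_pos hwi))).exists
  obtain ⟨t, ht1, ht2, ht3⟩ := (((limt C2).eventually (eventually_ge_atTop A)).and
    (((lim CQ C2).eventually (ge_mem_nhds one_pos)).and
      (eventually_ge_atTop (C1 + C2 - β)))).exists
  refine exist_between sP sQ sw hP hQ hw P0 Q0 hq (a := fun q => f q - 0 * g q + (-β))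
    (b := fun q => f q - A * g q + t)
    ((sf.sub (contDiff_const.mul sg)).add contDiff_const)
    ((sf.sub (contDiff_const.mul sg)).add contDiff_const)
    (per_map2 pf pg (fun r s => r - 0 * s + (-β))) (per_map2 pf pg (fun r s => r - A * s + t))
    ?_ ?_ ?_
  · intro p
    have e1 := (abs_le.1 (h1 p)).2
    have e2 := (abs_le.1 (h2 p)).1
    simp only [] at *
    linarith
  · intro p
    rw [lap_lin f2 g2]
    have e1 := (abs_le.1 (h1 p)).2
    have e3 := (abs_le.1 (hf p)).2
    have x1 : Real.exp (f p - 0 * g p + (-β)) ≤ Real.exp (C1 - β) :=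
      Real.exp_le_exp.2 (by linarith)
    have x2 : P p * Real.exp (f p - 0 * g p + (-β)) ≤ CP * Real.exp (C1 - β) :=
      mul_le_mul ((le_abs_self _).trans (hCP p)) x1 (Real.exp_pos _).le
        ((abs_nonneg _).trans (hCP p))
    have x3 := mul_nonneg (Q0 p) (Real.exp_pos (-(f p - 0 * g p + (-β)))).le
    linarith
  · intro p
    rw [lap_lin f2 g2]
    have e2 := (abs_le.1 (h2 p)).1
    have e3 := (abs_le.1 (hf p)).1
    have e4 := (abs_le.1 (hg p)).2
    simp only [] at e2
    have x1 : A ≤ Real.exp (f p - A * g p + t) :=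
      le_trans ht1 (Real.exp_le_exp.2 (by linarith))
    have x2 := mul_le_mul_of_nonneg_left x1 (P0 p)
    have x3 : Real.exp (-(f p - A * g p + t)) ≤ Real.exp (C2 - t) :=
      Real.exp_le_exp.2 (by linarith)
    have x4 : Q p * Real.exp (-(f p - A * g p + t)) ≤ CQ * Real.exp (C2 - t) :=
      mul_le_mul ((le_abs_self _).trans (hCQ p)) x3 (Real.exp_pos _).le
        ((abs_nonneg _).trans (hCQ p))
    have x5 := mul_le_mul_of_nonneg_left e4 A0.le
    have x6 : A * (I / 2) = (3 * W + 2) / 2 := by rw [← AI]; ring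
    have x7 : A * (-lap g p - (P p - I)) = -(A * lap g p) - P p * A + A * I := by ring
    rw [x6, x7, AI] at x5
    linarith

end

end KW

/-- Bryan–Wentworth: For smooth `ℤ²`-periodic `P, Q, w : ℝ² → ℝ`
with `P ≥ 0`, `Q ≥ 0`, `∫_{[0,1]²} (P − Q) > 0` and `∫_{[0,1]²} w > 0`, there
is a unique smooth `ℤ²`-periodic `u : ℝ² → ℝ` with
`Δu + P e^u − Q e^{−u} = w` on `ℝ²` (with `Δ` the positive Laplacian). -/
theorem statement5 (P Q w : ℝ × ℝ → ℝ)
    (hPsmooth : ContDiff ℝ (⊤ : ℕ∞) P) (hQsmooth : ContDiff ℝ (⊤ : ℕ∞) Q)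
    (hwsmooth : ContDiff ℝ (⊤ : ℕ∞) w)
    (hPper : ZSqPeriodic P) (hQper : ZSqPeriodic Q) (hwper : ZSqPeriodic w)
    (hPnonneg : ∀ p, 0 ≤ P p) (hQnonneg : ∀ p, 0 ≤ Q p)
    (hPQint : 0 < ∫ x in (0:ℝ)..1, ∫ y in (0:ℝ)..1, (P (x, y) - Q (x, y)))
    (hwint : 0 < ∫ x in (0:ℝ)..1, ∫ y in (0:ℝ)..1, w (x, y)) :
    ∃! u : ℝ × ℝ → ℝ, ContDiff ℝ (⊤ : ℕ∞) u ∧ ZSqPeriodic u ∧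
      ∀ p : ℝ × ℝ,
        posLaplacian u p + P p * Real.exp (u p) - Q p * Real.exp (-(u p)) = w p := by
  obtain ⟨⟨q, hq⟩, u, su, pu, hu⟩ := KW.main hPsmooth hQsmooth hwsmooth hPper hQper hwper
    hPnonneg hQnonneg hPQint hwint
  refine ⟨u, ⟨su, pu, hu⟩, ?_⟩
  rintro v ⟨sv, pv, hv⟩
  exact KW.uniq hPsmooth.continuous hQsmooth.continuous hwsmooth.continuous hPper hQper hwper
    hPnonneg hQnonneg hq sv pv hv su pu hu
end
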